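/- Let c ∈ [1, 16/15), h ∈ F_c, φ the inverse of h, N prime, W ∈ [1/8 · log log N, 1/2 · log log N] an integer, m = ∏_{p ∈ P, p ≤ W} p, 0 ≤ b ≤ m − 1 with gcd(b, m) = 1, and A ⊆ {1, ..., ⌊N/2⌋}. Define a(x) = 1_A(x) λ^h_{b,m,N}(x) on ℤ_N, and for δ, ε ∈ (0,1) set R = {ξ ∈ ℤ_N : |F_{ℤ_N}[a](ξ)| ≥ δ}, k = |R|, B = {x ∈ ℤ_N : ‖xξ/N‖ ≤ ε for all ξ ∈ R} (where ‖t‖ is the distance of t to the nearest integer), β = |B|^{−1} 1_B, and a₁ = a * β * β. Suppose ε^k ≥ log log W / W. Then, for sufficiently large N, there is a constant C_φ ≥ 2 depending only on h such that ‖a₁‖_{ℓ^∞(ℤ_N)} ≤ C_φ / N. -/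

import Mathlib

open Filter Real Set
open scoped Classical

structure Fc (c : ℝ) where
  x₀ : ℝ
  one_le_x₀ : 1 ≤ x₀
  toFun : ℝ → ℝ
  vth : ℝ → ℝ
  Ch : ℝ
  Ch_pos : 0 < Ch
  one_le : ∀ x ≥ x₀, 1 ≤ toFun x
  contDiffOn : ContDiffOn ℝ 3 toFun (Set.Ici x₀)
  deriv_pos : ∀ x ≥ x₀, 0 < deriv toFun x
  deriv2_pos : ∀ x ≥ x₀, 0 < iteratedDeriv 2 toFun x
  vth_contDiffOn : ContDiffOn ℝ 2 vth (Set.Ici x₀)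
  eqn : ∀ x ≥ x₀, toFun x = Ch * x ^ c * Real.exp (∫ t in x₀..x, vth t / t)
  cond_gt : 1 < c →
    Filter.Tendsto vth Filter.atTop (nhds 0) ∧
    Filter.Tendsto (fun x => x * deriv vth x) Filter.atTop (nhds 0) ∧
    Filter.Tendsto (fun x => x ^ 2 * deriv (deriv vth) x) Filter.atTop (nhds 0)
  cond_eq : c = 1 →
    (∀ x ≥ x₀, 0 < vth x) ∧
    (∀ x y, x₀ ≤ x → x ≤ y → vth y ≤ vth x) ∧
    (∀ ε : ℝ, 0 < ε → ∃ C > 0, ∀ x ≥ x₀, 1 / vth x ≤ C * x ^ ε) ∧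
    Filter.Tendsto (fun x => x / toFun x) Filter.atTop (nhds 0) ∧
    Filter.Tendsto vth Filter.atTop (nhds 0) ∧
    Filter.Tendsto (fun x => x * deriv vth x / vth x) Filter.atTop (nhds 0) ∧
    Filter.Tendsto (fun x => x ^ 2 * deriv (deriv vth) x / vth x) Filter.atTop (nhds 0)

def Ph {c : ℝ} (F : Fc c) : Set ℕ :=
  {p : ℕ | p.Prime ∧ ∃ n : ℕ, F.x₀ ≤ (n : ℝ) ∧ (p : ℤ) = ⌊F.toFun n⌋}

noncomputable def e (t : ℝ) : ℂ := Complex.exp (2 * Real.pi * Complex.I * t)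

/-- The measure `λ^h_{b,m,N}` on `Λ^h_{b,m,N} = {0 ≤ n ≤ N : mn + b ∈ P_h}`:
`λ^h_{b,m,N}(n) = ϕ(m) log(mn+b) / (m N φ'(mn+b))` there and `0` otherwise. -/
noncomputable def lamh {c : ℝ} (F : Fc c) (φ : ℝ → ℝ) (b m N n : ℕ) : ℝ :=
  if n ≤ N ∧ m * n + b ∈ Ph F then
    (Nat.totient m : ℝ) * Real.log (m * n + b) / (m * N * deriv φ ((m * n + b : ℕ) : ℝ))
  else 0

/-- The Fourier transform on `ℤ_N` of a real-valued function (regarded on `{0, …, N-1}`):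
`F_{ℤ_N}[f](ξ) = ∑_{x ∈ ℤ_N} f(x) e^{-2πiξx/N}`. -/
noncomputable def fourierZN (N : ℕ) (f : ℕ → ℝ) (ξ : ℕ) : ℂ :=
  ∑ n ∈ Finset.range N, (f n : ℂ) * e (-((ξ : ℝ) * n / N))

/-- Convolution on `ℤ_N` (with `{0, …, N-1}` as a set of representatives):
`(f * g)(x) = ∑_{y ∈ ℤ_N} f(x - y) g(y)`. -/
noncomputable def convZN (N : ℕ) (f g : ℕ → ℝ) (x : ℕ) : ℝ :=
  ∑ y ∈ Finset.range N, f ((x + (N - y)) % N) * g y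

/-- The distance of `t ∈ ℝ` to the nearest integer. -/
noncomputable def nint (t : ℝ) : ℝ := |t - round t|

/-- The trilinear form `Λ₃(f, g, h) = ∑_{x, d ∈ ℤ_N} f(x) g(x+d) h(x+2d)` on `ℤ_N`. -/
noncomputable def lam3 (N : ℕ) (f g h : ℕ → ℝ) : ℝ :=
  ∑ x ∈ Finset.range N, ∑ d ∈ Finset.range N,
    f x * g ((x + d) % N) * h ((x + 2 * d) % N)

lemma e_eq (t : ℝ) : e t = Complex.exp (Complex.I * ((2 * π * t : ℝ) : ℂ)) := by
  unfold e; congr 1; push_cast; ring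

lemma e_add (s t : ℝ) : e (s + t) = e s * e t := by
  unfold e; rw [← Complex.exp_add]; congr 1; push_cast; ring

lemma e_zero : e 0 = 1 := by simp [e]

lemma norm_e (t : ℝ) : ‖e t‖ = 1 := by
  rw [e_eq, mul_comm, Complex.norm_exp_ofReal_mul_I]

lemma e_neg (t : ℝ) : e (-t) = (starRingEnd ℂ) (e t) := by
  unfold e; rw [← Complex.exp_conj]; congr 1
  simp [map_ofNat]

lemma e_toCircle (t : ℝ) : e t = ((AddCircle.toCircle (t : UnitAddCircle) : Circle) : ℂ) := by
  rw [AddCircle.toCircle_apply_mk, Circle.coe_exp]; unfold e; congr 1; push_cast; ring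

lemma e_int (n : ℤ) : e n = 1 := by
  unfold e
  rw [Complex.exp_eq_one_iff]; exact ⟨n, by push_cast; ring⟩

lemma e_nat_mul (n : ℕ) (t : ℝ) : e (n * t) = e t ^ n := by
  unfold e; rw [← Complex.exp_nat_mul]; congr 1; push_cast; ring

lemma norm_e_sub_one_le (t : ℝ) : ‖e t - 1‖ ≤ 2 * π * |t| := by
  rw [e_eq]
  refine (Real.norm_exp_I_mul_ofReal_sub_one_le).trans ?_
  rw [Real.norm_eq_abs, abs_mul, abs_of_pos Real.two_pi_pos]

lemma norm_e_sub_le (s t : ℝ) : ‖e s - e t‖ ≤ 2 * π * |s - t| := by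
  have : e s - e t = e t * (e (s - t) - 1) := by
    rw [mul_sub, ← e_add]; ring_nf
  rw [this, norm_mul, norm_e, one_mul]
  exact norm_e_sub_one_le _

lemma four_nint_le (t : ℝ) : 4 * nint t ≤ ‖e t - 1‖ := by
  have h1 : e t = e (t - round t) := by
    have : e t = e (t - round t) * e (round t : ℤ) := by rw [← e_add]; ring_nf
    rw [this, e_int, mul_one]
  rw [h1, e_eq, Complex.norm_exp_I_mul_ofReal_sub_one]
  unfold nint
  set r := t - round t with hr
  have hr2 : |r| ≤ 1 / 2 := abs_sub_round t
  rw [Real.norm_eq_abs, abs_mul, abs_of_pos (by norm_num : (0:ℝ) < 2)]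
  have : 2 * π * r / 2 = π * r := by ring
  rw [this]
  have h3 : |Real.sin (π * r)| = Real.sin (π * |r|) := by
    rcases le_total 0 r with h | h
    · rw [abs_of_nonneg h, abs_of_nonneg]
      apply Real.sin_nonneg_of_nonneg_of_le_pi (by positivity)
      rw [abs_of_nonneg h] at hr2; nlinarith [Real.pi_pos]
    · rw [abs_of_nonpos h, mul_neg, Real.sin_neg, abs_of_nonpos]
      apply Real.sin_nonpos_of_nonpos_of_neg_pi_le
      · nlinarith [Real.pi_pos]
      · rw [abs_of_nonpos h] at hr2; nlinarith [Real.pi_pos]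
  rw [h3]
  have := Real.mul_le_sin (x := π * |r|) (by positivity) (by nlinarith [Real.pi_pos])
  have h5 : 2 / π * (π * |r|) = 2 * |r| := by field_simp
  linarith

lemma nint_nonneg (t : ℝ) : 0 ≤ nint t := abs_nonneg _

lemma nint_eq_norm (t : ℝ) : nint t = ‖(t : UnitAddCircle)‖ := by
  rw [UnitAddCircle.norm_eq]; rfl

lemma geom_bound (L : ℕ) (s t : ℝ) (ht : 0 < nint t) :
    ‖∑ n ∈ Finset.range L, e (s + n * t)‖ ≤ 1 / (2 * nint t) := by
  have h1 : ∑ n ∈ Finset.range L, e (s + n * t) = e s * ∑ n ∈ Finset.range L, e t ^ n := by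
    rw [Finset.mul_sum]; exact Finset.sum_congr rfl fun n _ => by rw [e_add, e_nat_mul]
  have h4 := four_nint_le t
  have hne : e t ≠ 1 := by
    intro h; rw [h] at h4; simp at h4; linarith
  rw [h1, norm_mul, norm_e, one_mul, geom_sum_eq hne, norm_div]
  have h5 : ‖e t ^ L - 1‖ ≤ 2 := by
    refine (norm_sub_le _ _).trans ?_
    rw [norm_pow, norm_e]; norm_num
  rw [div_le_div_iff₀ (by linarith) (by linarith)]
  nlinarith

lemma count_near_int (K : ℕ) (g : ℕ → ℝ) (lam V δ : ℝ) (hlam : 0 < lam) (hδ : 0 ≤ δ)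
    (hg : ∀ i < K, lam ≤ g (i + 1) - g i) (hV : g K - g 0 ≤ V) :
    ((((Finset.range K).filter (fun i => nint (g i) ≤ δ)).card : ℕ) : ℝ)
      ≤ (V + 2) * (2 * δ / lam + 1) := by
  have hdiff : ∀ i j, i ≤ j → j ≤ K → lam * ((j : ℝ) - i) ≤ g j - g i := by
    intro i j hij
    induction j, hij using Nat.le_induction with
    | base => intro _; simp
    | succ j hj ih =>
      intro hjK
      have h1 := ih (by omega)
      have h2 := hg j (by omega)
      push_cast
      linarith
  have hmono : ∀ i j, i ≤ j → j ≤ K → g i ≤ g j := by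
    intro i j hij hj
    have := hdiff i j hij hj
    have h2 : (0:ℝ) ≤ (j : ℝ) - i := by
      have : (i : ℝ) ≤ j := by exact_mod_cast hij
      linarith
    nlinarith [mul_nonneg hlam.le h2]
  set S := (Finset.range K).filter (fun i => nint (g i) ≤ δ) with hS
  set T : Finset ℤ := Finset.Icc (round (g 0)) (round (g K)) with hT
  have hmaps : ∀ i ∈ S, round (g i) ∈ T := by
    intro i hi
    rw [hS, Finset.mem_filter, Finset.mem_range] at hi
    rw [hT, Finset.mem_Icc]
    have h0 := hmono 0 i (by omega) (by omega)
    have h1 := hmono i K (by omega) le_rfl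
    constructor
    · rw [round_eq, round_eq]; exact Int.floor_le_floor (by linarith)
    · rw [round_eq, round_eq]; exact Int.floor_le_floor (by linarith)
  have hfib : ∀ n ∈ T, (((S.filter (fun i => round (g i) = n)).card : ℕ) : ℝ) ≤ 2 * δ / lam + 1 := by
    intro n _
    set U := S.filter (fun i => round (g i) = n) with hU
    rcases U.eq_empty_or_nonempty with h | h
    · rw [h]; simp; positivity
    · have hmin := U.min'_mem h
      have hmax := U.max'_mem h
      set a := U.min' h
      set b := U.max' h
      have hsub : U ⊆ Finset.Icc a b := by
        intro i hi; rw [Finset.mem_Icc]; exact ⟨U.min'_le i hi, U.le_max' i hi⟩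
      have hab : a ≤ b := U.min'_le b hmax
      have hc : (U.card : ℝ) ≤ (b : ℝ) - a + 1 := by
        have := Finset.card_le_card hsub
        rw [Nat.card_Icc] at this
        have h2 : (U.card : ℝ) ≤ ((b + 1 - a : ℕ) : ℝ) := by exact_mod_cast this
        rw [Nat.cast_sub (by omega)] at h2
        push_cast at h2; linarith
      have ha' : |g a - n| ≤ δ := by
        have := hmin; rw [hU, Finset.mem_filter, hS, Finset.mem_filter] at this
        have h3 := this.1.2; unfold nint at h3; rw [this.2] at h3; exact h3
      have hb' : |g b - n| ≤ δ := by
        have := hmax; rw [hU, Finset.mem_filter, hS, Finset.mem_filter] at this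
        have h3 := this.1.2; unfold nint at h3; rw [this.2] at h3; exact h3
      have hbK : b ≤ K := by
        have := hmax; rw [hU, Finset.mem_filter, hS, Finset.mem_filter, Finset.mem_range] at this
        omega
      have h4 := hdiff a b hab hbK
      have h5 : lam * ((b:ℝ) - a) ≤ 2 * δ := by
        have := (abs_le.mp ha').1
        have := (abs_le.mp hb').2
        linarith
      have h6 : (b:ℝ) - a ≤ 2 * δ / lam := by
        rw [le_div_iff₀ hlam]; linarith
      linarith
  have hTcard : (T.card : ℝ) ≤ V + 2 := by
    rw [hT, Int.card_Icc]
    have h0 := hmono 0 K (by omega) le_rfl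
    have h1 : round (g 0) ≤ round (g K) := by
      rw [round_eq, round_eq]; exact Int.floor_le_floor (by linarith)
    have h2 : (((round (g K) + 1 - round (g 0)).toNat : ℕ) : ℝ) = (round (g K) : ℝ) + 1 - round (g 0) := by
      have : ((round (g K) + 1 - round (g 0)).toNat : ℤ) = round (g K) + 1 - round (g 0) :=
        Int.toNat_of_nonneg (by omega)
      exact_mod_cast congrArg (Int.cast : ℤ → ℝ) this
    rw [h2]
    have := abs_le.mp (abs_sub_round (g 0))
    have := abs_le.mp (abs_sub_round (g K))
    linarith
  have hcard : S.card = ∑ n ∈ T, (S.filter (fun i => round (g i) = n)).card :=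
    Finset.card_eq_sum_card_fiberwise hmaps
  rw [hcard]; push_cast
  calc _ ≤ ∑ n ∈ T, (2 * δ / lam + 1) := Finset.sum_le_sum hfib
    _ = T.card * (2 * δ / lam + 1) := by rw [Finset.sum_const, nsmul_eq_mul]
    _ ≤ _ := by gcongr

lemma taylor_disc (f : ℕ → ℝ) (s H : ℕ) (Lam : ℝ)
    (h1 : ∀ n, n < H → 0 ≤ f (s + n) + f (s + n + 2) - 2 * f (s + n + 1))
    (h2 : ∀ n, n < H → f (s + n) + f (s + n + 2) - 2 * f (s + n + 1) ≤ Lam) :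
    ∀ t ≤ H, |f (s + t) - (f s + t * (f (s + 1) - f s))| ≤ Lam * t ^ 2 ∧
      (0 ≤ (f (s + t + 1) - f (s + t)) - (f (s + 1) - f s) ∧
      (f (s + t + 1) - f (s + t)) - (f (s + 1) - f s) ≤ Lam * t) := by
  intro t
  induction t with
  | zero => intro _; simp
  | succ t ih =>
    intro ht
    obtain ⟨i1, i2, i3⟩ := ih (by omega)
    have a1 := h1 t (by omega)
    have a2 := h2 t (by omega)
    have hL : 0 ≤ Lam := a1.trans a2
    have htn : (0:ℝ) ≤ t := Nat.cast_nonneg t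
    refine ⟨?_, ?_, ?_⟩
    · rw [abs_le] at i1 ⊢
      have := mul_nonneg hL htn
      push_cast
      rw [show s + (t + 1) = s + t + 1 by ring]
      constructor <;> nlinarith
    · rw [show s + (t + 1) = s + t + 1 by ring]
      rw [show s + t + 1 + 1 = s + t + 2 by ring]
      linarith
    · rw [show s + (t + 1) = s + t + 1 by ring]
      rw [show s + t + 1 + 1 = s + t + 2 by ring]
      push_cast
      linarith

lemma exp_sum_bound (f : ℕ → ℝ) (L H : ℕ) (hH : 1 ≤ H) (lam Lam δ : ℝ) (hlam : 0 < lam)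
    (hδ : 0 < δ)
    (h1 : ∀ n, n < L → lam ≤ f n + f (n + 2) - 2 * f (n + 1))
    (h2 : ∀ n, n < L → f n + f (n + 2) - 2 * f (n + 1) ≤ Lam) (hLam : 0 ≤ Lam) :
    ‖∑ n ∈ Finset.range L, e (f n)‖ ≤
      L / (δ * H) + 7 * Lam * H ^ 2 * L + (Lam * L + 2) * (2 * δ / lam + H) + H := by
  have hHr : (1:ℝ) ≤ H := by exact_mod_cast hH
  set K := L / H with hK
  have hKL : K * H ≤ L := Nat.div_mul_le_self L H
  have hKLr : (K:ℝ) * H ≤ L := by exact_mod_cast hKL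
  have hrem : L - K * H ≤ H := by
    have := Nat.div_add_mod L H
    have h3 := Nat.mod_lt L (show 0 < H by omega)
    rw [← hK, mul_comm] at this
    omega
  have hsplit : ∑ n ∈ Finset.range L, e (f n) =
      (∑ i ∈ Finset.range K, ∑ t ∈ Finset.range H, e (f (i * H + t))) +
      ∑ t ∈ Finset.range (L - K * H), e (f (K * H + t)) := by
    have : L = K * H + (L - K * H) := by omega
    conv_lhs => rw [this, Finset.sum_range_add]
    congr 1
    generalize K = K'
    induction K' with
    | zero => simp
    | succ k ih => rw [Finset.sum_range_succ, ← ih, Nat.succ_mul, Finset.sum_range_add]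
  set g : ℕ → ℝ := fun i => f (i * H + 1) - f (i * H) with hg
  have htay : ∀ i < K, ∀ t ≤ H, |f (i * H + t) - (f (i * H) + t * (f (i * H + 1) - f (i * H)))| ≤ Lam * t ^ 2 ∧
      (0 ≤ (f (i * H + t + 1) - f (i * H + t)) - (f (i * H + 1) - f (i * H)) ∧
      (f (i * H + t + 1) - f (i * H + t)) - (f (i * H + 1) - f (i * H)) ≤ Lam * t) := by
    intro i hi
    have hb : ∀ n, n < H → i * H + n < L := by
      intro n hn
      have : (i + 1) * H ≤ K * H := Nat.mul_le_mul_right _ hi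
      rw [Nat.succ_mul] at this; omega
    exact taylor_disc f (i * H) H Lam (fun n hn => hlam.le.trans (h1 _ (hb n hn))) (fun n hn => h2 _ (hb n hn))
  have hginc : ∀ i < K, lam * H ≤ g (i + 1) - g i := by
    intro i hi
    have hb : ∀ n, n < H → i * H + n < L := by
      intro n hn
      have : (i + 1) * H ≤ K * H := Nat.mul_le_mul_right _ hi
      rw [Nat.succ_mul] at this; omega
    have : ∀ t ≤ H, lam * t ≤ (f (i * H + t + 1) - f (i * H + t)) - (f (i * H + 1) - f (i * H)) := by
      intro t
      induction t with
      | zero => intro _; simp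
      | succ t ih =>
        intro ht
        have a0 := ih (by omega)
        have a1 := h1 (i * H + t) (hb t (by omega))
        rw [show i * H + (t + 1) = i * H + t + 1 by ring]
        rw [show i * H + t + 1 + 1 = i * H + t + 2 by ring]
        push_cast; linarith
    have := this H le_rfl
    simp only [hg]
    rw [Nat.succ_mul]; exact this
  have hgV : g K - g 0 ≤ Lam * L := by
    have : ∀ k ≤ K, g k - g 0 ≤ Lam * (k * H) := by
      intro k
      induction k with
      | zero => intro _; simp
      | succ k ih =>
        intro hk
        have a0 := ih (by omega)
        have a1 := (htay k (by omega) H le_rfl).2.2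
        have a2 : g (k + 1) - g k ≤ Lam * H := by
          simp only [hg]; rw [Nat.succ_mul]; exact a1
        push_cast; linarith
    refine (this K le_rfl).trans ?_
    gcongr
  have hcount := count_near_int K g (lam * H) (Lam * L) δ (by positivity) hδ.le hginc hgV
  have hblock : ∀ i ∈ Finset.range K, ‖∑ t ∈ Finset.range H, e (f (i * H + t))‖ ≤
      (1 / δ + 7 * Lam * H ^ 3) + (if nint (g i) ≤ δ then (H:ℝ) else 0) := by
    intro i hi
    rw [Finset.mem_range] at hi
    split_ifs with hbad
    · calc _ ≤ ∑ t ∈ Finset.range H, ‖e (f (i * H + t))‖ := norm_sum_le _ _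
        _ = H := by simp [norm_e]
        _ ≤ _ := by
          have : 0 ≤ 1 / δ + 7 * Lam * (H:ℝ) ^ 3 := by positivity
          linarith
    · push Not at hbad
      have e1 : ∑ t ∈ Finset.range H, e (f (i * H + t)) =
          (∑ t ∈ Finset.range H, e (f (i * H) + t * g i)) +
          ∑ t ∈ Finset.range H, (e (f (i * H + t)) - e (f (i * H) + t * g i)) := by
        rw [← Finset.sum_add_distrib]; apply Finset.sum_congr rfl; intro t _; ring
      rw [e1, add_zero]
      refine (norm_add_le _ _).trans (add_le_add ?_ ?_)
      · refine (geom_bound H _ _ (hδ.trans hbad)).trans ?_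
        apply one_div_le_one_div_of_le hδ; linarith
      · calc _ ≤ ∑ t ∈ Finset.range H, ‖e (f (i * H + t)) - e (f (i * H) + t * g i)‖ := norm_sum_le _ _
          _ ≤ ∑ t ∈ Finset.range H, 7 * Lam * (H:ℝ) ^ 2 := by
            apply Finset.sum_le_sum
            intro t ht
            rw [Finset.mem_range] at ht
            refine (norm_e_sub_le _ _).trans ?_
            have a1 := (htay i hi t ht.le).1
            have hpi : 2 * π ≤ 7 := by linarith [Real.pi_lt_d2]
            have htH : (t:ℝ) ≤ H := by exact_mod_cast ht.le
            calc 2 * π * |f (i * H + t) - (f (i * H) + t * g i)| ≤ 7 * (Lam * (t:ℝ) ^ 2) := by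
                  apply mul_le_mul hpi a1 (abs_nonneg _) (by norm_num)
              _ ≤ 7 * (Lam * (H:ℝ) ^ 2) := by gcongr
              _ = _ := by ring
          _ = _ := by rw [Finset.sum_const, Finset.card_range, nsmul_eq_mul]; ring
  have hsum1 : ‖∑ i ∈ Finset.range K, ∑ t ∈ Finset.range H, e (f (i * H + t))‖ ≤
      K * (1 / δ + 7 * Lam * H ^ 3) + (Lam * L + 2) * (2 * δ / (lam * H) + 1) * H := by
    calc _ ≤ ∑ i ∈ Finset.range K, ‖∑ t ∈ Finset.range H, e (f (i * H + t))‖ := norm_sum_le _ _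
      _ ≤ ∑ i ∈ Finset.range K, ((1 / δ + 7 * Lam * H ^ 3) + (if nint (g i) ≤ δ then (H:ℝ) else 0)) :=
        Finset.sum_le_sum hblock
      _ = K * (1 / δ + 7 * Lam * H ^ 3) + ((Finset.range K).filter (fun i => nint (g i) ≤ δ)).card * H := by
        rw [Finset.sum_add_distrib, Finset.sum_const, Finset.card_range, nsmul_eq_mul, ← Finset.sum_filter,
          Finset.sum_const, nsmul_eq_mul]
      _ ≤ _ := by gcongr
  have hsum2 : ‖∑ t ∈ Finset.range (L - K * H), e (f (K * H + t))‖ ≤ H := by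
    calc _ ≤ ∑ t ∈ Finset.range (L - K * H), ‖e (f (K * H + t))‖ := norm_sum_le _ _
      _ = ((L - K * H : ℕ) : ℝ) := by simp [norm_e]
      _ ≤ _ := by exact_mod_cast hrem
  rw [hsplit]
  refine (norm_add_le _ _).trans ?_
  have hf1 : (K:ℝ) * (1 / δ + 7 * Lam * H ^ 3) ≤ L / (δ * H) + 7 * Lam * H ^ 2 * L := by
    have hK' : (K:ℝ) ≤ L / H := by rw [le_div_iff₀ (by linarith)]; exact hKLr
    calc (K:ℝ) * (1 / δ + 7 * Lam * H ^ 3) ≤ (L / H) * (1 / δ + 7 * Lam * H ^ 3) := by gcongr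
      _ = _ := by field_simp
  have hf2 : (Lam * L + 2) * (2 * δ / (lam * H) + 1) * H = (Lam * L + 2) * (2 * δ / lam + H) := by
    field_simp
  rw [hf2] at hsum1
  linarith

lemma nint_le_of_int (t : ℝ) (z : ℤ) : nint t ≤ |t - z| := round_le t z

lemma bohr_card (N : ℕ) (hN : 0 < N) (R : Finset ℕ) (ε : ℝ) (hε0 : 0 < ε) (hε1 : ε < 1) :
    (N : ℝ) * ε ^ R.card ≤
      (((Finset.range N).filter (fun x : ℕ => ∀ ξ ∈ R, nint ((x : ℝ) * ξ / N) ≤ ε)).card : ℝ) := by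
  have hNr : (0:ℝ) < N := by exact_mod_cast hN
  set B := (Finset.range N).filter (fun x : ℕ => ∀ ξ ∈ R, nint ((x : ℝ) * ξ / N) ≤ ε) with hB
  set k0 := ⌊ε * N⌋₊ with hk0
  have hk0le : (k0:ℝ) ≤ ε * N := Nat.floor_le (by positivity)
  have hk0lt : ε * N < k0 + 1 := Nat.lt_floor_add_one _
  have hk0N : k0 + 1 ≤ N := by
    have : (k0:ℝ) < N := by nlinarith
    exact_mod_cast this
  set U : Finset (R → ℕ) := Fintype.piFinset (fun _ : R => Finset.range N) with hU
  set P : ℕ → (R → ℕ) → Prop := fun x u => ∀ ξ : R, (x * ξ + u ξ) % N ≤ k0 with hP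
  have hUcard : U.card = N ^ R.card := by
    rw [hU, Fintype.card_piFinset]; simp
  have hx : ∀ x ∈ Finset.range N, (k0 + 1) ^ R.card ≤ (U.filter (fun u => P x u)).card := by
    intro x _
    have hsub : Fintype.piFinset (fun ξ : R => (Finset.range N).filter (fun v => (x * ξ + v) % N ≤ k0)) ⊆
        U.filter (fun u => P x u) := by
      intro u hu
      rw [Fintype.mem_piFinset] at hu
      rw [Finset.mem_filter, hU, Fintype.mem_piFinset]
      exact ⟨fun ξ => (Finset.mem_filter.mp (hu ξ)).1, fun ξ => (Finset.mem_filter.mp (hu ξ)).2⟩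
    refine le_trans ?_ (Finset.card_le_card hsub)
    rw [Fintype.card_piFinset]
    have : ∀ ξ : R, k0 + 1 ≤ ((Finset.range N).filter (fun v => (x * ξ + v) % N ≤ k0)).card := by
      intro ξ
      have hinj : Set.InjOn (fun r => (r + (N - (x * ξ) % N)) % N) (Finset.range (k0 + 1) : Set ℕ) := by
        intro r hr s hs h
        simp only [Finset.coe_range, Set.mem_Iio] at hr hs
        have h2 : r + (N - (x * ξ) % N) ≡ s + (N - (x * ξ) % N) [MOD N] := h
        have h3 : r ≡ s [MOD N] := Nat.ModEq.add_right_cancel' _ h2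
        exact Nat.ModEq.eq_of_lt_of_lt h3 (by omega) (by omega)
      have hm : Set.MapsTo (fun r => (r + (N - (x * ξ) % N)) % N) (Finset.range (k0 + 1) : Set ℕ)
          ((Finset.range N).filter (fun v => (x * ξ + v) % N ≤ k0) : Finset ℕ) := by
        intro r hr
        simp only [Finset.coe_range, Set.mem_Iio] at hr
        simp only [Finset.coe_filter, Finset.mem_range, Set.mem_ofPred_eq]
        refine ⟨Nat.mod_lt _ hN, ?_⟩
        have hlt := Nat.mod_lt (x * ξ) hN
        have : (x * ξ + (r + (N - (x * ξ) % N)) % N) % N = r := by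
          rw [Nat.add_mod, Nat.mod_mod, ← Nat.add_mod, Nat.add_mod]
          have h5 : ((x * ξ) % N + (r + (N - (x * ξ) % N)) % N) % N = ((x * ξ) % N + (r + (N - (x * ξ) % N))) % N := by
            rw [Nat.add_mod_mod]
          rw [h5]
          have : (x * ξ) % N + (r + (N - (x * ξ) % N)) = r + N := by omega
          rw [this, Nat.add_mod_right, Nat.mod_eq_of_lt (by omega)]
        rw [this]; omega
      have := Finset.card_le_card_of_injOn _ hm hinj
      rwa [Finset.card_range] at this
    calc (k0 + 1) ^ R.card = ∏ ξ : R, (k0 + 1) := by simp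
      _ ≤ _ := Finset.prod_le_prod' fun ξ _ => this ξ
  have hdc : ∑ u ∈ U, ((Finset.range N).filter (fun x => P x u)).card =
      ∑ x ∈ Finset.range N, (U.filter (fun u => P x u)).card := by
    simp only [Finset.card_filter]
    exact Finset.sum_comm
  have hex : ∃ u ∈ U, (N:ℝ) * ε ^ R.card ≤ (((Finset.range N).filter (fun x => P x u)).card : ℝ) := by
    apply Finset.exists_le_of_sum_le
    · rw [← Finset.card_pos, hUcard]; positivity
    · rw [Finset.sum_const, hUcard, nsmul_eq_mul]
      have : (∑ u ∈ U, (((Finset.range N).filter (fun x => P x u)).card : ℝ)) =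
          ∑ x ∈ Finset.range N, ((U.filter (fun u => P x u)).card : ℝ) := by exact_mod_cast hdc
      rw [this]
      calc (((N ^ R.card : ℕ) : ℝ)) * ((N:ℝ) * ε ^ R.card) = ∑ x ∈ Finset.range N, (ε * N) ^ R.card := by
            rw [Finset.sum_const, Finset.card_range, nsmul_eq_mul, mul_pow]; push_cast; ring
        _ ≤ ∑ x ∈ Finset.range N, (((k0 + 1) ^ R.card : ℕ) : ℝ) := by
            apply Finset.sum_le_sum; intro x _; push_cast; gcongr
        _ ≤ _ := by
            apply Finset.sum_le_sum; intro x hxx; exact_mod_cast hx x hxx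
  obtain ⟨u, _, hu⟩ := hex
  refine hu.trans ?_
  set X := (Finset.range N).filter (fun x => P x u) with hX
  rcases X.eq_empty_or_nonempty with h | ⟨x0, hx0⟩
  · rw [h]; simp
  norm_cast
  have hx0' := Finset.mem_filter.mp hx0
  have hx0N := Finset.mem_range.mp hx0'.1
  apply Finset.card_le_card_of_injOn (fun x => (x + (N - x0)) % N)
  · intro x hxX
    have hx' := Finset.mem_filter.mp (Finset.mem_coe.mp hxX)
    have hxN := Finset.mem_range.mp hx'.1
    rw [Finset.mem_coe, hB, Finset.mem_filter, Finset.mem_range]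
    refine ⟨Nat.mod_lt _ hN, ?_⟩
    intro ξ hξ
    have h1 := hx'.2 ⟨ξ, hξ⟩
    have h2 := hx0'.2 ⟨ξ, hξ⟩
    simp only at h1 h2
    set uu := u ⟨ξ, hξ⟩
    set r := (x * ξ + uu) % N with hr
    set r0 := (x0 * ξ + uu) % N with hr0
    have q1 := Nat.div_add_mod (x * ξ + uu) N
    have q2 := Nat.div_add_mod (x0 * ξ + uu) N
    have q3 := Nat.div_add_mod (x + (N - x0)) N
    set y := (x + (N - x0)) % N
    rw [← hr] at q1
    rw [← hr0] at q2
    set A1 := (x * ξ + uu) / N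
    set A2 := (x0 * ξ + uu) / N
    set A3 := (x + (N - x0)) / N
    have q1r : (N:ℝ) * A1 + r = x * ξ + uu := by exact_mod_cast q1
    have q2r : (N:ℝ) * A2 + r0 = x0 * ξ + uu := by exact_mod_cast q2
    have q3r : (N:ℝ) * A3 + y = x + (N - x0) := by
      have : ((N * A3 + y : ℕ) : ℝ) = ((x + (N - x0) : ℕ) : ℝ) := by exact_mod_cast q3
      rw [Nat.cast_add x, Nat.cast_sub hx0N.le] at this
      push_cast at this; exact this
    refine (nint_le_of_int _ ((A1:ℤ) - A2 + ξ - A3 * ξ)).trans ?_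
    have : (y:ℝ) * ξ / N - (((A1:ℤ) - A2 + ξ - A3 * ξ : ℤ) : ℝ) = ((r:ℝ) - r0) / N := by
      rw [eq_div_iff hNr.ne', sub_mul, div_mul_cancel₀ _ hNr.ne']
      push_cast
      have hy : (y:ℝ) = x + (N - x0) - N * A3 := by linarith
      rw [hy]
      linarith
    rw [this, abs_div, abs_of_pos hNr, div_le_iff₀ hNr]
    have h1r : (r:ℝ) ≤ k0 := by exact_mod_cast h1
    have h2r : (r0:ℝ) ≤ k0 := by exact_mod_cast h2
    have h3r : (0:ℝ) ≤ r := Nat.cast_nonneg _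
    have h4r : (0:ℝ) ≤ r0 := Nat.cast_nonneg _
    rw [abs_le]; constructor <;> linarith
  · intro x hxX y hyX h
    have hx' := Finset.mem_range.mp (Finset.mem_filter.mp (Finset.mem_coe.mp hxX)).1
    have hy' := Finset.mem_range.mp (Finset.mem_filter.mp (Finset.mem_coe.mp hyX)).1
    have h2 : x + (N - x0) ≡ y + (N - x0) [MOD N] := h
    exact Nat.ModEq.eq_of_lt_of_lt (Nat.ModEq.add_right_cancel' _ h2) hx' hy'

lemma orth (N : ℕ) (hN : 0 < N) (t : ℤ) (ht : |t| < N) :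
    ∑ ξ ∈ Finset.range N, e ((ξ : ℝ) * t / N) = if t = 0 then (N : ℂ) else 0 := by
  have hNr : (0:ℝ) < N := by exact_mod_cast hN
  split_ifs with h
  · subst h; simp [e_zero]
  · have h1 : ∀ ξ : ℕ, e ((ξ : ℝ) * t / N) = e ((t:ℝ) / N) ^ ξ := by
      intro ξ; rw [← e_nat_mul]; congr 1; ring
    simp_rw [h1]
    have hne : e ((t:ℝ) / N) ≠ 1 := by
      unfold e
      rw [Ne, Complex.exp_eq_one_iff]
      rintro ⟨n, hn⟩
      have h2 : ((t:ℝ) / N : ℂ) = n := by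
        have h2pi : (2 * (π:ℂ) * Complex.I) ≠ 0 := Complex.two_pi_I_ne_zero
        apply mul_left_cancel₀ h2pi
        push_cast at hn ⊢
        rw [hn]; ring
      have h3 : (t:ℝ) / N = n := by exact_mod_cast h2
      rw [div_eq_iff hNr.ne'] at h3
      have h4 : t = n * N := by exact_mod_cast h3
      have hn0 : n ≠ 0 := by rintro rfl; simp at h4; exact h h4
      have : (N:ℤ) ≤ |t| := by
        rw [h4, abs_mul, Nat.abs_cast]
        have := Int.one_le_abs hn0
        nlinarith [Nat.cast_nonneg (α := ℤ) N]
      omega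
    rw [geom_sum_eq hne]
    have : e ((t:ℝ) / N) ^ N = 1 := by
      rw [← e_nat_mul]
      rw [mul_div_cancel₀ _ hNr.ne']; exact e_int t
    rw [this]; simp

lemma fourier_inv (N : ℕ) (hN : 0 < N) (f : ℕ → ℝ) (n0 : ℕ) (hn0 : n0 < N) :
    (f n0 : ℂ) = (N : ℂ)⁻¹ * ∑ ξ ∈ Finset.range N, fourierZN N f ξ * e ((ξ : ℝ) * n0 / N) := by
  have hNc : (N:ℂ) ≠ 0 := by exact_mod_cast hN.ne'
  have : ∑ ξ ∈ Finset.range N, fourierZN N f ξ * e ((ξ : ℝ) * n0 / N) = N * f n0 := by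
    calc _ = ∑ ξ ∈ Finset.range N, ∑ n ∈ Finset.range N, (f n : ℂ) * e ((ξ : ℝ) * ((n0 : ℤ) - (n:ℤ) : ℤ) / N) := by
          apply Finset.sum_congr rfl; intro ξ _
          unfold fourierZN
          rw [Finset.sum_mul]
          apply Finset.sum_congr rfl; intro n _
          rw [mul_assoc, ← e_add]; congr 2; push_cast; ring
      _ = ∑ n ∈ Finset.range N, (f n : ℂ) * ∑ ξ ∈ Finset.range N, e ((ξ : ℝ) * ((n0 : ℤ) - (n:ℤ) : ℤ) / N) := by
          rw [Finset.sum_comm]; apply Finset.sum_congr rfl; intro n _; rw [Finset.mul_sum]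
      _ = ∑ n ∈ Finset.range N, (f n : ℂ) * (if n = n0 then (N:ℂ) else 0) := by
          apply Finset.sum_congr rfl; intro n hn
          rw [Finset.mem_range] at hn
          rw [orth N hN _ (by rw [abs_lt]; constructor <;> omega)]
          congr 1
          by_cases h : n = n0
          · simp [h]
          · rw [if_neg h, if_neg (by omega)]
      _ = _ := by
          simp [hn0]; ring
  rw [this]; field_simp

lemma parseval (N : ℕ) (hN : 0 < N) (f : ℕ → ℝ) :
    ∑ ξ ∈ Finset.range N, ‖fourierZN N f ξ‖ ^ 2 = N * ∑ n ∈ Finset.range N, f n ^ 2 := by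
  have hNc : (N:ℂ) ≠ 0 := by exact_mod_cast hN.ne'
  have h : ∀ ξ, ((‖fourierZN N f ξ‖ ^ 2 : ℝ) : ℂ) =
      ∑ n ∈ Finset.range N, (f n : ℂ) * (fourierZN N f ξ * e ((ξ:ℝ) * n / N)) := by
    intro ξ
    have h1 : ((‖fourierZN N f ξ‖ ^ 2 : ℝ) : ℂ) = fourierZN N f ξ * (starRingEnd ℂ) (fourierZN N f ξ) := by
      rw [Complex.mul_conj, Complex.normSq_eq_norm_sq]
    have h2 : (starRingEnd ℂ) (fourierZN N f ξ) = ∑ n ∈ Finset.range N, (f n : ℂ) * e ((ξ:ℝ) * n / N) := by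
      unfold fourierZN
      rw [map_sum]; apply Finset.sum_congr rfl; intro n _
      rw [map_mul, Complex.conj_ofReal, e_neg, Complex.conj_conj]
    rw [h1, h2, Finset.mul_sum]; apply Finset.sum_congr rfl; intro n _; ring
  have : ((∑ ξ ∈ Finset.range N, ‖fourierZN N f ξ‖ ^ 2 : ℝ) : ℂ) = ((N * ∑ n ∈ Finset.range N, f n ^ 2 : ℝ) : ℂ) := by
    rw [Complex.ofReal_sum]
    simp_rw [h]
    rw [Finset.sum_comm]
    push_cast
    rw [Finset.mul_sum]
    apply Finset.sum_congr rfl; intro n hn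
    rw [← Finset.mul_sum]
    have := fourier_inv N hN f n (Finset.mem_range.mp hn)
    rw [eq_inv_mul_iff_mul_eq₀ hNc] at this
    rw [← this]; ring
  exact_mod_cast this

lemma conv_conv_fourier (N : ℕ) (hN : 0 < N) (f β : ℕ → ℝ) (x : ℕ) :
    ((convZN N (convZN N f β) β x : ℝ) : ℂ) =
      (N : ℂ)⁻¹ * ∑ ξ ∈ Finset.range N, fourierZN N f ξ * (fourierZN N β ξ) ^ 2 * e ((ξ:ℝ) * x / N) := by
  have hNr : (N:ℝ) ≠ 0 := by exact_mod_cast hN.ne'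
  have key : ∀ y ∈ Finset.range N, ∀ z ∈ Finset.range N,
      (f (((x + (N - y)) % N + (N - z)) % N) : ℂ) =
      (N : ℂ)⁻¹ * ∑ ξ ∈ Finset.range N, fourierZN N f ξ * e ((ξ:ℝ) * x / N) *
        e (-((ξ:ℝ) * y / N)) * e (-((ξ:ℝ) * z / N)) := by
    intro y hy z hz
    rw [Finset.mem_range] at hy hz
    rw [fourier_inv N hN f _ (Nat.mod_lt _ hN)]
    congr 1
    apply Finset.sum_congr rfl; intro ξ _
    rw [mul_assoc, mul_assoc, ← e_add, ← e_add]
    congr 1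
    have q1 := Nat.div_add_mod (x + (N - y)) N
    have q2 := Nat.div_add_mod ((x + (N - y)) % N + (N - z)) N
    set u := (x + (N - y)) % N
    set v := (u + (N - z)) % N
    set A1 := (x + (N - y)) / N
    set A2 := (u + (N - z)) / N
    have q1r : (N:ℝ) * A1 + u = x + (N - y) := by
      have : ((N * A1 + u : ℕ) : ℝ) = ((x + (N - y) : ℕ) : ℝ) := by exact_mod_cast q1
      rw [Nat.cast_add x, Nat.cast_sub hy.le] at this
      push_cast at this; exact this
    have q2r : (N:ℝ) * A2 + v = u + (N - z) := by
      have : ((N * A2 + v : ℕ) : ℝ) = ((u + (N - z) : ℕ) : ℝ) := by exact_mod_cast q2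
      rw [Nat.cast_add u, Nat.cast_sub hz.le] at this
      push_cast at this; exact this
    have hv : (v:ℝ) = x - y - z + N * (2 - A1 - A2) := by linarith
    have : (ξ:ℝ) * v / N = ((ξ:ℝ) * x / N + (-((ξ:ℝ) * y / N) + -((ξ:ℝ) * z / N))) +
        (((ξ:ℤ) * (2 - A1 - A2) : ℤ) : ℝ) := by
      rw [hv]; push_cast; field_simp; ring
    rw [this, e_add, e_int, mul_one]
  unfold convZN
  push_cast
  calc _ = ∑ y ∈ Finset.range N, (∑ z ∈ Finset.range N, ((N : ℂ)⁻¹ * ∑ ξ ∈ Finset.range N, fourierZN N f ξ * e ((ξ:ℝ) * x / N) *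
        e (-((ξ:ℝ) * y / N)) * e (-((ξ:ℝ) * z / N))) * (β z : ℂ)) * (β y : ℂ) := by
        apply Finset.sum_congr rfl; intro y hy
        congr 1
        apply Finset.sum_congr rfl; intro z hz
        rw [key y hy z hz]
    _ = ∑ y ∈ Finset.range N, ∑ z ∈ Finset.range N, ∑ ξ ∈ Finset.range N,
        (N : ℂ)⁻¹ * (fourierZN N f ξ * e ((ξ:ℝ) * x / N)) *
        ((β y : ℂ) * e (-((ξ:ℝ) * y / N))) * ((β z : ℂ) * e (-((ξ:ℝ) * z / N))) := by
        apply Finset.sum_congr rfl; intro y hy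
        rw [Finset.sum_mul]
        apply Finset.sum_congr rfl; intro z hz
        rw [Finset.mul_sum, Finset.sum_mul, Finset.sum_mul]
        apply Finset.sum_congr rfl; intro ξ _; ring
    _ = ∑ ξ ∈ Finset.range N, ∑ y ∈ Finset.range N, ∑ z ∈ Finset.range N,
        (N : ℂ)⁻¹ * (fourierZN N f ξ * e ((ξ:ℝ) * x / N)) *
        ((β y : ℂ) * e (-((ξ:ℝ) * y / N))) * ((β z : ℂ) * e (-((ξ:ℝ) * z / N))) := by
        rw [Finset.sum_congr rfl (fun y _ => Finset.sum_comm), Finset.sum_comm]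
    _ = _ := by
        rw [Finset.mul_sum]
        apply Finset.sum_congr rfl; intro ξ _
        simp_rw [← Finset.mul_sum]
        rw [← Finset.sum_mul, ← Finset.mul_sum]
        unfold fourierZN
        ring

lemma conv_bound (N : ℕ) (hN : 0 < N) (a ν β : ℕ → ℝ) (B : Finset ℕ) (hBN : B ⊆ Finset.range N)
    (hBne : B.Nonempty) (hβ : ∀ n, β n = if n ∈ B then ((B.card : ℝ))⁻¹ else 0)
    (ha0 : ∀ n, 0 ≤ a n) (ha : ∀ n < N, a n ≤ ν n) (C0 C1 : ℝ)
    (h0 : ‖fourierZN N ν 0‖ ≤ C0) (h1 : ∀ ξ, 0 < ξ → ξ < N → ‖fourierZN N ν ξ‖ ≤ C1) (hC1 : 0 ≤ C1)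
    (x : ℕ) :
    |convZN N (convZN N a β) β x| ≤ C0 / N + C1 / B.card := by
  have hNr : (0:ℝ) < N := by exact_mod_cast hN
  have hBc : (0:ℝ) < B.card := by exact_mod_cast hBne.card_pos
  have hβ0 : ∀ n, 0 ≤ β n := by intro n; rw [hβ]; split_ifs <;> positivity
  have hnn : 0 ≤ convZN N (convZN N a β) β x := by
    unfold convZN
    exact Finset.sum_nonneg fun y _ => mul_nonneg (Finset.sum_nonneg fun z _ => mul_nonneg (ha0 _) (hβ0 _)) (hβ0 _)
  have hle : convZN N (convZN N a β) β x ≤ convZN N (convZN N ν β) β x := by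
    unfold convZN
    refine Finset.sum_le_sum fun y _ => mul_le_mul_of_nonneg_right ?_ (hβ0 _)
    exact Finset.sum_le_sum fun z _ => mul_le_mul_of_nonneg_right (ha _ (Nat.mod_lt _ hN)) (hβ0 _)
  rw [abs_of_nonneg hnn]
  refine hle.trans ((le_abs_self _).trans ?_)
  rw [← Real.norm_eq_abs, ← Complex.norm_real, conv_conv_fourier N hN, norm_mul, norm_inv, Complex.norm_natCast]
  have hsumβ : ∑ n ∈ Finset.range N, β n = 1 := by
    simp_rw [hβ]
    rw [Finset.sum_ite_mem, Finset.inter_eq_right.mpr hBN, Finset.sum_const, nsmul_eq_mul]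
    field_simp
  have hsumβ2 : ∑ n ∈ Finset.range N, β n ^ 2 = (B.card : ℝ)⁻¹ := by
    have : ∀ n, β n ^ 2 = if n ∈ B then ((B.card : ℝ)⁻¹) ^ 2 else 0 := by
      intro n; rw [hβ]; split_ifs <;> simp
    simp_rw [this]
    rw [Finset.sum_ite_mem, Finset.inter_eq_right.mpr hBN, Finset.sum_const, nsmul_eq_mul]
    field_simp
  have hβ0f : fourierZN N β 0 = 1 := by
    unfold fourierZN
    have : ∀ n ∈ Finset.range N, (β n : ℂ) * e (-(((0:ℕ):ℝ) * n / N)) = β n := by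
      intro n _; simp [e_zero]
    rw [Finset.sum_congr rfl this, ← Complex.ofReal_sum, hsumβ]; simp
  have hpars := parseval N hN β
  rw [hsumβ2] at hpars
  have hterm : ∀ ξ ∈ Finset.range N, ‖fourierZN N ν ξ * (fourierZN N β ξ) ^ 2 * e ((ξ:ℝ) * x / N)‖ ≤
      (if ξ = 0 then C0 else 0) + C1 * ‖fourierZN N β ξ‖ ^ 2 := by
    intro ξ hξ
    rw [norm_mul, norm_e, mul_one, norm_mul, norm_pow]
    by_cases h : ξ = 0
    · subst h; rw [hβ0f]; simp; linarith
    · rw [if_neg h, zero_add]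
      exact mul_le_mul_of_nonneg_right (h1 ξ (by omega) (Finset.mem_range.mp hξ)) (by positivity)
  calc _ ≤ (N:ℝ)⁻¹ * ∑ ξ ∈ Finset.range N, ((if ξ = 0 then C0 else 0) + C1 * ‖fourierZN N β ξ‖ ^ 2) := by
        gcongr
        exact (norm_sum_le _ _).trans (Finset.sum_le_sum hterm)
    _ = (N:ℝ)⁻¹ * (C0 + C1 * (N * (B.card : ℝ)⁻¹)) := by
        rw [Finset.sum_add_distrib, ← Finset.mul_sum, hpars]
        simp [hN]
    _ = _ := by field_simp

noncomputable def ordSet (l : ℕ) : Finset UnitAddCircle :=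
  if h : 0 < l then (AddCircle.finite_setOfPred_addOrderOf_eq (1:ℝ) h).toFinset else ∅

lemma mem_ordSet {l : ℕ} (hl : 0 < l) (u : UnitAddCircle) : u ∈ ordSet l ↔ addOrderOf u = l := by
  unfold ordSet; rw [dif_pos hl]; simp

lemma card_ordSet {l : ℕ} (hl : 0 < l) : (ordSet l).card = l.totient := by
  haveI : Fact ((0:ℝ) < 1) := ⟨one_pos⟩
  rw [← AddCircle.card_addOrderOf_eq_totient (1:ℝ) (n := l)]
  rw [Nat.subtype_card (ordSet l) (fun u => mem_ordSet hl u)]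

noncomputable def chi (u : UnitAddCircle) : ℂ := ((AddCircle.toCircle u : Circle) : ℂ)

lemma chi_add (u v : UnitAddCircle) : chi (u + v) = chi u * chi v := by
  unfold chi; rw [AddCircle.toCircle_add]; rfl

lemma chi_zero : chi 0 = 1 := by unfold chi; simp

lemma chi_coe (t : ℝ) : chi (t : UnitAddCircle) = e t := (e_toCircle t).symm

lemma norm_chi (u : UnitAddCircle) : ‖chi u‖ = 1 := Circle.norm_coe _

lemma chi_neg (u : UnitAddCircle) : chi (-u) = (starRingEnd ℂ) (chi u) := by
  unfold chi; rw [AddCircle.toCircle_neg]; exact Circle.coe_inv_eq_conj _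

lemma chi_ne_one {u : UnitAddCircle} (hu : u ≠ 0) : chi u ≠ 1 := by
  intro h
  apply hu
  apply AddCircle.injective_toCircle (T := (1:ℝ)) one_ne_zero
  rw [AddCircle.toCircle_zero]
  apply Circle.ext
  simpa [chi] using h

lemma ramanujan (l y : ℕ) (hl : 0 < l) (hly : l.Coprime y) :
    ∑ u ∈ ordSet l, chi (y • u) = (ArithmeticFunction.moebius l : ℂ) := by
  have key : ∀ n : ℕ, 0 < n → n ∈ {n : ℕ | n.Coprime y} →
      ∑ i ∈ n.divisors, (∑ u ∈ ordSet i, chi (y • u)) = if n = 1 then (1:ℂ) else 0 := by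
    intro n hn hny
    have hny : n.Coprime y := hny
    set T := (AddCircle.finite_torsion (1:ℝ) hn).toFinset with hT
    have hmT : ∀ u, u ∈ T ↔ n • u = 0 := by intro u; simp [hT]
    have hbi : T = n.divisors.biUnion ordSet := by
      ext u
      rw [hmT, Finset.mem_biUnion]
      constructor
      · intro h
        have hd := addOrderOf_dvd_of_nsmul_eq_zero h
        exact ⟨addOrderOf u, Nat.mem_divisors.mpr ⟨hd, hn.ne'⟩, (mem_ordSet (Nat.pos_of_dvd_of_pos hd hn) u).mpr rfl⟩
      · rintro ⟨d, hd, hu⟩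
        have hd' := (Nat.mem_divisors.mp hd).1
        rw [mem_ordSet (Nat.pos_of_dvd_of_pos hd' hn)] at hu
        rw [← addOrderOf_dvd_iff_nsmul_eq_zero, hu]; exact hd'
    have hsum : ∑ i ∈ n.divisors, (∑ u ∈ ordSet i, chi (y • u)) = ∑ u ∈ T, chi (y • u) := by
      rw [hbi, Finset.sum_biUnion]
      intro a ha b hb hab
      rw [Function.onFun, Finset.disjoint_left]
      intro u hua hub
      have ha' := Nat.pos_of_mem_divisors (Finset.mem_coe.mp ha)
      have hb' := Nat.pos_of_mem_divisors (Finset.mem_coe.mp hb)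
      rw [mem_ordSet ha'] at hua
      rw [mem_ordSet hb'] at hub
      exact hab (hua.symm.trans hub)
    rw [hsum]
    split_ifs with h1
    · subst h1
      have : T = {0} := by ext u; rw [hmT]; simp
      rw [this]; simp [chi_zero]
    · set u0 : UnitAddCircle := (((1:ℝ) / n : ℝ) : UnitAddCircle) with hu0
      have hord : addOrderOf u0 = n := by
        haveI : Fact ((0:ℝ) < 1) := ⟨one_pos⟩
        exact AddCircle.addOrderOf_period_div hn
      have hne : y • u0 ≠ 0 := by
        intro h
        have := addOrderOf_dvd_of_nsmul_eq_zero h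
        rw [hord] at this
        exact h1 (Nat.Coprime.eq_one_of_dvd hny this)
      have hn0 : n • u0 = 0 := by rw [← hord]; exact addOrderOf_nsmul_eq_zero _
      have hshift : ∑ u ∈ T, chi (y • u) = chi (y • u0) * ∑ u ∈ T, chi (y • u) := by
        rw [Finset.mul_sum]
        symm
        apply Finset.sum_bij (fun u _ => u0 + u)
        · intro u hu; rw [hmT] at hu ⊢; rw [smul_add, hn0, hu, add_zero]
        · intro a _ b _ h; exact add_left_cancel h
        · intro b hb; refine ⟨b - u0, ?_, by abel⟩
          rw [hmT] at hb ⊢; rw [smul_sub, hn0, hb, sub_zero]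
        · intro u _; rw [smul_add, chi_add]
      have h3 : (chi (y • u0) - 1) * ∑ u ∈ T, chi (y • u) = 0 := by
        rw [sub_mul, ← hshift]; ring
      rcases mul_eq_zero.mp h3 with h | h
      · exact absurd (sub_eq_zero.mp h) (chi_ne_one hne)
      · exact h
  have := (ArithmeticFunction.sum_eq_iff_sum_mul_moebius_eq_on {n : ℕ | n.Coprime y}
    (fun m n hmn hn => Nat.Coprime.coprime_dvd_left hmn hn)).mp key l hl hly
  rw [← this]
  rw [Finset.sum_eq_single (l, 1)]
  · simp
  · rintro ⟨a, b⟩ hab hne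
    rw [Nat.mem_divisorsAntidiagonal] at hab
    have : b ≠ 1 := by
      rintro rfl
      apply hne
      simp at hab ⊢; exact hab.1
    simp [this]
  · intro h; exfalso; apply h; simp; omega

noncomputable def SL (D m : ℕ) : Finset ℕ :=
  (Finset.Icc 1 D).filter (fun l => Squarefree l ∧ l.Coprime m)

noncomputable def GS (D m : ℕ) : ℝ := ∑ l ∈ SL D m, (1 : ℝ) / (Nat.totient l)

noncomputable def FS (D m : ℕ) : Finset UnitAddCircle := (SL D m).biUnion ordSet

noncomputable def wt (D m : ℕ) (u : UnitAddCircle) : ℝ :=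
  (ArithmeticFunction.moebius (addOrderOf u) : ℝ) / (GS D m * (Nat.totient (addOrderOf u)))

noncomputable def Lam (D m y : ℕ) : ℂ := ∑ u ∈ FS D m, (wt D m u : ℂ) * chi (y • u)

lemma mem_SL {D m l : ℕ} : l ∈ SL D m ↔ (1 ≤ l ∧ l ≤ D) ∧ Squarefree l ∧ l.Coprime m := by
  unfold SL; rw [Finset.mem_filter, Finset.mem_Icc]

lemma mem_FS {D m : ℕ} {u : UnitAddCircle} : u ∈ FS D m ↔ addOrderOf u ∈ SL D m := by
  unfold FS; rw [Finset.mem_biUnion]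
  constructor
  · rintro ⟨l, hl, hu⟩
    rw [mem_ordSet (mem_SL.mp hl).1.1] at hu
    rwa [hu]
  · intro h; exact ⟨_, h, (mem_ordSet (mem_SL.mp h).1.1 u).mpr rfl⟩

lemma sum_FS {D m : ℕ} {A : Type*} [AddCommMonoid A] (g : UnitAddCircle → A) :
    ∑ u ∈ FS D m, g u = ∑ l ∈ SL D m, ∑ u ∈ ordSet l, g u := by
  unfold FS; rw [Finset.sum_biUnion]
  intro a ha b hb hab
  rw [Function.onFun, Finset.disjoint_left]
  intro u hua hub
  rw [mem_ordSet (mem_SL.mp ha).1.1] at hua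
  rw [mem_ordSet (mem_SL.mp hb).1.1] at hub
  exact hab (hua.symm.trans hub)

lemma sum_FS_ord {D m : ℕ} (g : ℕ → ℝ) :
    ∑ u ∈ FS D m, g (addOrderOf u) = ∑ l ∈ SL D m, (Nat.totient l : ℝ) * g l := by
  rw [sum_FS]
  apply Finset.sum_congr rfl
  intro l hl
  have hl1 := (mem_SL.mp hl).1.1
  rw [Finset.sum_congr rfl (fun u hu => by rw [(mem_ordSet hl1 u).mp hu])]
  rw [Finset.sum_const, card_ordSet hl1, nsmul_eq_mul]

lemma one_le_GS {D m : ℕ} (hD : 1 ≤ D) : 1 ≤ GS D m := by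
  unfold GS
  have h1 : 1 ∈ SL D m := mem_SL.mpr ⟨⟨le_rfl, hD⟩, squarefree_one, Nat.coprime_one_left m⟩
  have := Finset.single_le_sum (f := fun l : ℕ => (1:ℝ) / (Nat.totient l)) (fun l _ => by positivity) h1
  simpa using this

lemma abs_wt {D m : ℕ} (hD : 1 ≤ D) {u : UnitAddCircle} (hu : u ∈ FS D m) :
    |wt D m u| = 1 / (GS D m * Nat.totient (addOrderOf u)) := by
  have hG := one_le_GS (m := m) hD
  have hs := (mem_SL.mp (mem_FS.mp hu)).2.1
  unfold wt
  rw [abs_div, abs_of_nonneg (a := GS D m * _) (by positivity)]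
  congr 1
  have := ArithmeticFunction.abs_moebius_eq_one_of_squarefree hs
  rw [← Int.cast_abs, this]; simp

lemma Lam_eq_one {D m y : ℕ} (hD : 1 ≤ D) (hy : ∀ l ∈ SL D m, l.Coprime y) : Lam D m y = 1 := by
  have hG := one_le_GS (m := m) hD
  unfold Lam
  rw [sum_FS]
  have : ∀ l ∈ SL D m, ∑ u ∈ ordSet l, (wt D m u : ℂ) * chi (y • u) =
      (((1 / (Nat.totient l : ℝ)) / GS D m : ℝ) : ℂ) := by
    intro l hl
    have hl' := mem_SL.mp hl
    have hs := hl'.2.1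
    have h1 : ∑ u ∈ ordSet l, (wt D m u : ℂ) * chi (y • u) =
        (((ArithmeticFunction.moebius l : ℝ) / (GS D m * (Nat.totient l)) : ℝ) : ℂ) * ∑ u ∈ ordSet l, chi (y • u) := by
      rw [Finset.mul_sum]
      apply Finset.sum_congr rfl
      intro u hu
      rw [mem_ordSet hl'.1.1] at hu
      unfold wt; rw [hu]
    rw [h1, ramanujan l y hl'.1.1 (hy l hl)]
    have hmu : (ArithmeticFunction.moebius l : ℝ) * (ArithmeticFunction.moebius l : ℝ) = 1 := by
      have := ArithmeticFunction.moebius_sq_eq_one_of_squarefree hs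
      rw [sq] at this; exact_mod_cast this
    have hphi : (0:ℝ) < Nat.totient l := by exact_mod_cast Nat.totient_pos.mpr hl'.1.1
    have : ((ArithmeticFunction.moebius l : ℤ) : ℂ) = (((ArithmeticFunction.moebius l : ℝ)) : ℂ) := by push_cast; rfl
    rw [this, ← Complex.ofReal_mul]
    congr 1
    rw [div_mul_eq_mul_div, hmu]; field_simp
  rw [Finset.sum_congr rfl this, ← Complex.ofReal_sum, ← Finset.sum_div]
  have h2 : ∑ l ∈ SL D m, (1:ℝ) / (Nat.totient l) = GS D m := rfl
  rw [h2, div_self (by positivity)]; simp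

lemma sum_abs_wt {D m : ℕ} (hD : 1 ≤ D) : ∑ u ∈ FS D m, |wt D m u| ≤ D := by
  have hG := one_le_GS (m := m) hD
  rw [Finset.sum_congr rfl (fun u hu => abs_wt hD hu)]
  rw [sum_FS_ord (fun l => 1 / (GS D m * Nat.totient l))]
  calc _ ≤ ∑ l ∈ SL D m, (1:ℝ) := by
        apply Finset.sum_le_sum; intro l hl
        have hphi : (0:ℝ) < Nat.totient l := by exact_mod_cast Nat.totient_pos.mpr (mem_SL.mp hl).1.1
        rw [mul_one_div, div_le_one (by positivity)]
        nlinarith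
    _ = (SL D m).card := by simp
    _ ≤ D := by
        have : (SL D m).card ≤ (Finset.Icc 1 D).card := Finset.card_filter_le _ _
        rw [Nat.card_Icc] at this
        exact_mod_cast (by omega : (SL D m).card ≤ D)

lemma sum_wt_sq {D m : ℕ} (hD : 1 ≤ D) : ∑ u ∈ FS D m, |wt D m u| ^ 2 = 1 / GS D m := by
  have hG := one_le_GS (m := m) hD
  rw [Finset.sum_congr rfl (fun u hu => by rw [abs_wt hD hu])]
  rw [sum_FS_ord (fun l => (1 / (GS D m * Nat.totient l)) ^ 2)]
  have : ∀ l ∈ SL D m, (Nat.totient l : ℝ) * (1 / (GS D m * Nat.totient l)) ^ 2 =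
      (1 / GS D m ^ 2) * (1 / (Nat.totient l : ℝ)) := by
    intro l hl
    have hphi : (0:ℝ) < Nat.totient l := by exact_mod_cast Nat.totient_pos.mpr (mem_SL.mp hl).1.1
    field_simp
  rw [Finset.sum_congr rfl this, ← Finset.mul_sum]
  have h2 : ∑ l ∈ SL D m, (1:ℝ) / (Nat.totient l) = GS D m := rfl
  rw [h2]; field_simp

lemma sum_wt_sq_p {D m p : ℕ} (hD : 1 ≤ D) (hp : p.Prime) :
    ∑ u ∈ (FS D m).filter (fun u => p ∣ addOrderOf u), |wt D m u| ^ 2 ≤ 1 / ((p - 1 : ℝ) * GS D m) := by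
  have hG := one_le_GS (m := m) hD
  have hp1 : (0:ℝ) < (p:ℝ) - 1 := by
    have : (1:ℝ) < p := by exact_mod_cast hp.one_lt
    linarith
  rw [Finset.sum_filter]
  have h1 : ∀ u ∈ FS D m, (if p ∣ addOrderOf u then |wt D m u| ^ 2 else 0) =
      (fun l : ℕ => if p ∣ l then (1 / (GS D m * Nat.totient l)) ^ 2 else 0) (addOrderOf u) := by
    intro u hu; simp only; rw [abs_wt hD hu]
  rw [Finset.sum_congr rfl h1, sum_FS_ord (fun l : ℕ => if p ∣ l then (1 / (GS D m * Nat.totient l)) ^ 2 else 0)]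
  have h2 : ∑ l ∈ SL D m, (Nat.totient l : ℝ) * (if p ∣ l then (1 / (GS D m * Nat.totient l)) ^ 2 else 0) =
      ∑ l ∈ (SL D m).filter (fun l => p ∣ l), (1 / GS D m ^ 2) * (1 / (Nat.totient l : ℝ)) := by
    rw [Finset.sum_filter]
    apply Finset.sum_congr rfl
    intro l hl
    have hphi : (0:ℝ) < Nat.totient l := by exact_mod_cast Nat.totient_pos.mpr (mem_SL.mp hl).1.1
    split_ifs
    · field_simp
    · simp
  rw [h2, ← Finset.mul_sum]
  have h3 : ∑ l ∈ (SL D m).filter (fun l => p ∣ l), (1 / (Nat.totient l : ℝ)) ≤ (1 / ((p:ℝ) - 1)) * GS D m := by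
    have hval : ∀ l ∈ (SL D m).filter (fun l => p ∣ l), l / p ∈ SL D m ∧
        (1 / (Nat.totient l : ℝ)) = (1 / ((p:ℝ) - 1)) * (1 / (Nat.totient (l / p) : ℝ)) := by
      intro l hl
      rw [Finset.mem_filter, mem_SL] at hl
      obtain ⟨⟨⟨hl1, hlD⟩, hsq, hcop⟩, k, rfl⟩ := hl
      rw [Nat.mul_div_cancel_left _ hp.pos]
      have hk : 1 ≤ k := Nat.pos_of_ne_zero (by rintro rfl; simp at hl1)
      have hcp : p.Coprime k := Nat.coprime_of_squarefree_mul hsq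
      refine ⟨mem_SL.mpr ⟨⟨hk, ?_⟩, hsq.of_mul_right, Nat.Coprime.coprime_mul_left hcop⟩, ?_⟩
      · exact (Nat.le_mul_of_pos_left k hp.pos).trans hlD
      · rw [Nat.totient_mul hcp, Nat.totient_prime hp]
        push_cast [Nat.cast_sub hp.one_lt.le]
        field_simp
    rw [Finset.sum_congr rfl (fun l hl => (hval l hl).2), ← Finset.mul_sum]
    gcongr
    have hinj : Set.InjOn (fun l => l / p) ((SL D m).filter (fun l => p ∣ l) : Finset ℕ) := by
      intro a ha b hb hab
      have ha' := (Finset.mem_filter.mp (Finset.mem_coe.mp ha)).2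
      have hb' := (Finset.mem_filter.mp (Finset.mem_coe.mp hb)).2
      simp only at hab
      rw [← Nat.div_mul_cancel ha', ← Nat.div_mul_cancel hb', hab]
    have himg := Finset.sum_image (s := (SL D m).filter (fun l => p ∣ l)) (g := fun l => l / p)
      (f := fun k : ℕ => 1 / (Nat.totient k : ℝ)) hinj
    rw [← himg]
    apply Finset.sum_le_sum_of_subset_of_nonneg
    · intro k hk
      obtain ⟨l, hl, rfl⟩ := Finset.mem_image.mp hk
      exact (hval l hl).1
    · intros; positivity
  calc _ ≤ (1 / GS D m ^ 2) * ((1 / ((p:ℝ) - 1)) * GS D m) := by gcongr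
    _ = _ := by field_simp

lemma exists_p_part {p : ℕ} (hp : p.Prime) (α : UnitAddCircle) (q' : ℕ) (hq : addOrderOf α = p * q')
    (hq' : 0 < q') (hcop : p.Coprime q') :
    ∃ τ : UnitAddCircle, addOrderOf τ = p ∧ addOrderOf (α - τ) ∣ q' := by
  obtain ⟨s0, -, hs0⟩ := Nat.exists_mul_mod_eq_one_of_coprime (k := p) (n := q') hcop.symm hp.one_lt
  obtain ⟨s, hs⟩ : ∃ s : ℤ, ((q':ℤ) * s) % p = 1 := ⟨(s0 : ℤ), by exact_mod_cast hs0⟩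
  have hdvd : (p:ℤ) ∣ 1 - q' * s := by
    have : ((q':ℤ) * s) % p = 1 := hs
    have h2 := Int.emod_add_mul_ediv ((q':ℤ) * s) p
    rw [this] at h2
    exact ⟨-((q':ℤ) * s / p), by linarith⟩
  have hα : ((p * q' : ℕ) : ℤ) • α = 0 := by
    rw [natCast_zsmul, ← hq]; exact addOrderOf_nsmul_eq_zero α
  have hsub : q' • (α - ((q':ℤ) * s) • α) = 0 := by
    obtain ⟨t, ht⟩ := hdvd
    have : q' • (α - ((q':ℤ) * s) • α) = t • (((p * q' : ℕ) : ℤ) • α) := by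
      have h1 : α - ((q':ℤ) * s) • α = (1 - (q':ℤ) * s) • α := by rw [sub_smul, one_smul]
      rw [h1, ht, ← natCast_zsmul, smul_smul, smul_smul]; congr 1; push_cast; ring
    rw [this, hα, smul_zero]
  have hd := addOrderOf_dvd_of_nsmul_eq_zero hsub
  refine ⟨((q':ℤ) * s) • α, ?_, hd⟩
  have h1 : p • (((q':ℤ) * s) • α) = 0 := by
    have : p • (((q':ℤ) * s) • α) = s • (((p * q' : ℕ) : ℤ) • α) := by
      rw [← natCast_zsmul, smul_smul, smul_smul]; congr 1; push_cast; ring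
    rw [this, hα, smul_zero]
  have h2 := addOrderOf_dvd_of_nsmul_eq_zero h1
  rcases (Nat.dvd_prime hp).mp h2 with h | h
  · exfalso
    rw [AddMonoid.addOrderOf_eq_one_iff] at h
    rw [h, sub_zero, hq] at hd
    have := Nat.le_of_dvd hq' hd
    have := hp.one_lt
    nlinarith
  · exact h

lemma corr_half {D m p : ℕ} (hD : 1 ≤ D) (hp : p.Prime) (α τ : UnitAddCircle)
    (hτ : addOrderOf τ = p) (hα' : ¬ p ∣ addOrderOf (α - τ)) (hα'' : 0 < addOrderOf (α - τ)) :
    ∑ u ∈ (FS D m).filter (fun u => u - α ∈ FS D m ∧ p ∣ addOrderOf u ∧ ¬ p ∣ addOrderOf (u - α)),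
      |wt D m u| * |wt D m (u - α)| ≤ 1 / ((p - 1 : ℝ) * GS D m) := by
  have hG := one_le_GS (m := m) hD
  have hp1 : (0:ℝ) < (p:ℝ) - 1 := by
    have : (1:ℝ) < p := by exact_mod_cast hp.one_lt
    linarith
  set X := (FS D m).filter (fun u => u - α ∈ FS D m ∧ p ∣ addOrderOf u ∧ ¬ p ∣ addOrderOf (u - α)) with hX
  have hu : ∀ u ∈ X, u - τ ∈ FS D m ∧ |wt D m u| = (1 / ((p:ℝ) - 1)) * |wt D m (u - τ)| := by
    intro u hu
    rw [hX, Finset.mem_filter] at hu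
    obtain ⟨huF, hvF, hpu, hpv⟩ := hu
    have hv := mem_SL.mp (mem_FS.mp hvF)
    have hU := mem_SL.mp (mem_FS.mp huF)
    have hd : addOrderOf (u - τ) ∣ addOrderOf (u - α) * addOrderOf (α - τ) := by
      have : u - τ = (u - α) + (α - τ) := by abel
      rw [this]
      exact (AddCommute.all _ _).addOrderOf_add_dvd_mul_addOrderOf
    have hnp : ¬ p ∣ addOrderOf (u - τ) := by
      intro h
      rcases (Nat.Prime.dvd_mul hp).mp (h.trans hd) with h | h
      · exact hpv h
      · exact hα' h
    have hcop : (addOrderOf (u - τ)).Coprime (addOrderOf τ) := by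
      rw [hτ]; exact ((Nat.Prime.coprime_iff_not_dvd hp).mpr hnp).symm
    have hmul : addOrderOf u = addOrderOf (u - τ) * p := by
      have := (AddCommute.all (u - τ) τ).addOrderOf_add_eq_mul_addOrderOf_of_coprime hcop
      rw [sub_add_cancel, hτ] at this; exact this
    set k := addOrderOf (u - τ) with hk
    have hk0 : 1 ≤ k := Nat.pos_of_ne_zero (by intro h; rw [h] at hmul; omega)
    have hkF : u - τ ∈ FS D m := by
      rw [mem_FS, mem_SL, ← hk]
      rw [hmul] at hU
      exact ⟨⟨hk0, (Nat.le_mul_of_pos_right k hp.pos).trans hU.1.2⟩, hU.2.1.of_mul_left,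
        Nat.Coprime.coprime_mul_right hU.2.2⟩
    refine ⟨hkF, ?_⟩
    rw [abs_wt hD huF, abs_wt hD hkF, hmul, ← hk]
    rw [Nat.totient_mul (by rw [hτ] at hcop; exact hcop), Nat.totient_prime hp]
    have hphi : (0:ℝ) < Nat.totient k := by exact_mod_cast Nat.totient_pos.mpr hk0
    push_cast [Nat.cast_sub hp.one_lt.le]
    field_simp
  have himg : ∀ σ : UnitAddCircle, (∀ u ∈ X, u - σ ∈ FS D m) → ∑ u ∈ X, |wt D m (u - σ)| ^ 2 ≤ 1 / GS D m := by
    intro σ hσ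
    rw [← sum_wt_sq (m := m) hD]
    have := Finset.sum_image (s := X) (g := fun u => u - σ) (f := fun v => |wt D m v| ^ 2)
      (by intro a _ b _ h; exact sub_left_injective h)
    rw [← this]
    apply Finset.sum_le_sum_of_subset_of_nonneg
    · intro k hk
      obtain ⟨l, hl, rfl⟩ := Finset.mem_image.mp hk
      exact hσ l hl
    · intros; positivity
  have e1 := himg τ (fun u h => (hu u h).1)
  have e2 := himg α (fun u h => by rw [hX, Finset.mem_filter] at h; exact h.2.1)
  calc _ ≤ ∑ u ∈ X, (1 / ((p:ℝ) - 1)) * ((|wt D m (u - τ)| ^ 2 + |wt D m (u - α)| ^ 2) / 2) := by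
        apply Finset.sum_le_sum
        intro u h
        rw [(hu u h).2, mul_assoc]
        gcongr
        nlinarith [sq_nonneg (|wt D m (u - τ)| - |wt D m (u - α)|)]
    _ = (1 / ((p:ℝ) - 1)) * ((∑ u ∈ X, |wt D m (u - τ)| ^ 2 + ∑ u ∈ X, |wt D m (u - α)| ^ 2) / 2) := by
        rw [← Finset.mul_sum, ← Finset.sum_div, Finset.sum_add_distrib]
    _ ≤ (1 / ((p:ℝ) - 1)) * ((1 / GS D m + 1 / GS D m) / 2) := by gcongr
    _ = _ := by field_simp; ring

lemma corr_bound {D m W : ℕ} (hD : 1 ≤ D) (hW0 : 0 < W) (hW : ∀ p : ℕ, p.Prime → ¬ p ∣ m → W < p)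
    (α : UnitAddCircle) (hα : α ≠ 0) :
    ∑ u ∈ (FS D m).filter (fun u => u - α ∈ FS D m), |wt D m u| * |wt D m (u - α)|
      ≤ 3 / (W * GS D m) := by
  have hG := one_le_GS (m := m) hD
  have hWr : (0:ℝ) < W := by exact_mod_cast hW0
  set X := (FS D m).filter (fun u => u - α ∈ FS D m) with hX
  rcases X.eq_empty_or_nonempty with h | ⟨u0, hu0⟩
  · rw [h]; simp; positivity
  rw [hX, Finset.mem_filter] at hu0
  have hU := mem_SL.mp (mem_FS.mp hu0.1)
  have hV := mem_SL.mp (mem_FS.mp hu0.2)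
  have hlcm : addOrderOf α ∣ Nat.lcm (addOrderOf u0) (addOrderOf (u0 - α)) := by
    have h1 : α = u0 + (-(u0 - α)) := by abel
    have h2 := (AddCommute.all u0 (-(u0 - α))).addOrderOf_add_dvd_lcm
    rw [← h1, addOrderOf_neg] at h2; exact h2
  have hsq : Squarefree (addOrderOf α) := by
    have : Squarefree (Nat.lcm (addOrderOf u0) (addOrderOf (u0 - α))) := by
      rw [Nat.squarefree_iff_prime_squarefree]
      intro x hx hd
      set a := addOrderOf u0
      set b := addOrderOf (u0 - α)
      have ha := (Nat.squarefree_iff_factorization_le_one (by omega)).mp hU.2.1 x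
      have hb := (Nat.squarefree_iff_factorization_le_one (by omega)).mp hV.2.1 x
      have h3 := Nat.factorization_lcm (a := a) (b := b) (by omega) (by omega)
      have h4 : (a.lcm b).factorization x ≤ 1 := by
        rw [h3]; simp [Finsupp.sup_apply]; exact ⟨ha, hb⟩
      have h5 : 2 ≤ (a.lcm b).factorization x := by
        rw [← hx.pow_dvd_iff_le_factorization (Nat.lcm_ne_zero (by omega) (by omega))]
        rw [sq]; exact hd
      omega
    exact this.squarefree_of_dvd hlcm
  have hcopm : (addOrderOf α).Coprime m := by
    apply Nat.Coprime.coprime_dvd_left hlcm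
    apply Nat.Coprime.coprime_dvd_left (Nat.lcm_dvd_mul _ _)
    exact Nat.Coprime.mul_left hU.2.2 hV.2.2
  have hne1 : addOrderOf α ≠ 1 := by rwa [Ne, AddMonoid.addOrderOf_eq_one_iff]
  obtain ⟨p, hp, hpd⟩ := Nat.exists_prime_and_dvd hne1
  have hpm : ¬ p ∣ m := by
    intro h
    have := Nat.dvd_gcd hpd h
    rw [hcopm] at this
    exact hp.one_lt.ne' (Nat.dvd_one.mp this)
  have hpW := hW p hp hpm
  obtain ⟨q', hq'⟩ := hpd
  have hq'0 : 0 < q' := Nat.pos_of_ne_zero (by rintro rfl; rw [mul_zero] at hq'; rw [hq'] at hsq; exact not_squarefree_zero hsq)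
  have hcp : p.Coprime q' := Nat.coprime_of_squarefree_mul (by rw [← hq']; exact hsq)
  have hpart : ∀ α' : UnitAddCircle, addOrderOf α' = p * q' → ∃ τ : UnitAddCircle, addOrderOf τ = p ∧ ¬ p ∣ addOrderOf (α' - τ) ∧ 0 < addOrderOf (α' - τ) := by
    intro α' hα'
    obtain ⟨τ, h1, h2⟩ := exists_p_part hp α' q' hα' hq'0 hcp
    refine ⟨τ, h1, ?_, Nat.pos_of_dvd_of_pos h2 hq'0⟩
    intro h
    exact (Nat.Prime.coprime_iff_not_dvd hp).mp hcp (h.trans h2)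
  obtain ⟨τ1, a1, a2, a3⟩ := hpart α hq'
  obtain ⟨τ2, b1, b2, b3⟩ := hpart (-α) (by rw [addOrderOf_neg, hq'])
  have c1 := corr_half (m := m) hD hp α τ1 a1 a2 a3
  have c2 := corr_half (m := m) hD hp (-α) τ2 b1 b2 b3
  have c0 := sum_wt_sq_p (m := m) hD hp
  rw [Finset.sum_filter] at c0
  have hsplit : ∑ u ∈ X, |wt D m u| * |wt D m (u - α)| ≤
      ∑ u ∈ X, ((if p ∣ addOrderOf u then |wt D m u| ^ 2 else 0) / 2 +
        (if p ∣ addOrderOf (u - α) then |wt D m (u - α)| ^ 2 else 0) / 2 +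
        (if p ∣ addOrderOf u ∧ ¬ p ∣ addOrderOf (u - α) then |wt D m u| * |wt D m (u - α)| else 0) +
        (if ¬ p ∣ addOrderOf u ∧ p ∣ addOrderOf (u - α) then |wt D m u| * |wt D m (u - α)| else 0)) := by
    apply Finset.sum_le_sum
    intro u hu
    have hpos : 0 ≤ |wt D m u| * |wt D m (u - α)| := by positivity
    have hs1 := sq_nonneg (|wt D m u|)
    have hs2 := sq_nonneg (|wt D m (u - α)|)
    by_cases h1 : p ∣ addOrderOf u <;> by_cases h2 : p ∣ addOrderOf (u - α)
    · simp only [h1, h2, if_true, not_true, and_false, false_and, if_false]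
      nlinarith [sq_nonneg (|wt D m u| - |wt D m (u - α)|)]
    · simp only [h1, h2, if_true, not_true, not_false_iff, and_true, and_false, false_and, true_and, if_false]
      linarith
    · simp only [h1, h2, if_true, not_true, not_false_iff, and_true, and_false, false_and, true_and, if_false]
      linarith
    · exfalso
      have h3 : addOrderOf α ∣ addOrderOf u * addOrderOf (u - α) := by
        have h1 : α = u + (-(u - α)) := by abel
        have h2 := (AddCommute.all u (-(u - α))).addOrderOf_add_dvd_mul_addOrderOf
        rw [← h1, addOrderOf_neg] at h2; exact h2
      have h4 : p ∣ addOrderOf α := ⟨q', hq'⟩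
      rcases (Nat.Prime.dvd_mul hp).mp (h4.trans h3) with h | h
      · exact h1 h
      · exact h2 h
  rw [Finset.sum_add_distrib, Finset.sum_add_distrib, Finset.sum_add_distrib, ← Finset.sum_div, ← Finset.sum_div] at hsplit
  have d1 : ∑ u ∈ X, (if p ∣ addOrderOf u then |wt D m u| ^ 2 else 0) ≤ 1 / ((p - 1 : ℝ) * GS D m) := by
    refine le_trans ?_ c0
    exact Finset.sum_le_sum_of_subset_of_nonneg (Finset.filter_subset _ _) (by intros; split_ifs <;> positivity)
  have d2 : ∑ u ∈ X, (if p ∣ addOrderOf (u - α) then |wt D m (u - α)| ^ 2 else 0) ≤ 1 / ((p - 1 : ℝ) * GS D m) := by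
    refine le_trans ?_ c0
    have := Finset.sum_image (s := X) (g := fun u => u - α) (f := fun v => if p ∣ addOrderOf v then |wt D m v| ^ 2 else 0)
      (by intro a _ b _ h; exact sub_left_injective h)
    rw [← this]
    apply Finset.sum_le_sum_of_subset_of_nonneg
    · intro k hk
      obtain ⟨l, hl, rfl⟩ := Finset.mem_image.mp hk
      exact (Finset.mem_filter.mp hl).2
    · intros; split_ifs <;> positivity
  have d3 : ∑ u ∈ X, (if p ∣ addOrderOf u ∧ ¬ p ∣ addOrderOf (u - α) then |wt D m u| * |wt D m (u - α)| else 0) ≤ 1 / ((p - 1 : ℝ) * GS D m) := by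
    refine le_trans ?_ c1
    rw [← Finset.sum_filter, hX, Finset.filter_filter]
  have d4 : ∑ u ∈ X, (if ¬ p ∣ addOrderOf u ∧ p ∣ addOrderOf (u - α) then |wt D m u| * |wt D m (u - α)| else 0) ≤ 1 / ((p - 1 : ℝ) * GS D m) := by
    refine le_trans ?_ c2
    rw [← Finset.sum_filter, hX, Finset.filter_filter]
    apply le_of_eq
    apply Finset.sum_bij (fun u _ => u - α)
    · intro u hu
      rw [Finset.mem_filter] at hu ⊢
      have : u - α - -α = u := by abel
      rw [this]
      exact ⟨hu.2.1, hu.1, hu.2.2.2, hu.2.2.1⟩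
    · intro a _ b _ h; exact sub_left_injective h
    · intro v hv
      refine ⟨v + α, ?_, by abel⟩
      rw [Finset.mem_filter] at hv ⊢
      have : v - -α = v + α := by abel
      rw [this] at hv
      rw [add_sub_cancel_right]
      exact ⟨hv.2.1, hv.1, hv.2.2.2, hv.2.2.1⟩
    · intro u _
      have : u - α - -α = u := by abel
      rw [this, mul_comm]
  have hpr : (W:ℝ) ≤ (p:ℝ) - 1 := by
    have : (W:ℝ) + 1 ≤ p := by exact_mod_cast hpW
    linarith
  have hfin : 1 / ((p - 1 : ℝ) * GS D m) ≤ 1 / (W * GS D m) := by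
    apply one_div_le_one_div_of_le (by positivity)
    gcongr
  have : 3 / (W * GS D m) = 3 * (1 / (W * GS D m)) := by ring
  rw [this]
  linarith

noncomputable def SS (N m b ξ : ℕ) (z : UnitAddCircle) : ℂ :=
  ∑ n ∈ Finset.range N, chi ((m * n + b) • z) * e (-((ξ : ℝ) * n / N))

lemma lam_sq (D m y : ℕ) : ((‖Lam D m y‖ ^ 2 : ℝ) : ℂ) =
    ∑ u ∈ FS D m, ∑ v ∈ FS D m, ((wt D m u * wt D m v : ℝ) : ℂ) * chi (y • (u - v)) := by
  have h : ((‖Lam D m y‖ ^ 2 : ℝ) : ℂ) = Lam D m y * (starRingEnd ℂ) (Lam D m y) := by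
    rw [Complex.mul_conj, Complex.normSq_eq_norm_sq]
  rw [h]
  unfold Lam
  rw [map_sum, Finset.sum_mul_sum]
  apply Finset.sum_congr rfl; intro u _
  apply Finset.sum_congr rfl; intro v _
  rw [map_mul, Complex.conj_ofReal, ← chi_neg, sub_eq_add_neg, smul_add, smul_neg, chi_add]
  push_cast; ring

lemma SS_le (N m b ξ : ℕ) (z : UnitAddCircle) : ‖SS N m b ξ z‖ ≤ N := by
  unfold SS
  refine (norm_sum_le _ _).trans ?_
  calc _ ≤ ∑ n ∈ Finset.range N, (1:ℝ) := by
        apply Finset.sum_le_sum; intro n _; rw [norm_mul, norm_chi, norm_e, one_mul]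
    _ = N := by simp

lemma SS_le_norm (N m b ξ : ℕ) (z : UnitAddCircle) (Q : ℝ) (hQ : 0 < Q)
    (h : 1 / (2 * Q) ≤ ‖m • z - (((ξ:ℝ) / N : ℝ) : UnitAddCircle)‖) : ‖SS N m b ξ z‖ ≤ Q := by
  induction z using QuotientAddGroup.induction_on with
  | H r =>
  have h1 : m • (r : UnitAddCircle) - (((ξ:ℝ) / N : ℝ) : UnitAddCircle) = ((m * r - ξ / N : ℝ) : UnitAddCircle) := by
    rw [AddCircle.coe_sub, ← nsmul_eq_mul, AddCircle.coe_nsmul]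
  have h2 : SS N m b ξ (r : UnitAddCircle) = ∑ n ∈ Finset.range N, e (b * r + n * (m * r - ξ / N)) := by
    unfold SS
    apply Finset.sum_congr rfl; intro n _
    have : (m * n + b) • (r : UnitAddCircle) = (((m * n + b : ℕ) * r : ℝ) : UnitAddCircle) := by
      rw [← nsmul_eq_mul, AddCircle.coe_nsmul]
    rw [this, chi_coe, ← e_add]
    congr 1; push_cast; ring
  have h3 : 1 / (2 * Q) ≤ nint (m * r - ξ / N) := by
    rw [nint_eq_norm, ← h1]; exact h
  have h4 : 0 < nint (m * r - ξ / N) := lt_of_lt_of_le (by positivity) h3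
  change ‖SS N m b ξ (r : UnitAddCircle)‖ ≤ Q
  rw [h2]
  refine (geom_bound N (b * r) _ h4).trans ?_
  rw [div_le_iff₀ (by positivity)]
  rw [div_le_iff₀ (by positivity)] at h3
  linarith

lemma T_general (D m b N ξ : ℕ) (hD : 1 ≤ D) (α : UnitAddCircle) (M : ℝ) (hM : 0 ≤ M)
    (h : ∀ u ∈ FS D m, ∀ v ∈ FS D m, u - v = α ∨ ‖SS N m b ξ (u - v)‖ ≤ M) :
    ‖∑ n ∈ Finset.range N, ((‖Lam D m (m * n + b)‖ ^ 2 : ℝ) : ℂ) * e (-((ξ : ℝ) * n / N))‖ ≤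
      N * (∑ u ∈ (FS D m).filter (fun u => u - α ∈ FS D m), |wt D m u| * |wt D m (u - α)|) + M * D ^ 2 := by
  have h1 : ∑ n ∈ Finset.range N, ((‖Lam D m (m * n + b)‖ ^ 2 : ℝ) : ℂ) * e (-((ξ : ℝ) * n / N)) =
      ∑ u ∈ FS D m, ∑ v ∈ FS D m, ((wt D m u * wt D m v : ℝ) : ℂ) * SS N m b ξ (u - v) := by
    simp_rw [lam_sq, Finset.sum_mul]
    rw [Finset.sum_comm]
    apply Finset.sum_congr rfl; intro u _
    rw [Finset.sum_comm]
    apply Finset.sum_congr rfl; intro v _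
    unfold SS
    rw [Finset.mul_sum]
    apply Finset.sum_congr rfl; intro n _
    ring
  rw [h1]
  have h2 : ∀ u ∈ FS D m, ∀ v ∈ FS D m, ‖((wt D m u * wt D m v : ℝ) : ℂ) * SS N m b ξ (u - v)‖ ≤
      (if v = u - α then N * (|wt D m u| * |wt D m v|) else 0) + M * (|wt D m u| * |wt D m v|) := by
    intro u hu v hv
    rw [norm_mul, Complex.norm_real, Real.norm_eq_abs, abs_mul]
    have hp : 0 ≤ |wt D m u| * |wt D m v| := by positivity
    by_cases hv' : v = u - α
    · rw [if_pos hv']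
      have := mul_le_mul_of_nonneg_left (SS_le N m b ξ (u - v)) hp
      have := mul_nonneg hM hp
      linarith
    · rw [if_neg hv']
      rcases h u hu v hv with h | h
      · exfalso; apply hv'; rw [← h]; abel
      · have := mul_le_mul_of_nonneg_left h hp
        linarith
  calc _ ≤ ∑ u ∈ FS D m, ∑ v ∈ FS D m, ((if v = u - α then N * (|wt D m u| * |wt D m v|) else 0) + M * (|wt D m u| * |wt D m v|)) := by
        refine (norm_sum_le _ _).trans (Finset.sum_le_sum fun u hu => ?_)
        exact (norm_sum_le _ _).trans (Finset.sum_le_sum fun v hv => h2 u hu v hv)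
    _ = N * (∑ u ∈ (FS D m).filter (fun u => u - α ∈ FS D m), |wt D m u| * |wt D m (u - α)|) + M * ((∑ u ∈ FS D m, |wt D m u|) * (∑ u ∈ FS D m, |wt D m u|)) := by
        simp_rw [Finset.sum_add_distrib]
        congr 1
        · rw [Finset.sum_filter, Finset.mul_sum]
          apply Finset.sum_congr rfl; intro u _
          rw [Finset.sum_ite_eq' (FS D m) (u - α) (fun v => (N:ℝ) * (|wt D m u| * |wt D m v|))]
          split_ifs <;> simp
        · rw [Finset.sum_mul_sum, Finset.mul_sum]
          apply Finset.sum_congr rfl; intro u _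
          rw [Finset.mul_sum]
    _ ≤ _ := by
        have hw := sum_abs_wt (m := m) hD
        have hw0 : 0 ≤ ∑ u ∈ FS D m, |wt D m u| := Finset.sum_nonneg (fun _ _ => abs_nonneg _)
        have : (∑ u ∈ FS D m, |wt D m u|) * (∑ u ∈ FS D m, |wt D m u|) ≤ (D:ℝ) ^ 2 := by nlinarith
        gcongr

lemma norm_lower (m q Q : ℕ) (z : UnitAddCircle) (hq0 : 0 < q) (hq : q ≤ Q) (hc : q.Coprime m) (hz : q • z = 0) (hz0 : z ≠ 0) :
    1 / (Q:ℝ) ≤ ‖m • z‖ := by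
  have hne : m • z ≠ 0 := by
    intro h
    have h1 := addOrderOf_dvd_of_nsmul_eq_zero h
    have h2 := addOrderOf_dvd_of_nsmul_eq_zero hz
    have := Nat.dvd_gcd h2 h1
    rw [hc] at this
    exact hz0 (AddMonoid.addOrderOf_eq_one_iff.mp (Nat.dvd_one.mp this))
  have hq2 : q • (m • z) = 0 := by rw [smul_comm, hz, smul_zero]
  have hfin : IsOfFinAddOrder (m • z) := isOfFinAddOrder_iff_nsmul_eq_zero.mpr ⟨q, hq0, hq2⟩
  haveI : Fact ((0:ℝ) < 1) := ⟨one_pos⟩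
  have h3 := AddCircle.le_add_order_smul_norm_of_isOfFinAddOrder (p := (1:ℝ)) hfin hne
  have h4 : addOrderOf (m • z) ≤ Q := (Nat.le_of_dvd hq0 (addOrderOf_dvd_of_nsmul_eq_zero hq2)).trans hq
  rw [nsmul_eq_mul] at h3
  have hQ : (0:ℝ) < Q := by exact_mod_cast lt_of_lt_of_le hq0 hq
  rw [div_le_iff₀ hQ]
  have : (addOrderOf (m • z) : ℝ) ≤ Q := by exact_mod_cast h4
  nlinarith [norm_nonneg (m • z)]

lemma FS_sub_ann {D m : ℕ} {u v : UnitAddCircle} (hu : u ∈ FS D m) (hv : v ∈ FS D m) :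
    ∃ q : ℕ, 0 < q ∧ q ≤ D ^ 2 ∧ q.Coprime m ∧ q • (u - v) = 0 := by
  have hU := mem_SL.mp (mem_FS.mp hu)
  have hV := mem_SL.mp (mem_FS.mp hv)
  refine ⟨addOrderOf u * addOrderOf v, Nat.mul_pos hU.1.1 hV.1.1, ?_, Nat.Coprime.mul_left hU.2.2 hV.2.2, ?_⟩
  · rw [sq]; exact Nat.mul_le_mul hU.1.2 hV.1.2
  · rw [smul_sub]
    have h1 : (addOrderOf u * addOrderOf v) • u = 0 := by
      rw [mul_comm, mul_smul, addOrderOf_nsmul_eq_zero, smul_zero]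
    have h2 : (addOrderOf u * addOrderOf v) • v = 0 := by
      rw [mul_smul, addOrderOf_nsmul_eq_zero, smul_zero]
    rw [h1, h2, sub_zero]

lemma T0_zero (D m b N : ℕ) (hD : 1 ≤ D) :
    ‖∑ n ∈ Finset.range N, ((‖Lam D m (m * n + b)‖ ^ 2 : ℝ) : ℂ) * e (-(((0:ℕ) : ℝ) * n / N))‖ ≤
      N / GS D m + D ^ 6 := by
  have hDr : (1:ℝ) ≤ D := by exact_mod_cast hD
  have h := T_general D m b N 0 hD 0 (D ^ 4) (by positivity) (by
    intro u hu v hv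
    by_cases h0 : u - v = 0
    · left; exact h0
    right
    obtain ⟨q, hq0, hq, hc, hz⟩ := FS_sub_ann hu hv
    have h1 := norm_lower m q (D ^ 2) (u - v) hq0 hq hc hz h0
    apply SS_le_norm _ _ _ _ _ _ (by positivity)
    simp only [Nat.cast_zero, zero_div, AddCircle.coe_zero, sub_zero]
    refine le_trans ?_ h1
    apply one_div_le_one_div_of_le (by positivity)
    push_cast
    nlinarith [pow_le_pow_right₀ hDr (show 2 ≤ 4 by norm_num), pow_pos (lt_of_lt_of_le one_pos hDr) 4])
  refine h.trans ?_
  have h2 : ∑ u ∈ (FS D m).filter (fun u => u - 0 ∈ FS D m), |wt D m u| * |wt D m (u - 0)| = 1 / GS D m := by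
    rw [← sum_wt_sq (m := m) hD]
    simp only [sub_zero]
    rw [Finset.filter_true_of_mem (fun _ h => h)]
    apply Finset.sum_congr rfl; intro u _; ring
  rw [h2]
  apply le_of_eq; ring

lemma T0_ne (D m b N W ξ : ℕ) (hD : 1 ≤ D) (hW0 : 0 < W) (hW : ∀ p : ℕ, p.Prime → ¬ p ∣ m → W < p)
    (hξ : 0 < ξ) (hξN : ξ < N) :
    ‖∑ n ∈ Finset.range N, ((‖Lam D m (m * n + b)‖ ^ 2 : ℝ) : ℂ) * e (-((ξ : ℝ) * n / N))‖ ≤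
      N * (3 / (W * GS D m)) + D ^ 6 := by
  have hDr : (1:ℝ) ≤ D := by exact_mod_cast hD
  have hS0 : SS N m b ξ 0 = 0 := by
    unfold SS
    simp only [smul_zero, chi_zero, one_mul]
    have := orth N (by omega) (-(ξ:ℤ)) (by rw [abs_neg, abs_of_nonneg (by positivity)]; exact_mod_cast hξN)
    rw [if_neg (by omega)] at this
    rw [← this]
    apply Finset.sum_congr rfl; intro n _
    congr 1; push_cast; ring
  have hbad : ∀ u ∈ FS D m, ∀ v ∈ FS D m, ¬ ‖SS N m b ξ (u - v)‖ ≤ (D:ℝ) ^ 4 →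
      ‖m • (u - v) - (((ξ:ℝ) / N : ℝ) : UnitAddCircle)‖ < 1 / (2 * (D:ℝ) ^ 4) := by
    intro u hu v hv hb
    by_contra hcon
    exact hb (SS_le_norm _ _ _ _ _ _ (by positivity) (not_lt.mp hcon))
  have hα : ∃ α : UnitAddCircle, α ≠ 0 ∧ ∀ u ∈ FS D m, ∀ v ∈ FS D m, u - v = α ∨ ‖SS N m b ξ (u - v)‖ ≤ (D:ℝ) ^ 4 := by
    by_cases hex : ∃ u0 ∈ FS D m, ∃ v0 ∈ FS D m, ¬ ‖SS N m b ξ (u0 - v0)‖ ≤ (D:ℝ) ^ 4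
    · obtain ⟨u0, hu0, v0, hv0, hb0⟩ := hex
      refine ⟨u0 - v0, ?_, ?_⟩
      · intro h; rw [h, hS0] at hb0; apply hb0; simp
      · intro u hu v hv
        by_cases hb : ‖SS N m b ξ (u - v)‖ ≤ (D:ℝ) ^ 4
        · right; exact hb
        left
        by_contra hne
        obtain ⟨q, hq0, hq, hc, hz⟩ := FS_sub_ann hu hv
        obtain ⟨q2, hq02, hq2, hc2, hz2⟩ := FS_sub_ann hu0 hv0
        have h1 := norm_lower m (q * q2) (D ^ 4) ((u - v) - (u0 - v0)) (Nat.mul_pos hq0 hq02)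
          (by calc q * q2 ≤ D ^ 2 * D ^ 2 := Nat.mul_le_mul hq hq2
                _ = D ^ 4 := by ring) (Nat.Coprime.mul_left hc hc2)
          (by rw [smul_sub, mul_smul q q2 (u0 - v0), hz2, mul_comm, mul_smul q2 q (u - v), hz, smul_zero, smul_zero, sub_zero])
          (sub_ne_zero.mpr hne)
        have h2 := hbad u hu v hv hb
        have h3 := hbad u0 hu0 v0 hv0 hb0
        have h4 : m • ((u - v) - (u0 - v0)) = (m • (u - v) - (((ξ:ℝ) / N : ℝ) : UnitAddCircle)) - (m • (u0 - v0) - (((ξ:ℝ) / N : ℝ) : UnitAddCircle)) := by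
          rw [smul_sub]; abel
        rw [h4] at h1
        have h5 := norm_sub_le (m • (u - v) - (((ξ:ℝ) / N : ℝ) : UnitAddCircle)) (m • (u0 - v0) - (((ξ:ℝ) / N : ℝ) : UnitAddCircle))
        have h6 : 1 / (2 * (D:ℝ) ^ 4) + 1 / (2 * (D:ℝ) ^ 4) = 1 / ((D ^ 4 : ℕ) : ℝ) := by
          push_cast; field_simp; norm_num
        linarith
    · push Not at hex
      refine ⟨(((1/2 : ℝ)) : UnitAddCircle), ?_, fun u hu v hv => Or.inr (hex u hu v hv)⟩
      intro h
      have : ‖(((1/2 : ℝ)) : UnitAddCircle)‖ = 0 := by rw [h, norm_zero]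
      rw [← nint_eq_norm] at this
      unfold nint at this
      norm_num [round_eq] at this
  obtain ⟨α, hα0, hα⟩ := hα
  refine (T_general D m b N ξ hD α (D ^ 4) (by positivity) hα).trans ?_
  have := corr_bound hD hW0 hW α hα0
  have h7 : (D:ℝ) ^ 4 * D ^ 2 = D ^ 6 := by ring
  rw [h7]
  gcongr

lemma sum_le_of_inj {ι κ : Type*} (s : Finset ι) (t : Finset κ) (i : ι → κ) (f : ι → ℝ) (g : κ → ℝ)
    (hg : ∀ k ∈ t, 0 ≤ g k) (hi : ∀ a ∈ s, i a ∈ t) (hinj : Set.InjOn i s) (hfg : ∀ a ∈ s, f a ≤ g (i a)) :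
    ∑ a ∈ s, f a ≤ ∑ k ∈ t, g k := by
  calc _ ≤ ∑ a ∈ s, g (i a) := Finset.sum_le_sum hfg
    _ = ∑ k ∈ s.image i, g k := (Finset.sum_image hinj).symm
    _ ≤ _ := by
        apply Finset.sum_le_sum_of_subset_of_nonneg
        · intro k hk
          obtain ⟨a, ha, rfl⟩ := Finset.mem_image.mp hk
          exact hi a ha
        · intro k hk _; exact hg k hk

lemma sum_inv_totient {m : ℕ} (hm : Squarefree m) :
    ∑ t ∈ m.divisors, (1:ℝ) / (Nat.totient t) = m / Nat.totient m := by
  let f : ArithmeticFunction ℝ := ⟨fun n => 1 / (Nat.totient n : ℝ), by simp⟩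
  have hf : ∀ n, f n = 1 / (Nat.totient n : ℝ) := fun n => rfl
  have hmul : f.IsMultiplicative := by
    constructor
    · rw [hf]; simp
    · intro a b hab
      rw [hf, hf, hf, Nat.totient_mul hab]; push_cast
      rw [div_mul_div_comm, one_mul]
  have h := hmul.prodPrimeFactors_one_add_of_squarefree hm
  simp only [hf] at h
  rw [← h]
  have h2 := Nat.totient_mul_prod_primeFactors m
  have h3 : (Nat.totient m : ℝ) * ∏ p ∈ m.primeFactors, (p:ℝ) = m * ∏ p ∈ m.primeFactors, ((p:ℝ) - 1) := by
    have h4 : ((Nat.totient m * ∏ p ∈ m.primeFactors, p : ℕ) : ℝ) = ((m * ∏ p ∈ m.primeFactors, (p - 1) : ℕ) : ℝ) := by rw [h2]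
    push_cast at h4
    rw [h4]; congr 1
    apply Finset.prod_congr rfl; intro p hp
    rw [Nat.cast_sub (Nat.prime_of_mem_primeFactors hp).one_lt.le]; simp
  have hpos : ∀ p ∈ m.primeFactors, (0:ℝ) < (p:ℝ) - 1 := by
    intro p hp
    have : (1:ℝ) < p := by exact_mod_cast (Nat.prime_of_mem_primeFactors hp).one_lt
    linarith
  have h5 : ∏ p ∈ m.primeFactors, (1 + 1 / (Nat.totient p : ℝ)) = (∏ p ∈ m.primeFactors, (p:ℝ)) / ∏ p ∈ m.primeFactors, ((p:ℝ) - 1) := by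
    rw [← Finset.prod_div_distrib]
    apply Finset.prod_congr rfl; intro p hp
    have hp' := Nat.prime_of_mem_primeFactors hp
    rw [Nat.totient_prime hp', Nat.cast_sub hp'.one_lt.le, Nat.cast_one]
    have := hpos p hp
    field_simp; ring
  rw [h5]
  have hphi : (0:ℝ) < Nat.totient m := by exact_mod_cast Nat.totient_pos.mpr (Nat.pos_of_ne_zero hm.ne_zero)
  have := Finset.prod_pos hpos
  rw [div_eq_div_iff this.ne' hphi.ne']
  linarith

lemma GS_lower {D m : ℕ} (hm : Squarefree m) :
    Real.log D ≤ 2 * (m / Nat.totient m) * GS D m := by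
  have hm0 : 0 < m := Nat.pos_of_ne_zero hm.ne_zero
  have s1 : Real.log D ≤ ∑ k ∈ Finset.Icc 1 D, (1:ℝ) / k := by
    rcases Nat.eq_zero_or_pos D with rfl | hD
    · simp
    have := log_add_one_le_harmonic D
    rw [harmonic_eq_sum_Icc] at this
    push_cast at this
    simp only [one_div]
    refine le_trans ?_ this
    apply Real.log_le_log (by exact_mod_cast hD)
    linarith
  have hchoice : ∀ k : ℕ, ∃ q : ℕ × ℕ, 0 < k → 0 < q.1 ∧ 0 < q.2 ∧ q.1 ^ 2 * q.2 = k ∧ Squarefree q.2 := by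
    intro k
    rcases Nat.eq_zero_or_pos k with rfl | hk
    · exact ⟨(0,0), fun h => absurd h (lt_irrefl _)⟩
    · obtain ⟨a, b, ha, hb, h1, h2⟩ := Nat.sq_mul_squarefree_of_pos hk
      exact ⟨(b, a), fun _ => ⟨hb, ha, h1, h2⟩⟩
  choose q hq using hchoice
  have s2 : ∑ k ∈ Finset.Icc 1 D, (1:ℝ) / k ≤
      ∑ z ∈ (Finset.Ioo 0 (D+1)) ×ˢ (SL D 1), (((z.1:ℝ) ^ 2)⁻¹ * (1 / Nat.totient z.2)) := by
    apply sum_le_of_inj _ _ q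
    · intros; positivity
    · intro k hk
      rw [Finset.mem_Icc] at hk
      obtain ⟨h1, h2, h3, h4⟩ := hq k (by omega)
      rw [Finset.mem_product, Finset.mem_Ioo, mem_SL]
      have h5 : (q k).1 ≤ k := by
        apply Nat.le_of_dvd (by omega)
        rw [sq] at h3; exact ⟨(q k).1 * (q k).2, by rw [← mul_assoc]; exact h3.symm⟩
      have h6 : (q k).2 ≤ k := by
        exact Nat.le_of_dvd (by omega) ⟨(q k).1 ^ 2, by rw [mul_comm]; exact h3.symm⟩
      exact ⟨⟨h1, by omega⟩, ⟨h2, by omega⟩, h4, Nat.coprime_one_right _⟩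
    · intro a ha b hb hab
      rw [Finset.mem_coe, Finset.mem_Icc] at ha hb
      rw [← (hq a (by omega)).2.2.1, ← (hq b (by omega)).2.2.1, hab]
    · intro k hk
      rw [Finset.mem_Icc] at hk
      obtain ⟨h1, h2, h3, h4⟩ := hq k (by omega)
      have h5 : (k:ℝ) = ((q k).1:ℝ) ^ 2 * (q k).2 := by exact_mod_cast h3.symm
      have hphi : (0:ℝ) < Nat.totient (q k).2 := by exact_mod_cast Nat.totient_pos.mpr h2
      have hle : (Nat.totient (q k).2 : ℝ) ≤ (q k).2 := by exact_mod_cast Nat.totient_le _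
      have h1' : (0:ℝ) < (q k).1 := by exact_mod_cast h1
      rw [h5, one_div, mul_inv, ← one_div ((q k).2 : ℝ)]
      gcongr
  rw [Finset.sum_product] at s2
  simp_rw [← Finset.mul_sum] at s2
  rw [← Finset.sum_mul] at s2
  have s3 := sum_Ioo_inv_sq_le (α := ℝ) 0 (D+1)
  have s4 : ∑ r ∈ SL D 1, (1:ℝ) / Nat.totient r ≤ ∑ z ∈ m.divisors ×ˢ SL D m, ((1:ℝ) / Nat.totient z.1) * (1 / Nat.totient z.2) := by
    have hcop : ∀ r : ℕ, Squarefree r → (r.gcd m).Coprime (r / r.gcd m) := by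
      intro r hr
      apply Nat.coprime_of_squarefree_mul
      rw [Nat.mul_div_cancel' (Nat.gcd_dvd_left r m)]; exact hr
    apply sum_le_of_inj _ _ (fun r : ℕ => (r.gcd m, r / r.gcd m))
    · intros; positivity
    · intro r hr
      rw [mem_SL] at hr
      rw [Finset.mem_product, Nat.mem_divisors, mem_SL]
      refine ⟨⟨Nat.gcd_dvd_right _ _, hm0.ne'⟩, ⟨Nat.div_pos (Nat.gcd_le_left _ hr.1.1) (Nat.gcd_pos_of_pos_left _ hr.1.1), (Nat.div_le_self _ _).trans hr.1.2⟩, ?_, ?_⟩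
      · exact hr.2.1.squarefree_of_dvd (Nat.div_dvd_of_dvd (Nat.gcd_dvd_left r m))
      · exact Nat.coprime_div_gcd_of_squarefree hr.2.1 hm0.ne'
    · intro a ha b hb hab
      simp only [Prod.mk.injEq] at hab
      rw [← Nat.mul_div_cancel' (Nat.gcd_dvd_left a m), ← Nat.mul_div_cancel' (Nat.gcd_dvd_left b m), hab.2, hab.1]
    · intro r hr
      rw [mem_SL] at hr
      have h1 := Nat.totient_mul (hcop r hr.2.1)
      rw [Nat.mul_div_cancel' (Nat.gcd_dvd_left r m)] at h1
      rw [h1]; push_cast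
      rw [div_mul_div_comm, one_mul]
  rw [Finset.sum_product] at s4
  simp_rw [← Finset.mul_sum] at s4
  rw [← Finset.sum_mul, sum_inv_totient hm] at s4
  have s5 : ∑ r ∈ SL D m, (1:ℝ) / Nat.totient r = GS D m := rfl
  rw [s5] at s4
  have s6 : 0 ≤ ∑ r ∈ SL D 1, (1:ℝ) / Nat.totient r := Finset.sum_nonneg (by intros; positivity)
  norm_num at s3
  have s7 := mul_le_mul_of_nonneg_right s3 s6
  linarith

lemma primorial_sqf (W : ℕ) : Squarefree (primorial W) := by
  unfold primorial
  apply Finset.squarefree_prod_of_pairwise_isCoprime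
  · intro p hp q hq hpq
    have hp' := (Finset.mem_filter.mp (Finset.mem_coe.mp hp)).2
    have hq' := (Finset.mem_filter.mp (Finset.mem_coe.mp hq)).2
    exact Nat.coprime_iff_isRelPrime.mp ((Nat.coprime_primes hp' hq').mpr hpq)
  · intro p hp
    exact (Finset.mem_filter.mp hp).2.prime.squarefree

lemma primorial_big (W p : ℕ) (hp : p.Prime) (h : ¬ p ∣ primorial W) : W < p := by
  by_contra hc
  apply h
  unfold primorial
  exact Finset.dvd_prod_of_mem _ (Finset.mem_filter.mpr ⟨Finset.mem_range.mpr (by omega), hp⟩)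

lemma Fc.x0pos {c : ℝ} (F : Fc c) : 0 < F.x₀ := lt_of_lt_of_le one_pos F.one_le_x₀

lemma Fc.hasDeriv {c : ℝ} (F : Fc c) {x : ℝ} (hx : F.x₀ < x) :
    HasDerivAt F.toFun (F.toFun x / x * (c + F.vth x)) x := by
  have hx0 : 0 < x := F.x0pos.trans hx
  have hcont : ContinuousOn (fun t => F.vth t / t) (Set.Ici F.x₀) := by
    apply F.vth_contDiffOn.continuousOn.div continuousOn_id
    intro t ht; exact (lt_of_lt_of_le F.x0pos ht).ne'
  have hI : HasDerivAt (fun x => ∫ t in F.x₀..x, F.vth t / t) (F.vth x / x) x := by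
    apply intervalIntegral.integral_hasDerivAt_right
    · apply ContinuousOn.intervalIntegrable
      apply hcont.mono
      rw [Set.uIcc_of_le hx.le]; exact Set.Icc_subset_Ici_self
    · exact ContinuousOn.stronglyMeasurableAtFilter isOpen_Ioi (hcont.mono Set.Ioi_subset_Ici_self) x hx
    · exact hcont.continuousAt (Ici_mem_nhds hx)
  have h1 : HasDerivAt (fun x : ℝ => F.Ch * x ^ c * Real.exp (∫ t in F.x₀..x, F.vth t / t))
      (F.toFun x / x * (c + F.vth x)) x := by
    have hp : HasDerivAt (fun x : ℝ => x ^ c) (c * x ^ (c - 1)) x := Real.hasDerivAt_rpow_const (Or.inl hx0.ne')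
    have := (hp.const_mul F.Ch).mul hI.exp
    refine HasDerivAt.congr_deriv this ?_
    rw [F.eqn x hx.le, Real.rpow_sub hx0, Real.rpow_one]
    field_simp
  apply h1.congr_of_eventuallyEq
  filter_upwards [Ioi_mem_nhds hx] with z hz
  exact F.eqn z (le_of_lt hz)

lemma Fc.hasDeriv2 {c : ℝ} (F : Fc c) {x : ℝ} (hx : F.x₀ < x) :
    HasDerivAt (fun x => F.toFun x / x * (c + F.vth x))
      (F.toFun x / x ^ 2 * ((c + F.vth x) * (c - 1 + F.vth x) + x * deriv F.vth x)) x := by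
  have hx0 : 0 < x := F.x0pos.trans hx
  have hv : HasDerivAt F.vth (deriv F.vth x) x := by
    have : ContDiffAt ℝ 2 F.vth x := F.vth_contDiffOn.contDiffAt (Ici_mem_nhds hx)
    exact (this.differentiableAt (by norm_num)).hasDerivAt
  have := ((F.hasDeriv hx).div (hasDerivAt_id x) hx0.ne').mul (hv.const_add c)
  refine HasDerivAt.congr_deriv this ?_
  simp only [id, Pi.div_apply]
  field_simp
  ring

lemma Fc.vth_tendsto {c : ℝ} (F : Fc c) (hc₁ : 1 ≤ c) : Tendsto F.vth atTop (nhds 0) := by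
  rcases eq_or_lt_of_le hc₁ with h | h
  · exact (F.cond_eq h.symm).2.2.2.2.1
  · exact (F.cond_gt h).1

noncomputable def Fc.E {c : ℝ} (F : Fc c) (x : ℝ) : ℝ := (c + F.vth x) * (c - 1 + F.vth x) + x * deriv F.vth x

lemma Fc.xv_tendsto {c : ℝ} (F : Fc c) (hc₁ : 1 ≤ c) : Tendsto (fun x => x * deriv F.vth x) atTop (nhds 0) := by
  rcases eq_or_lt_of_le hc₁ with h | h
  · have h1 := F.cond_eq h.symm
    have h2 := h1.2.2.2.2.2.1.mul h1.2.2.2.2.1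
    rw [mul_zero] at h2
    apply h2.congr'
    filter_upwards [eventually_ge_atTop F.x₀] with x hx
    have := h1.1 x hx
    field_simp
  · exact (F.cond_gt h).2.1

lemma Fc.E_tendsto {c : ℝ} (F : Fc c) (hc₁ : 1 ≤ c) : Tendsto F.E atTop (nhds (c * (c - 1))) := by
  have hv := F.vth_tendsto hc₁
  have := ((hv.const_add c).mul (hv.const_add (c - 1))).add (F.xv_tendsto hc₁)
  simp only [add_zero] at this
  exact this

lemma Fc.E_lower {c : ℝ} (F : Fc c) (hc₁ : 1 ≤ c) : ∀ᶠ x in atTop, x ^ (-(0.001:ℝ)) ≤ F.E x := by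
  have hz : Tendsto (fun x : ℝ => x ^ (-(0.001:ℝ))) atTop (nhds 0) := tendsto_rpow_neg_atTop (by norm_num)
  rcases eq_or_lt_of_le hc₁ with h | h
  · have h1 := F.cond_eq h.symm
    obtain ⟨C, hC, hCx⟩ := h1.2.2.1 0.0005 (by norm_num)
    have hz2 : Tendsto (fun x : ℝ => x ^ ((0.0005:ℝ))) atTop atTop := tendsto_rpow_atTop (by norm_num)
    filter_upwards [eventually_ge_atTop F.x₀, h1.2.2.2.2.2.1.eventually (eventually_ge_nhds (show (-1/2:ℝ) < 0 by norm_num)), hz2.eventually_ge_atTop (2*C)] with x hx hx1 hx2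
    have hx0 : 0 < x := lt_of_lt_of_le F.x0pos hx
    have hv := h1.1 x hx
    have h3 := hCx x hx
    have hE : F.E x = F.vth x * (1 + F.vth x + x * deriv F.vth x / F.vth x) := by
      unfold Fc.E; field_simp; linear_combination (-(c + F.vth x)) * h - F.vth x * h
    rw [hE]
    have h4 : x ^ (-(0.001:ℝ)) * x ^ ((0.0005:ℝ)) * x ^ ((0.0005:ℝ)) = 1 := by
      rw [← Real.rpow_add hx0, ← Real.rpow_add hx0]; norm_num
    have hp : 0 < x ^ ((0.0005:ℝ)) := by positivity
    have hp2 : 0 < x ^ (-(0.001:ℝ)) := by positivity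
    rw [div_le_iff₀ hv] at h3
    have h5 : F.vth x * (1/2) ≤ F.vth x * (1 + F.vth x + x * deriv F.vth x / F.vth x) := by
      apply mul_le_mul_of_nonneg_left _ hv.le; linarith
    refine le_trans ?_ h5
    have h6 : C ≤ x ^ ((0.0005:ℝ)) / 2 := by linarith
    have h7 : 1 ≤ (x ^ ((0.0005:ℝ)) / 2) * x ^ ((0.0005:ℝ)) * F.vth x := by
      refine h3.trans ?_; gcongr
    have h8 := mul_le_mul_of_nonneg_left h7 hp2.le
    calc x ^ (-(0.001:ℝ)) = x ^ (-(0.001:ℝ)) * 1 := by ring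
      _ ≤ _ := h8
      _ = (x ^ (-(0.001:ℝ)) * x ^ ((0.0005:ℝ)) * x ^ ((0.0005:ℝ))) * (F.vth x * (1/2)) := by ring
      _ = _ := by rw [h4, one_mul]
  · have hpos : 0 < c * (c - 1) := by nlinarith
    have h1 := hz.eventually (eventually_le_nhds (show 0 < c * (c-1) / 2 by linarith))
    have h2 := (F.E_tendsto hc₁).eventually (eventually_ge_nhds (show c * (c-1) / 2 < c * (c-1) by linarith))
    filter_upwards [h1, h2] with x a b
    linarith

lemma Fc.lower_lin {c : ℝ} (F : Fc c) (hc₁ : 1 ≤ c) : ∃ K : ℝ, 1 ≤ K ∧ ∀ᶠ x in atTop, x ≤ K * F.toFun x := by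
  have hev : ∀ᶠ x in atTop, 0 ≤ c - 1 + F.vth x := by
    rcases eq_or_lt_of_le hc₁ with h | h
    · filter_upwards [eventually_ge_atTop F.x₀] with x hx
      have := (F.cond_eq h.symm).1 x hx
      linarith
    · have := (F.vth_tendsto hc₁).eventually (eventually_ge_nhds (show -(c-1) < 0 by linarith))
      filter_upwards [this] with x hx; linarith
  obtain ⟨X0, hX0⟩ := eventually_atTop.mp hev
  set X := max X0 (F.x₀ + 1)
  have hX1 : F.x₀ < X := lt_of_lt_of_le (by linarith) (le_max_right _ _)
  have hXp : 1 ≤ X := by have := F.one_le_x₀; linarith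
  have hmono : MonotoneOn (fun x => F.toFun x / x) (Set.Ici X) := by
    have hd : ∀ x, X ≤ x → HasDerivAt (fun x => F.toFun x / x) (F.toFun x / x ^ 2 * (c - 1 + F.vth x)) x := by
      intro x hx
      have hx0 : 0 < x := by linarith
      have := (F.hasDeriv (lt_of_lt_of_le hX1 hx)).div (hasDerivAt_id x) hx0.ne'
      refine HasDerivAt.congr_deriv this ?_
      simp only [id]; field_simp; ring
    apply monotoneOn_of_deriv_nonneg (convex_Ici X)
    · intro x hx; exact (hd x hx).continuousAt.continuousWithinAt
    · intro x hx; rw [interior_Ici] at hx; exact (hd x (le_of_lt hx)).differentiableAt.differentiableWithinAt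
    · intro x hx; rw [interior_Ici] at hx
      have hx' : X ≤ x := le_of_lt hx
      rw [(hd x hx').deriv]
      have := F.one_le x (hX1.le.trans hx')
      have := hX0 x ((le_max_left _ _).trans hx')
      positivity
  refine ⟨X, hXp, ?_⟩
  filter_upwards [eventually_ge_atTop X] with x hx
  have h1 : F.toFun X / X ≤ F.toFun x / x := hmono (Set.self_mem_Ici) hx hx
  have h2 := F.one_le X hX1.le
  have hx0 : 0 < x := by linarith
  rw [div_le_div_iff₀ (by linarith) hx0] at h1
  nlinarith

lemma Fc.upper_pow {c : ℝ} (F : Fc c) (hc₁ : 1 ≤ c) (hc₂ : c < 16 / 15) : ∀ᶠ x in atTop, F.toFun x ≤ x ^ ((16:ℝ)/15) := by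
  set η := (16/15 - c) / 2 with hη
  have hη0 : 0 < η := by rw [hη]; linarith
  have hev := (F.vth_tendsto hc₁).eventually (eventually_le_nhds hη0)
  obtain ⟨X0, hX0⟩ := eventually_atTop.mp hev
  set X := max X0 (F.x₀ + 1)
  have hX1 : F.x₀ < X := lt_of_lt_of_le (by linarith) (le_max_right _ _)
  have hXp : 1 ≤ X := by have := F.one_le_x₀; linarith
  have hanti : AntitoneOn (fun x => F.toFun x * x ^ (-(c + η))) (Set.Ici X) := by
    have hd : ∀ x, X ≤ x → HasDerivAt (fun x => F.toFun x * x ^ (-(c + η))) (F.toFun x * x ^ (-(c+η)) / x * (F.vth x - η)) x := by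
      intro x hx
      have hx0 : 0 < x := by linarith
      have := (F.hasDeriv (lt_of_lt_of_le hX1 hx)).mul (Real.hasDerivAt_rpow_const (p := -(c + η)) (Or.inl hx0.ne'))
      refine HasDerivAt.congr_deriv this ?_
      rw [Real.rpow_sub hx0, Real.rpow_one]; field_simp; ring
    apply antitoneOn_of_deriv_nonpos (convex_Ici X)
    · intro x hx; exact (hd x hx).continuousAt.continuousWithinAt
    · intro x hx; rw [interior_Ici] at hx; exact (hd x (le_of_lt hx)).differentiableAt.differentiableWithinAt
    · intro x hx; rw [interior_Ici] at hx
      have hx' : X ≤ x := le_of_lt hx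
      have hx0 : 0 < x := by linarith
      rw [(hd x hx').deriv]
      have h1 := F.one_le x (hX1.le.trans hx')
      have h2 := hX0 x ((le_max_left _ _).trans hx')
      apply mul_nonpos_of_nonneg_of_nonpos
      · positivity
      · linarith
  have hz2 : Tendsto (fun x : ℝ => x ^ η) atTop atTop := tendsto_rpow_atTop hη0
  filter_upwards [eventually_ge_atTop X, hz2.eventually_ge_atTop (F.toFun X * X ^ (-(c + η)))] with x hx hx2
  have hx0 : 0 < x := by linarith
  have h1 : F.toFun x * x ^ (-(c + η)) ≤ F.toFun X * X ^ (-(c + η)) := hanti (Set.self_mem_Ici) hx hx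
  have h2 : F.toFun x * x ^ (-(c + η)) ≤ x ^ η := h1.trans hx2
  have h3 : F.toFun x = F.toFun x * x ^ (-(c + η)) * x ^ (c + η) := by
    rw [mul_assoc, ← Real.rpow_add hx0]; simp
  rw [h3]
  calc _ ≤ x ^ η * x ^ (c + η) := by gcongr
    _ = x ^ ((16:ℝ)/15) := by rw [← Real.rpow_add hx0]; congr 1; rw [hη]; ring

lemma phi_facts {c : ℝ} (hc₁ : 1 ≤ c) (hc₂ : c < 16 / 15) (F : Fc c)
    (φ : ℝ → ℝ) (hφ₁ : ∀ x ≥ F.x₀, φ (F.toFun x) = x)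
    (hφ₂ : ∀ y ≥ F.toFun F.x₀, F.toFun (φ y) = y)
    (hφ₃ : ∀ y ≥ F.toFun F.x₀, F.x₀ ≤ φ y) :
    ∃ y1 : ℝ, 1 ≤ y1 ∧ ∃ C : ℝ, 1 ≤ C ∧ ∃ φ2 : ℝ → ℝ,
      (∀ y ≥ y1, 0 < deriv φ y ∧ HasDerivAt φ (deriv φ y) y ∧ HasDerivAt (deriv φ) (φ2 y) y ∧
        y ^ (-(1.07:ℝ)) ≤ - φ2 y ∧ - φ2 y ≤ C / y ∧ (deriv φ y)⁻¹ ≤ 2 * y ^ ((1:ℝ)/16)) ∧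
      (∀ y' y, y1 ≤ y' → y' ≤ y → y ≤ 2 * y' → (deriv φ y)⁻¹ ≤ 8 * (deriv φ y')⁻¹) ∧
      (∀ y k : ℕ, y1 ≤ y → F.x₀ ≤ (k:ℝ) → (y:ℤ) = ⌊F.toFun k⌋ → φ y ≤ k ∧ (k:ℝ) < φ (y + 1)) := by
  have hmono : StrictMonoOn F.toFun (Set.Ici F.x₀) := by
    apply strictMonoOn_of_deriv_pos (convex_Ici _) F.contDiffOn.continuousOn
    intro x hx; rw [interior_Ici] at hx; exact F.deriv_pos x (le_of_lt hx)
  set Y0 := F.toFun F.x₀ with hY0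
  have hφmono : StrictMonoOn φ (Set.Ici Y0) := by
    intro y hy y' hy' hlt
    by_contra hcon
    have h1 := hmono.monotoneOn (hφ₃ y' hy') (hφ₃ y hy) (not_lt.mp hcon)
    rw [hφ₂ y hy, hφ₂ y' hy'] at h1
    linarith
  have hφx0 : φ Y0 = F.x₀ := hφ₁ _ le_rfl
  have hφgt : ∀ y, Y0 < y → F.x₀ < φ y := by
    intro y hy
    have := hφmono (Set.self_mem_Ici) (Set.mem_Ici.mpr hy.le) hy
    rwa [hφx0] at this
  have hφcont : ∀ y, Y0 < y → ContinuousAt φ y := by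
    intro y hy
    apply continuousAt_of_monotoneOn_of_image_mem_nhds hφmono.monotoneOn (Ici_mem_nhds hy)
    apply Filter.mem_of_superset (Ici_mem_nhds (hφgt y hy))
    intro x hx
    exact ⟨F.toFun x, hmono.monotoneOn (Set.self_mem_Ici) hx hx, hφ₁ x hx⟩
  set g := fun x => F.toFun x / x * (c + F.vth x) with hg
  have hgpos : ∀ x, F.x₀ < x → 0 < g x := by
    intro x hx
    have := F.deriv_pos x hx.le
    rwa [(F.hasDeriv hx).deriv] at this
  have hd1 : ∀ y, Y0 < y → HasDerivAt φ (g (φ y))⁻¹ y := by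
    intro y hy
    apply HasDerivAt.of_local_left_inverse (hφcont y hy) (F.hasDeriv (hφgt y hy)) (hgpos _ (hφgt y hy)).ne'
    filter_upwards [Ici_mem_nhds hy] with z hz
    exact hφ₂ z hz
  have hd1' : ∀ y, Y0 < y → deriv φ y = (g (φ y))⁻¹ := fun y hy => (hd1 y hy).deriv
  have hd2 : ∀ y, Y0 < y → HasDerivAt (deriv φ)
      (-(F.toFun (φ y) / (φ y) ^ 2 * F.E (φ y) * (g (φ y))⁻¹) / (g (φ y)) ^ 2) y := by
    intro y hy
    have h1 := (HasDerivAt.comp y (F.hasDeriv2 (hφgt y hy)) (hd1 y hy)).inv (hgpos _ (hφgt y hy)).ne'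
    refine HasDerivAt.congr_of_eventuallyEq h1 ?_
    filter_upwards [Ioi_mem_nhds hy] with z hz
    exact hd1' z hz
  obtain ⟨K, hK1, hK⟩ := F.lower_lin hc₁
  have hv1 := (F.vth_tendsto hc₁).eventually (eventually_ge_nhds (show (-1/2:ℝ) < 0 by norm_num))
  have hv2 := (F.vth_tendsto hc₁).eventually (eventually_le_nhds (show (0:ℝ) < 1/2 by norm_num))
  have hE2 := (F.E_tendsto hc₁).eventually (eventually_le_nhds (show c * (c - 1) < 2 by nlinarith))
  have hall := hK.and (hv1.and (hv2.and (hE2.and ((F.E_lower hc₁).and (F.upper_pow hc₁ hc₂)))))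
  obtain ⟨X0, hX0⟩ := eventually_atTop.mp hall
  set X := max X0 (F.x₀ + 1)
  have hX1 : F.x₀ < X := lt_of_lt_of_le (by linarith) (le_max_right _ _)
  have hXp : 1 ≤ X := by have := F.one_le_x₀; linarith
  obtain ⟨Y2, hY2⟩ := eventually_atTop.mp ((tendsto_rpow_atTop (show (0:ℝ) < 0.006 by norm_num)).eventually_ge_atTop 8)
  set y1 := max (F.toFun X) Y2 with hy1
  have hy1a : ∀ y, y1 ≤ y → Y0 < y ∧ X ≤ φ y ∧ 8 ≤ y ^ (0.006:ℝ) ∧ 1 ≤ y := by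
    intro y hy
    have h1 : F.toFun X ≤ y := (le_max_left _ _).trans hy
    have h2 : Y0 < F.toFun X := hmono (Set.self_mem_Ici) hX1.le hX1
    have h3 : Y0 < y := lt_of_lt_of_le h2 h1
    refine ⟨h3, ?_, hY2 y ((le_max_right _ _).trans hy), (F.one_le X hX1.le).trans h1⟩
    have := hφmono.monotoneOn (Set.mem_Ici.mpr h2.le) (Set.mem_Ici.mpr h3.le) h1
    rwa [hφ₁ X hX1.le] at this
  have hfacts : ∀ y, y1 ≤ y → φ y ≤ K * y ∧ -1/2 ≤ F.vth (φ y) ∧ F.vth (φ y) ≤ 1/2 ∧ F.E (φ y) ≤ 2 ∧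
      (φ y) ^ (-(0.001:ℝ)) ≤ F.E (φ y) ∧ y ≤ (φ y) ^ ((16:ℝ)/15) := by
    intro y hy
    obtain ⟨h1, h2, _, _⟩ := hy1a y hy
    have := hX0 (φ y) ((le_max_left _ _).trans h2)
    rw [hφ₂ y h1.le] at this
    exact this
  have hinv : ∀ y, y1 ≤ y → (deriv φ y)⁻¹ = y / φ y * (c + F.vth (φ y)) := by
    intro y hy
    obtain ⟨h1, _⟩ := hy1a y hy
    rw [hd1' y h1, inv_inv, hg]; simp only; rw [hφ₂ y h1.le]
  have hxlow : ∀ y, y1 ≤ y → y ^ ((15:ℝ)/16) ≤ φ y := by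
    intro y hy
    obtain ⟨h1, h2, _, h4⟩ := hy1a y hy
    have h5 := (hfacts y hy).2.2.2.2.2
    have hx0 : 0 < φ y := by linarith
    calc y ^ ((15:ℝ)/16) ≤ ((φ y) ^ ((16:ℝ)/15)) ^ ((15:ℝ)/16) := by gcongr
      _ = φ y := by rw [← Real.rpow_mul hx0.le]; norm_num
  refine ⟨y1, ?_, 16 * K, by linarith, _, fun y hy => ⟨?_, ?_, hd2 y (hy1a y hy).1, ?_, ?_, ?_⟩, ?_, ?_⟩
  · exact (F.one_le X hX1.le).trans (le_max_left _ _)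
  · rw [hd1' y (hy1a y hy).1]
    exact inv_pos.mpr (hgpos _ (hφgt y (hy1a y hy).1))
  · rw [hd1' y (hy1a y hy).1]; exact hd1 y (hy1a y hy).1
  · obtain ⟨h1, h2, h3, h4⟩ := hy1a y hy
    obtain ⟨f1, f2, f3, f4, f5, f6⟩ := hfacts y hy
    have f7 := hxlow y hy
    set x := φ y with hx
    have hx1 : 1 ≤ x := by linarith
    have hx0 : 0 < x := by linarith
    have hy0 : 0 < y := by linarith
    have hgx : g x = y / x * (c + F.vth x) := by rw [hg]; simp only; rw [hφ₂ y h1.le]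
    rw [hφ₂ y h1.le, hgx]
    set w := c + F.vth x with hw
    have hw0 : 0 < w := by rw [hw]; linarith
    have hw2 : w ≤ 2 := by rw [hw]; linarith
    have heq : -(-(y / x ^ 2 * F.E x * (y / x * w)⁻¹) / (y / x * w) ^ 2) = x * F.E x / (y ^ 2 * w ^ 3) := by
      field_simp
    rw [heq, le_div_iff₀ (by positivity)]
    have hw3 : w ^ 3 ≤ 8 := by
      calc w ^ 3 ≤ 2 ^ 3 := by gcongr
        _ = 8 := by norm_num
    calc y ^ (-(1.07:ℝ)) * (y ^ 2 * w ^ 3) ≤ y ^ (-(1.07:ℝ)) * (y ^ 2 * y ^ (0.006:ℝ)) := by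
          gcongr; linarith
      _ = y ^ (0.936:ℝ) := by
          rw [← Real.rpow_natCast y 2, ← Real.rpow_add hy0, ← Real.rpow_add hy0]; norm_num
      _ ≤ (y ^ ((15:ℝ)/16)) ^ (0.999:ℝ) := by
          rw [← Real.rpow_mul hy0.le]
          apply Real.rpow_le_rpow_of_exponent_le h4; norm_num
      _ ≤ x ^ (0.999:ℝ) := by gcongr
      _ = x * x ^ (-(0.001:ℝ)) := by
          nth_rewrite 2 [← Real.rpow_one x]; rw [← Real.rpow_add hx0]; norm_num
      _ ≤ x * F.E x := by gcongr
  · obtain ⟨h1, h2, h3, h4⟩ := hy1a y hy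
    obtain ⟨f1, f2, f3, f4, f5, f6⟩ := hfacts y hy
    set x := φ y with hx
    have hx1 : 1 ≤ x := by linarith
    have hx0 : 0 < x := by linarith
    have hy0 : 0 < y := by linarith
    have hgx : g x = y / x * (c + F.vth x) := by rw [hg]; simp only; rw [hφ₂ y h1.le]
    rw [hφ₂ y h1.le, hgx]
    set w := c + F.vth x with hw
    have hw0 : 0 < w := by rw [hw]; linarith
    have hw2 : 1/2 ≤ w := by rw [hw]; linarith
    have heq : -(-(y / x ^ 2 * F.E x * (y / x * w)⁻¹) / (y / x * w) ^ 2) = x * F.E x / (y ^ 2 * w ^ 3) := by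
      field_simp
    rw [heq, div_le_div_iff₀ (by positivity) hy0]
    have hw3 : 1/8 ≤ w ^ 3 := by
      calc (1:ℝ)/8 = (1/2) ^ 3 := by norm_num
        _ ≤ w ^ 3 := by gcongr
    have hE0 : 0 ≤ F.E x := le_trans (Real.rpow_nonneg hx0.le _) f5
    calc x * F.E x * y ≤ (K * y) * 2 * y := by gcongr
      _ = 16 * K * (y ^ 2 * (1/8)) := by ring
      _ ≤ _ := by gcongr
  · rw [hinv y hy]
    obtain ⟨h1, h2, h3, h4⟩ := hy1a y hy
    obtain ⟨f1, f2, f3, f4, f5, f6⟩ := hfacts y hy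
    have f7 := hxlow y hy
    have hx0 : 0 < φ y := by linarith
    have hy0 : 0 < y := by linarith
    have : y / φ y ≤ y ^ ((1:ℝ)/16) := by
      rw [div_le_iff₀ hx0]
      calc y = y ^ ((1:ℝ)/16) * y ^ ((15:ℝ)/16) := by rw [← Real.rpow_add hy0]; norm_num
        _ ≤ _ := by gcongr
    calc _ ≤ y ^ ((1:ℝ)/16) * 2 := by
          apply mul_le_mul this (by linarith) (by linarith) (by positivity)
      _ = _ := by ring
  · intro y' y hy' hyy' hy2
    have hy := hy'.trans hyy'
    rw [hinv y hy, hinv y' hy']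
    obtain ⟨h1, h2, h3, h4⟩ := hy1a y hy
    obtain ⟨f1, f2, f3, f4, f5, f6⟩ := hfacts y hy
    obtain ⟨h1', h2', h3', h4'⟩ := hy1a y' hy'
    obtain ⟨f1', f2', f3', f4', f5', f6'⟩ := hfacts y' hy'
    have hx0 : 0 < φ y := by linarith
    have hx0' : 0 < φ y' := by linarith
    have hm : φ y' ≤ φ y := hφmono.monotoneOn (Set.mem_Ici.mpr h1'.le) (Set.mem_Ici.mpr h1.le) hyy'
    calc y / φ y * (c + F.vth (φ y)) ≤ (2 * y') / φ y' * 2 := by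
          apply mul_le_mul _ (by linarith) (by linarith) (by positivity)
          apply div_le_div₀ (by linarith) hy2 hx0' hm
      _ = 8 * (y' / φ y' * (1/2)) := by ring
      _ ≤ _ := by gcongr; linarith
  · intro y k hy hk hfl
    obtain ⟨h1, _⟩ := hy1a y hy
    have h2 := Int.floor_le (F.toFun k)
    have h3 := Int.lt_floor_add_one (F.toFun k)
    rw [← hfl] at h2 h3
    push_cast at h2 h3
    have h4 : Y0 ≤ F.toFun k := hmono.monotoneOn (Set.self_mem_Ici) hk hk
    have h5 := hφmono.monotoneOn (Set.mem_Ici.mpr h1.le) (Set.mem_Ici.mpr h4) h2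
    have h6 := hφmono (Set.mem_Ici.mpr h4) (Set.mem_Ici.mpr (by linarith)) h3
    rw [hφ₁ k hk] at h5 h6
    exact ⟨h5, h6⟩

structure PhiOK (φ φ2 : ℝ → ℝ) (y1 C : ℝ) : Prop where
  y1_ge : 1 ≤ y1
  C_ge : 1 ≤ C
  main : ∀ y ≥ y1, 0 < deriv φ y ∧ HasDerivAt φ (deriv φ y) y ∧ HasDerivAt (deriv φ) (φ2 y) y ∧
        y ^ (-(1.07:ℝ)) ≤ - φ2 y ∧ - φ2 y ≤ C / y ∧ (deriv φ y)⁻¹ ≤ 2 * y ^ ((1:ℝ)/16)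
  doubling : ∀ y' y, y1 ≤ y' → y' ≤ y → y ≤ 2 * y' → (deriv φ y)⁻¹ ≤ 8 * (deriv φ y')⁻¹

lemma second_diff {φ φ2 : ℝ → ℝ} {y1 C : ℝ} (H : PhiOK φ φ2 y1 C) (y M : ℝ) (hy : y1 ≤ y) (hM : 0 < M) :
    ∃ ζ, y ≤ ζ ∧ ζ ≤ y + 2 * M ∧ φ y + φ (y + 2 * M) - 2 * φ (y + M) = M ^ 2 * φ2 ζ := by
  have hd : ∀ t, y ≤ t → HasDerivAt (fun t => φ (t + M) - φ t) (deriv φ (t + M) - deriv φ t) t := by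
    intro t ht
    have h1 := (H.main (t + M) (by linarith)).2.1
    have h2 := (H.main t (by linarith)).2.1
    exact (h1.comp_add_const t M).sub h2
  obtain ⟨η, hη, hη2⟩ := exists_hasDerivAt_eq_slope (fun t => φ (t + M) - φ t) (fun t => deriv φ (t + M) - deriv φ t)
    (show y < y + M by linarith)
    (fun t ht => (hd t ht.1).continuousAt.continuousWithinAt) (fun t ht => hd t ht.1.le)
  obtain ⟨ζ, hζ, hζ2⟩ := exists_hasDerivAt_eq_slope (deriv φ) φ2
    (show η < η + M by linarith)
    (fun t ht => (H.main t (by linarith [hη.1, ht.1])).2.2.1.continuousAt.continuousWithinAt)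
    (fun t ht => (H.main t (by linarith [hη.1, ht.1])).2.2.1)
  refine ⟨ζ, by linarith [hη.1, hζ.1], by linarith [hη.2, hζ.2], ?_⟩
  have e1 : y + M - y = M := by ring
  have e2 : η + M - η = M := by ring
  rw [e1, eq_div_iff hM.ne'] at hη2
  rw [e2, eq_div_iff hM.ne'] at hζ2
  have e3 : y + M + M = y + 2 * M := by ring
  rw [e3] at hη2
  have h5 : φ y + φ (y + 2 * M) - 2 * φ (y + M) = (deriv φ (η + M) - deriv φ η) * M := by rw [hη2]; ring
  rw [h5, ← hζ2]; ring

lemma zeta_le (m P i b ζ N : ℝ) (hN0 : 0 < N) (hm1 : 1 ≤ m) (hP1 : 1 ≤ P) (hi : i + 1 ≤ P) (hb : b ≤ m) (hPN : P ≤ N)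
    (hmN : 5 * m ≤ N ^ (0.005:ℝ)) (hζ2 : ζ ≤ m * (P + i) + b + 2 * m) : ζ ≤ N ^ (1.005:ℝ) := by
  have h1 : ζ ≤ 5 * m * P := by
    have h3 : m * i ≤ m * (P - 1) := mul_le_mul_of_nonneg_left (by linarith) (by linarith)
    have h4 : m * 1 ≤ m * P := mul_le_mul_of_nonneg_left hP1 (by linarith)
    have h5 : m * (P + i) = m * P + m * i := by ring
    have h6 : m * (P - 1) = m * P - m := by ring
    linarith
  have h2 : (5:ℝ) * m * P ≤ N ^ (0.005:ℝ) * N := mul_le_mul hmN hPN (by linarith) (by positivity)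
  have h3 : N ^ (0.005:ℝ) * N = N ^ (1.005:ℝ) := by
    nth_rewrite 2 [← Real.rpow_one N]; rw [← Real.rpow_add hN0]; norm_num
  linarith

lemma block_key {φ φ2 : ℝ → ℝ} {y1 C : ℝ} (H : PhiOK φ φ2 y1 C) (m b P i j : ℕ) (hm : y1 ≤ m) (hb : b ≤ m)
    (hP : 1 ≤ P) (hi : i + 1 ≤ P) (hj : 1 ≤ j) (N : ℝ) (hN : 1 ≤ N) (hPN : (P:ℝ) ≤ N) (hmN : 5 * (m:ℝ) ≤ N ^ (0.005:ℝ))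
    (s t : ℝ) :
    (N ^ (1.005:ℝ)) ^ (-(1.07:ℝ)) ≤ -(j:ℝ) * φ (((m * (P + i) + b : ℕ) : ℝ)) + (s + i * t) + (-(j:ℝ) * φ (((m * (P + (i+2)) + b : ℕ) : ℝ)) + (s + ((i+2:ℕ):ℝ) * t)) - 2 * (-(j:ℝ) * φ (((m * (P + (i+1)) + b : ℕ) : ℝ)) + (s + ((i+1:ℕ):ℝ) * t)) ∧
    -(j:ℝ) * φ (((m * (P + i) + b : ℕ) : ℝ)) + (s + i * t) + (-(j:ℝ) * φ (((m * (P + (i+2)) + b : ℕ) : ℝ)) + (s + ((i+2:ℕ):ℝ) * t)) - 2 * (-(j:ℝ) * φ (((m * (P + (i+1)) + b : ℕ) : ℝ)) + (s + ((i+1:ℕ):ℝ) * t)) ≤ j * C * m / P := by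
  have hy1 := H.y1_ge
  have hC := H.C_ge
  have hm1 : (1:ℝ) ≤ m := hy1.trans hm
  have hP1 : (1:ℝ) ≤ P := by exact_mod_cast hP
  have hj1 : (1:ℝ) ≤ j := by exact_mod_cast hj
  have hb' : (b:ℝ) ≤ m := by exact_mod_cast hb
  have hN0 : 0 < N := by linarith
  have hi' : (i:ℝ) + 1 ≤ P := by exact_mod_cast hi
  obtain ⟨y, hy⟩ : ∃ y : ℝ, y = m * (P + i) + b := ⟨_, rfl⟩
  have hymP : (m:ℝ) * P ≤ y := by
    have : (0:ℝ) ≤ (m:ℝ) * i + b := by positivity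
    rw [hy, mul_add]; linarith
  have hmP : (m:ℝ) * 1 ≤ m * P := mul_le_mul_of_nonneg_left hP1 (by linarith)
  have hyy : y1 ≤ y := by linarith
  obtain ⟨ζ, hζ1, hζ2, hζ3⟩ := second_diff H y m hyy (by linarith)
  have c1 : (((m * (P + i) + b : ℕ) : ℝ)) = y := by rw [hy]; push_cast; ring
  have c2 : (((m * (P + (i+2)) + b : ℕ) : ℝ)) = y + 2 * m := by rw [hy]; push_cast; ring
  have c3 : (((m * (P + (i+1)) + b : ℕ) : ℝ)) = y + m := by rw [hy]; push_cast; ring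
  rw [c1, c2, c3]
  have heq : -(j:ℝ) * φ y + (s + i * t) + (-(j:ℝ) * φ (y + 2 * m) + (s + ((i + 2 : ℕ) : ℝ) * t)) - 2 * (-(j:ℝ) * φ (y + m) + (s + ((i + 1 : ℕ) : ℝ) * t)) = j * (m ^ 2 * (- φ2 ζ)) := by
    push_cast; linear_combination (-(j:ℝ)) * hζ3
  rw [heq]
  obtain ⟨_, _, _, g1, g2, _⟩ := H.main ζ (by linarith)
  have hζ0 : 0 < ζ := by linarith
  have hζmP : (m:ℝ) * P ≤ ζ := by linarith
  have hζN : ζ ≤ N ^ (1.005:ℝ) := zeta_le m P i b ζ N hN0 hm1 hP1 hi' hb' hPN hmN (by rw [← hy]; exact hζ2)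
  have g0 : (N ^ (1.005:ℝ)) ^ (-(1.07:ℝ)) ≤ - φ2 ζ := by
    refine le_trans ?_ g1
    exact Real.rpow_le_rpow_of_nonpos hζ0 hζN (by norm_num)
  have g00 : 0 ≤ -φ2 ζ := le_trans (by positivity) g0
  constructor
  · have h1 : (1:ℝ) ≤ j * m ^ 2 := one_le_mul_of_one_le_of_one_le hj1 (one_le_pow₀ hm1)
    calc _ ≤ 1 * (-φ2 ζ) := by linarith
      _ ≤ (j * m ^ 2) * (-φ2 ζ) := mul_le_mul_of_nonneg_right h1 g00
      _ = _ := by ring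
  · calc (j:ℝ) * (m ^ 2 * (-φ2 ζ)) ≤ j * (m ^ 2 * (C / (m * P))) := by
          gcongr
          refine g2.trans ?_
          gcongr
      _ = _ := by field_simp

lemma block_neg {φ φ2 : ℝ → ℝ} {y1 C : ℝ} (H : PhiOK φ φ2 y1 C) (m b P L j : ℕ) (hm : y1 ≤ m) (hb : b ≤ m)
    (hP : 1 ≤ P) (hL : L ≤ P) (hj : 1 ≤ j) (N : ℝ) (hN : 1 ≤ N) (hPN : (P:ℝ) ≤ N) (hmN : 5 * (m:ℝ) ≤ N ^ (0.005:ℝ))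
    (hjN : j * C * m ≤ N ^ (0.075:ℝ)) (s t : ℝ) :
    ‖∑ i ∈ Finset.range L, e (-(j:ℝ) * φ (((m * (P + i) + b : ℕ) : ℝ)) + (s + i * t))‖ ≤ 50 * N ^ (0.88:ℝ) := by
  have hy1 := H.y1_ge
  have hC := H.C_ge
  have hm1 : (1:ℝ) ≤ m := hy1.trans hm
  have hP1 : (1:ℝ) ≤ P := by exact_mod_cast hP
  have hj1 : (1:ℝ) ≤ j := by exact_mod_cast hj
  have hLP : (L:ℝ) ≤ P := by exact_mod_cast hL
  have hb' : (b:ℝ) ≤ m := by exact_mod_cast hb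
  have hN0 : 0 < N := by linarith
  set lam : ℝ := (N ^ (1.005:ℝ)) ^ (-(1.07:ℝ)) with hlam
  set V : ℝ := j * C * m / P with hV
  have hlam0 : 0 < lam := by positivity
  have key : ∀ i < L, lam ≤ (fun i : ℕ => -(j:ℝ) * φ (((m * (P + i) + b : ℕ) : ℝ)) + (s + i * t)) i + (fun i : ℕ => -(j:ℝ) * φ (((m * (P + i) + b : ℕ) : ℝ)) + (s + i * t)) (i+2) - 2 * (fun i : ℕ => -(j:ℝ) * φ (((m * (P + i) + b : ℕ) : ℝ)) + (s + i * t)) (i+1) ∧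
     (fun i : ℕ => -(j:ℝ) * φ (((m * (P + i) + b : ℕ) : ℝ)) + (s + i * t)) i + (fun i : ℕ => -(j:ℝ) * φ (((m * (P + i) + b : ℕ) : ℝ)) + (s + i * t)) (i+2) - 2 * (fun i : ℕ => -(j:ℝ) * φ (((m * (P + i) + b : ℕ) : ℝ)) + (s + i * t)) (i+1) ≤ V :=
    fun i hi => block_key H m b P i j hm hb hP (by omega) hj N hN hPN hmN s t
  set H0 := ⌈N ^ (0.4:ℝ)⌉₊ with hH0
  have hN4 : 1 ≤ N ^ (0.4:ℝ) := Real.one_le_rpow hN (by norm_num)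
  have hHa : N ^ (0.4:ℝ) ≤ H0 := Nat.le_ceil _
  have hHb : (H0:ℝ) ≤ 2 * N ^ (0.4:ℝ) := by
    have := Nat.ceil_lt_add_one (show 0 ≤ N ^ (0.4:ℝ) by linarith)
    rw [← hH0] at this; linarith
  have hH1 : 1 ≤ H0 := by
    have : (1:ℝ) ≤ H0 := hN4.trans hHa
    exact_mod_cast this
  have hV0 : 0 ≤ V := by positivity
  have hb1 := exp_sum_bound (fun i : ℕ => -(j:ℝ) * φ (((m * (P + i) + b : ℕ) : ℝ)) + (s + i * t)) L H0 hH1 lam V (N ^ (-(0.28:ℝ))) hlam0 (by positivity)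
    (fun i hi => (key i hi).1) (fun i hi => (key i hi).2) hV0
  refine hb1.trans ?_
  have hVL : V * L ≤ N ^ (0.075:ℝ) := by
    calc V * L ≤ V * P := by gcongr
      _ = j * C * m := by rw [hV]; field_simp
      _ ≤ _ := hjN
  have hmono : ∀ a b : ℝ, a ≤ b → N ^ a ≤ N ^ b := fun a b hab => Real.rpow_le_rpow_of_exponent_le hN hab
  have t1 : (L:ℝ) / (N ^ (-(0.28:ℝ)) * H0) ≤ N ^ (0.88:ℝ) := by
    rw [div_le_iff₀ (by positivity)]
    calc (L:ℝ) ≤ N := by linarith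
      _ = N ^ (0.88:ℝ) * (N ^ (-(0.28:ℝ)) * N ^ (0.4:ℝ)) := by
          rw [← Real.rpow_add hN0, ← Real.rpow_add hN0]; norm_num
      _ ≤ _ := by gcongr
  have t2 : 7 * V * (H0:ℝ) ^ 2 * L ≤ 28 * N ^ (0.88:ℝ) := by
    calc 7 * V * (H0:ℝ) ^ 2 * L = 7 * (V * L) * (H0:ℝ) ^ 2 := by ring
      _ ≤ 7 * N ^ (0.075:ℝ) * (2 * N ^ (0.4:ℝ)) ^ 2 := by gcongr
      _ = 28 * (N ^ (0.075:ℝ) * (N ^ (0.4:ℝ) * N ^ (0.4:ℝ))) := by ring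
      _ = 28 * N ^ (0.875:ℝ) := by rw [← Real.rpow_add hN0, ← Real.rpow_add hN0]; norm_num
      _ ≤ 28 * N ^ (0.88:ℝ) := by
          have := hmono 0.875 0.88 (by norm_num); linarith
  have t3 : 2 * N ^ (-(0.28:ℝ)) / lam ≤ 2 * N ^ (0.8:ℝ) := by
    have : 2 * N ^ (-(0.28:ℝ)) / lam = 2 * N ^ (0.79535:ℝ) := by
      rw [hlam, ← Real.rpow_mul hN0.le, mul_div_assoc, ← Real.rpow_sub hN0]; norm_num
    rw [this]
    have := hmono 0.79535 0.8 (by norm_num); linarith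
  have hn7 : 1 ≤ N ^ (0.075:ℝ) := Real.one_le_rpow hN (by norm_num)
  have t4 : (V * L + 2) * (2 * N ^ (-(0.28:ℝ)) / lam + H0) ≤ 12 * N ^ (0.88:ℝ) := by
    calc (V * L + 2) * (2 * N ^ (-(0.28:ℝ)) / lam + H0) ≤ (3 * N ^ (0.075:ℝ)) * (4 * N ^ (0.8:ℝ)) := by
          apply mul_le_mul
          · linarith
          · have := hmono 0.4 0.8 (by norm_num); linarith
          · positivity
          · positivity
      _ = 12 * (N ^ (0.075:ℝ) * N ^ (0.8:ℝ)) := by ring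
      _ = 12 * N ^ (0.875:ℝ) := by rw [← Real.rpow_add hN0]; norm_num
      _ ≤ 12 * N ^ (0.88:ℝ) := by
          have := hmono 0.875 0.88 (by norm_num); linarith
  have t5 := hmono 0.4 0.88 (by norm_num)
  linarith

lemma block_sum {φ φ2 : ℝ → ℝ} {y1 C : ℝ} (H : PhiOK φ φ2 y1 C) (m b P L J : ℕ) (hm : y1 ≤ m) (hb : b ≤ m)
    (hP : 1 ≤ P) (hL : L ≤ P) (N : ℝ) (hN : 1 ≤ N) (hPN : (P:ℝ) ≤ N) (hmN : 5 * (m:ℝ) ≤ N ^ (0.005:ℝ))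
    (hJN : J * C * m ≤ N ^ (0.075:ℝ)) (k : ℤ) (hk : k ≠ 0) (hkJ : |k| ≤ J) (s t : ℝ) :
    ‖∑ i ∈ Finset.range L, e ((k:ℝ) * φ (((m * (P + i) + b : ℕ) : ℝ)) + (s + i * t))‖ ≤ 50 * N ^ (0.88:ℝ) := by
  have hC := H.C_ge
  have hkJ' : k.natAbs ≤ J := by
    rw [Int.abs_eq_natAbs] at hkJ; exact_mod_cast hkJ
  have hmain : ∀ j : ℕ, 1 ≤ j → j ≤ J → ∀ s t : ℝ, ‖∑ i ∈ Finset.range L, e (-(j:ℝ) * φ (((m * (P + i) + b : ℕ) : ℝ)) + (s + i * t))‖ ≤ 50 * N ^ (0.88:ℝ) := by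
    intro j hj hjJ s t
    apply block_neg H m b P L j hm hb hP hL hj N hN hPN hmN
    refine le_trans ?_ hJN
    gcongr
  rcases lt_or_gt_of_ne hk with h | h
  · have := hmain k.natAbs (by omega) hkJ' s t
    have h2 : -((k.natAbs : ℕ) : ℝ) = k := by
      have : ((k.natAbs : ℕ) : ℤ) = -k := by omega
      have h3 : ((k.natAbs : ℕ) : ℝ) = ((-k : ℤ) : ℝ) := by rw [← this]; simp
      rw [h3]; push_cast; ring
    rw [h2] at this; exact this
  · have := hmain k.natAbs (by omega) hkJ' (-s) (-t)
    have h2 : ((k.natAbs : ℕ) : ℝ) = k := by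
      have : ((k.natAbs : ℕ) : ℤ) = k := by omega
      have h3 : ((k.natAbs : ℕ) : ℝ) = ((k : ℤ) : ℝ) := by rw [← this]; simp
      rw [h3]
    rw [h2] at this
    rw [← Complex.norm_conj, map_sum]
    convert this using 3
    rw [← e_neg]; congr 1; ring

noncomputable def fej (J : ℕ) (t : ℝ) : ℝ := ‖∑ j ∈ Finset.range J, e (j * t)‖ ^ 2 / J

lemma fej_nonneg (J : ℕ) (t : ℝ) : 0 ≤ fej J t := by unfold fej; positivity

lemma fej_expand (J : ℕ) (hJ : 1 ≤ J) (t : ℝ) : ((fej J t : ℝ) : ℂ) - 1 =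
    ∑ j ∈ Finset.range J, ∑ k ∈ Finset.range J, (if j = k then (0:ℂ) else (1 / (J:ℂ)) * e ((((j:ℤ) - (k:ℤ) : ℤ) : ℝ) * t)) := by
  have hJ0 : (J:ℂ) ≠ 0 := by
    have : J ≠ 0 := by omega
    exact_mod_cast this
  have h1 : ((fej J t : ℝ) : ℂ) = (1 / (J:ℂ)) * ∑ j ∈ Finset.range J, ∑ k ∈ Finset.range J, e ((((j:ℤ) - (k:ℤ) : ℤ) : ℝ) * t) := by
    unfold fej
    have h : ((‖∑ j ∈ Finset.range J, e (j * t)‖ ^ 2 : ℝ) : ℂ) = (∑ j ∈ Finset.range J, e (j * t)) * (starRingEnd ℂ) (∑ j ∈ Finset.range J, e (j * t)) := by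
      rw [Complex.mul_conj, Complex.normSq_eq_norm_sq]
    rw [Complex.ofReal_div, h, map_sum, Finset.sum_mul_sum]
    rw [div_eq_mul_inv, mul_comm, one_div]
    congr 1
    apply Finset.sum_congr rfl; intro j _
    apply Finset.sum_congr rfl; intro k _
    rw [← e_neg, ← e_add]; congr 1; push_cast; ring
  have h2 : (1:ℂ) = (1 / (J:ℂ)) * ∑ j ∈ Finset.range J, ∑ k ∈ Finset.range J, (if j = k then (1:ℂ) else 0) := by
    have : ∀ j ∈ Finset.range J, ∑ k ∈ Finset.range J, (if j = k then (1:ℂ) else 0) = 1 := by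
      intro j hj
      rw [Finset.sum_ite_eq, if_pos hj]
    rw [Finset.sum_congr rfl this]
    simp [hJ0]
  rw [h1]
  nth_rewrite 2 [h2]
  rw [← mul_sub, ← Finset.sum_sub_distrib, Finset.mul_sum]
  apply Finset.sum_congr rfl; intro j _
  rw [← Finset.sum_sub_distrib, Finset.mul_sum]
  apply Finset.sum_congr rfl; intro k _
  split_ifs with h
  · subst h; simp [e_zero]
  · simp

lemma fej_lower (J : ℕ) (hJ : 1 ≤ J) (t : ℝ) (k : ℤ) (τ : ℝ) (ht : t = k - τ) (h0 : 0 ≤ τ) (h1 : τ * (16 * J) ≤ 1) :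
    (J:ℝ) / 4 ≤ fej J t := by
  have hJ1 : (1:ℝ) ≤ J := by exact_mod_cast hJ
  have h2 : ∀ j ∈ Finset.range J, ‖e (j * t) - 1‖ ≤ 1 / 2 := by
    intro j hj
    have hjJ : (j:ℝ) ≤ J := by exact_mod_cast (Finset.mem_range.mp hj).le
    have : e (j * t) = e (-(j * τ)) := by
      rw [ht]
      have h3 : (j:ℝ) * (k - τ) = -(j * τ) + (((j:ℤ) * k : ℤ) : ℝ) := by push_cast; ring
      rw [h3, e_add, e_int, mul_one]
    rw [this]
    refine (norm_e_sub_one_le _).trans ?_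
    rw [abs_neg, abs_of_nonneg (by positivity)]
    have h4 : (j:ℝ) * τ ≤ J * τ := by gcongr
    have h5 := Real.pi_lt_four
    have h6 : (J:ℝ) * τ ≤ 1 / 16 := by linarith
    calc 2 * π * (j * τ) ≤ 2 * 4 * (1/16) := by
          gcongr; exact h4.trans h6
      _ = 1/2 := by norm_num
  have h3 : ‖∑ j ∈ Finset.range J, e (j * t) - J‖ ≤ J / 2 := by
    have : ∑ j ∈ Finset.range J, e (j * t) - J = ∑ j ∈ Finset.range J, (e (j * t) - 1) := by
      rw [Finset.sum_sub_distrib]; simp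
    rw [this]
    refine (norm_sum_le _ _).trans ((Finset.sum_le_sum h2).trans ?_)
    simp; linarith
  have h4 : (J:ℝ) / 2 ≤ ‖∑ j ∈ Finset.range J, e (j * t)‖ := by
    have h5 := norm_sub_norm_le (J:ℂ) (J - ∑ j ∈ Finset.range J, e (j * t))
    rw [sub_sub_cancel, norm_sub_rev (J:ℂ), Complex.norm_natCast] at h5
    linarith
  unfold fej
  rw [le_div_iff₀ (by linarith)]
  calc (J:ℝ) / 4 * J = (J / 2) ^ 2 := by ring
    _ ≤ _ := by gcongr

lemma sum_comb_le {ι κ : Type*} (S : Finset ι) (T : Finset κ) (a : κ → ℂ) (g : κ → ι → ℂ) (V A : ℝ)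
    (hg : ∀ p ∈ T, a p ≠ 0 → ‖∑ i ∈ S, g p i‖ ≤ V) (hV : 0 ≤ V) (hA : ∑ p ∈ T, ‖a p‖ ≤ A) :
    ‖∑ i ∈ S, ∑ p ∈ T, a p * g p i‖ ≤ A * V := by
  rw [Finset.sum_comm]
  calc _ ≤ ∑ p ∈ T, ‖a p‖ * V := by
        refine (norm_sum_le _ _).trans (Finset.sum_le_sum ?_)
        intro p hp
        rw [← Finset.mul_sum, norm_mul]
        by_cases h : a p = 0
        · simp [h]
        · gcongr; exact hg p hp h
    _ ≤ A * V := by rw [← Finset.sum_mul]; gcongr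

lemma block_T1 {φ φ2 : ℝ → ℝ} {y1 C : ℝ} (H : PhiOK φ φ2 y1 C) (D m b P L J : ℕ) (hD : 1 ≤ D) (hm : y1 ≤ m) (hb : b ≤ m)
    (hP : 1 ≤ P) (hL : L ≤ P) (hJ : 1 ≤ J) (N : ℝ) (hN : 1 ≤ N) (hPN : (P:ℝ) ≤ N) (hmN : 5 * (m:ℝ) ≤ N ^ (0.005:ℝ))
    (hJN : J * C * m ≤ N ^ (0.075:ℝ)) (θ : ℝ) :
    ‖∑ i ∈ Finset.range L, ((‖Lam D m (m * (P + i) + b)‖ ^ 2 : ℝ) : ℂ) *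
      ((((fej J (φ ((m * (P + i) + b : ℕ) : ℝ)) : ℝ) : ℂ) - 1) * e (θ * ((P + i : ℕ) : ℝ)))‖ ≤ (D:ℝ) ^ 2 * (J * (50 * N ^ (0.88:ℝ))) := by
  have hN0 : 0 < N := by linarith
  have hJ1 : (1:ℝ) ≤ J := by exact_mod_cast hJ
  have step1 : ∀ z : UnitAddCircle, ‖∑ i ∈ Finset.range L, chi ((m * (P + i) + b) • z) *
      ((((fej J (φ ((m * (P + i) + b : ℕ) : ℝ)) : ℝ) : ℂ) - 1) * e (θ * ((P + i : ℕ) : ℝ)))‖ ≤ J * (50 * N ^ (0.88:ℝ)) := by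
    intro z
    induction z using QuotientAddGroup.induction_on with
    | H r =>
    have hs := sum_comb_le (Finset.range L) (Finset.range J ×ˢ Finset.range J)
      (fun p : ℕ × ℕ => if p.1 = p.2 then (0:ℂ) else 1 / (J:ℂ))
      (fun p i => e ((((p.1:ℤ) - (p.2:ℤ) : ℤ) : ℝ) * φ ((m * (P + i) + b : ℕ) : ℝ) + (((m * P + b) * r + θ * P) + i * (m * r + θ))))
      (50 * N ^ (0.88:ℝ)) J ?_ (by positivity) ?_
    · refine le_trans (le_of_eq ?_) hs
      congr 1
      apply Finset.sum_congr rfl; intro i _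
      rw [fej_expand J hJ, Finset.sum_product, Finset.sum_mul, Finset.mul_sum]
      apply Finset.sum_congr rfl; intro j _
      rw [Finset.sum_mul, Finset.mul_sum]
      apply Finset.sum_congr rfl; intro k _
      have hc : chi ((m * (P + i) + b) • (r : UnitAddCircle)) = e (((m * (P + i) + b : ℕ) : ℝ) * r) := by
        rw [← chi_coe, ← nsmul_eq_mul]; rfl
      have h6 := chi_coe r
      dsimp only
      split_ifs with h
      · simp
      · rw [e_add]
        have : e ((↑m * ↑P + ↑b) * r + θ * ↑P + ↑i * (↑m * r + θ)) = e (((m * (P + i) + b : ℕ) : ℝ) * r) * e (θ * ((P + i : ℕ) : ℝ)) := by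
          rw [← e_add]; congr 1; push_cast; ring
        rw [this, ← hc]; ring
    · rintro ⟨j, k⟩ hp hne
      rw [Finset.mem_product, Finset.mem_range, Finset.mem_range] at hp
      have hjk : j ≠ k := by
        intro h; apply hne; simp [h]
      apply block_sum H m b P L J hm hb hP hL N hN hPN hmN hJN
      · dsimp only; omega
      · dsimp only at hp ⊢; rw [abs_le]; omega
    · calc _ ≤ ∑ p ∈ Finset.range J ×ˢ Finset.range J, (1 / (J:ℝ)) := by
            apply Finset.sum_le_sum; intro p _
            split_ifs
            · simp
            · simp
        _ = J := by simp
  have hs := sum_comb_le (Finset.range L) (FS D m ×ˢ FS D m)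
      (fun p => ((wt D m p.1 * wt D m p.2 : ℝ) : ℂ))
      (fun p i => chi ((m * (P + i) + b) • (p.1 - p.2)) *
      ((((fej J (φ ((m * (P + i) + b : ℕ) : ℝ)) : ℝ) : ℂ) - 1) * e (θ * ((P + i : ℕ) : ℝ))))
      (J * (50 * N ^ (0.88:ℝ))) ((D:ℝ)^2) (fun p _ _ => step1 _) (by positivity) ?_
  · refine le_trans (le_of_eq ?_) hs
    congr 1
    apply Finset.sum_congr rfl; intro i _
    rw [lam_sq, Finset.sum_product, Finset.sum_mul]
    apply Finset.sum_congr rfl; intro u _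
    rw [Finset.sum_mul]
    apply Finset.sum_congr rfl; intro v _
    ring
  · have h1 := sum_abs_wt (D := D) (m := m) hD
    calc _ = (∑ u ∈ FS D m, |wt D m u|) * ∑ v ∈ FS D m, |wt D m v| := by
          rw [Finset.sum_mul_sum, Finset.sum_product]
          apply Finset.sum_congr rfl; intro u _
          apply Finset.sum_congr rfl; intro v _
          rw [Complex.norm_real, Real.norm_eq_abs, abs_mul]
      _ ≤ D * D := by gcongr
      _ = (D:ℝ)^2 := by ring

noncomputable def GG (φ : ℝ → ℝ) (Jf : ℕ → ℕ) (m b n : ℕ) : ℝ :=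
  if n = 0 then 1 else fej (Jf (Nat.log 2 n)) (φ ((m * n + b : ℕ) : ℝ))

lemma GG_nonneg (φ : ℝ → ℝ) (Jf : ℕ → ℕ) (m b n : ℕ) : 0 ≤ GG φ Jf m b n := by
  unfold GG; split_ifs
  · norm_num
  · exact fej_nonneg _ _

lemma dyadic_sum (N : ℕ) (hN : 1 ≤ N) (f : ℕ → ℂ) (hf : f 0 = 0) :
    ∑ n ∈ Finset.range N, f n = ∑ i ∈ Finset.range (Nat.log 2 N + 1),
      ∑ j ∈ Finset.range (min (2 ^ (i + 1)) N - 2 ^ i), f (2 ^ i + j) := by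
  have h1 : ∑ n ∈ Finset.range N, f n = ∑ n ∈ Finset.Ico 1 N, f n := by
    rw [Finset.range_eq_Ico, Finset.sum_eq_sum_Ico_succ_bot (by omega), hf, zero_add]
  rw [h1, ← Finset.sum_fiberwise_of_maps_to (g := Nat.log 2) (t := Finset.range (Nat.log 2 N + 1))]
  · apply Finset.sum_congr rfl
    intro i _
    rw [← Finset.sum_Ico_eq_sum_range]
    apply Finset.sum_congr _ (fun _ _ => rfl)
    ext n
    rw [Finset.mem_filter, Finset.mem_Ico, Finset.mem_Ico, lt_min_iff]
    constructor
    · rintro ⟨⟨h1, h2⟩, h3⟩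
      have := (Nat.log_eq_iff (b := 2) (m := i) (n := n) (Or.inr ⟨by norm_num, by omega⟩)).mp h3
      exact ⟨this.1, this.2, h2⟩
    · rintro ⟨h1, h2, h3⟩
      have h4 : 0 < 2 ^ i := by positivity
      exact ⟨⟨by omega, h3⟩, (Nat.log_eq_iff (b := 2) (m := i) (n := n) (Or.inr ⟨by norm_num, by omega⟩)).mpr ⟨h1, h2⟩⟩
  · intro n hn
    rw [Finset.mem_Ico] at hn
    rw [Finset.mem_range, Nat.lt_succ_iff]
    exact Nat.log_mono_right hn.2.le

lemma T1_bound {φ φ2 : ℝ → ℝ} {y1 C : ℝ} (H : PhiOK φ φ2 y1 C) (D m b N : ℕ) (hD : 1 ≤ D) (hm : y1 ≤ m) (hb : b ≤ m)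
    (hN : 1 ≤ N) (hmN : 5 * (m:ℝ) ≤ (N:ℝ) ^ (0.005:ℝ)) (Jf : ℕ → ℕ) (hJ : ∀ i, 1 ≤ Jf i)
    (hJN : ∀ i, 2 ^ i ≤ N → Jf i * C * m ≤ (N:ℝ) ^ (0.075:ℝ)) (ξ : ℕ) :
    ‖∑ n ∈ Finset.range N, ((‖Lam D m (m * n + b)‖ ^ 2 : ℝ) : ℂ) *
      ((((GG φ Jf m b n : ℝ) : ℂ) - 1) * e (-((ξ:ℝ) * n / N)))‖ ≤
      (Nat.log 2 N + 1) * ((D:ℝ) ^ 2 * ((N:ℝ) ^ (0.075:ℝ) * (50 * (N:ℝ) ^ (0.88:ℝ)))) := by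
  have hN1 : (1:ℝ) ≤ N := by exact_mod_cast hN
  have hm1 : (1:ℝ) ≤ m := H.y1_ge.trans hm
  have hC := H.C_ge
  rw [dyadic_sum N hN _ (by simp [GG])]
  refine (norm_sum_le _ _).trans ?_
  calc _ ≤ ∑ i ∈ Finset.range (Nat.log 2 N + 1), ((D:ℝ) ^ 2 * ((N:ℝ) ^ (0.075:ℝ) * (50 * (N:ℝ) ^ (0.88:ℝ)))) := by
        apply Finset.sum_le_sum
        intro i hi
        have hi2 : i ≤ Nat.log 2 N := by rw [Finset.mem_range] at hi; omega
        have h2i : 2 ^ i ≤ N := Nat.pow_le_of_le_log (by omega) hi2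
        have hpos : 0 < 2 ^ i := by positivity
        have hL : min (2 ^ (i + 1)) N - 2 ^ i ≤ 2 ^ i := by
          have : min (2 ^ (i + 1)) N ≤ 2 ^ (i+1) := min_le_left _ _
          rw [pow_succ] at *; omega
        have hb1 := block_T1 H D m b (2 ^ i) (min (2 ^ (i + 1)) N - 2 ^ i) (Jf i) hD hm hb hpos hL (hJ i) N hN1
          (by exact_mod_cast h2i) hmN (hJN i h2i) (-((ξ:ℝ) / N))
        have hJle : (Jf i : ℝ) ≤ (N:ℝ) ^ (0.075:ℝ) := by
          refine le_trans ?_ (hJN i h2i)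
          rw [mul_assoc]
          exact le_mul_of_one_le_right (by positivity) (one_le_mul_of_one_le_of_one_le hC hm1)
        have : (D:ℝ) ^ 2 * (Jf i * (50 * (N:ℝ) ^ (0.88:ℝ))) ≤ (D:ℝ) ^ 2 * ((N:ℝ) ^ (0.075:ℝ) * (50 * (N:ℝ) ^ (0.88:ℝ))) := by gcongr
        refine le_trans (le_of_eq ?_) (hb1.trans this)
        congr 1
        apply Finset.sum_congr rfl
        intro j hj
        rw [Finset.mem_range] at hj
        have hj2 : 2 ^ i + j < 2 ^ (i + 1) := by
          have : min (2 ^ (i + 1)) N ≤ 2 ^ (i+1) := min_le_left _ _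
          omega
        have hlog : Nat.log 2 (2 ^ i + j) = i :=
          (Nat.log_eq_iff (b := 2) (m := i) (n := 2 ^ i + j) (Or.inr ⟨by norm_num, by omega⟩)).mpr ⟨by omega, hj2⟩
        have hG : GG φ Jf m b (2 ^ i + j) = fej (Jf i) (φ ((m * (2 ^ i + j) + b : ℕ) : ℝ)) := by
          unfold GG; rw [if_neg (by omega), hlog]
        rw [hG]
        congr 3
        ring
    _ = _ := by simp

noncomputable def Jf (φ : ℝ → ℝ) (m i : ℕ) : ℕ := max 1 ⌊(16 * deriv φ ((m:ℝ) * 2 ^ i))⁻¹⌋₊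

lemma phi'_anti {φ φ2 : ℝ → ℝ} {y1 C : ℝ} (H : PhiOK φ φ2 y1 C) (y z : ℝ) (hy : y1 ≤ y) (hyz : y ≤ z) :
    deriv φ z ≤ deriv φ y := by
  rcases hyz.eq_or_lt with h | h
  · rw [h]
  obtain ⟨ζ, hζ, hζ2⟩ := exists_hasDerivAt_eq_slope (deriv φ) φ2 h
    (fun t ht => (H.main t (by linarith [ht.1])).2.2.1.continuousAt.continuousWithinAt)
    (fun t ht => (H.main t (by linarith [ht.1])).2.2.1)
  have h0 : 0 < ζ := by linarith [H.y1_ge, hζ.1]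
  have h1 := (H.main ζ (by linarith [hζ.1])).2.2.2.1
  have h2 : 0 < ζ ^ (-(1.07:ℝ)) := by positivity
  rw [eq_div_iff (by linarith)] at hζ2
  have h3 : φ2 ζ * (z - y) ≤ 0 := mul_nonpos_of_nonpos_of_nonneg (by linarith) (by linarith)
  linarith

lemma Jf_bound {φ φ2 : ℝ → ℝ} {y1 C : ℝ} (H : PhiOK φ φ2 y1 C) (m N i : ℕ) (hm : y1 ≤ m) (hN : 1 ≤ N)
    (hmN : 5 * (m:ℝ) ≤ (N:ℝ) ^ (0.005:ℝ)) (hCN : C ≤ (N:ℝ) ^ (0.005:ℝ)) (hi : 2 ^ i ≤ N) :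
    Jf φ m i * C * m ≤ (N:ℝ) ^ (0.075:ℝ) := by
  have hN1 : (1:ℝ) ≤ N := by exact_mod_cast hN
  have hN0 : (0:ℝ) < N := by linarith
  have hm1 : (1:ℝ) ≤ m := H.y1_ge.trans hm
  have hC := H.C_ge
  have hi' : (2:ℝ) ^ i ≤ N := by exact_mod_cast hi
  have h2i : (1:ℝ) ≤ 2 ^ i := one_le_pow₀ (by norm_num)
  have hYm : (m:ℝ) ≤ m * 2 ^ i := le_mul_of_one_le_right (by linarith) h2i
  have hY : y1 ≤ (m:ℝ) * 2 ^ i := by linarith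
  obtain ⟨g1, _, _, _, _, g2⟩ := H.main _ hY
  have hYN : (m:ℝ) * 2 ^ i ≤ (N:ℝ) ^ (1.005:ℝ) := by
    calc (m:ℝ) * 2 ^ i ≤ (N:ℝ) ^ (0.005:ℝ) * N := by gcongr; linarith
      _ = (N:ℝ) ^ (1.005:ℝ) := by
        nth_rewrite 2 [← Real.rpow_one (N:ℝ)]; rw [← Real.rpow_add hN0]; norm_num
  have hJ : (Jf φ m i : ℝ) ≤ (N:ℝ) ^ (0.063:ℝ) := by
    unfold Jf
    rw [Nat.cast_max]
    apply max_le
    · rw [Nat.cast_one]; exact Real.one_le_rpow hN1 (by norm_num)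
    · refine (Nat.floor_le (by positivity)).trans ?_
      rw [mul_inv]
      have h5 : (16:ℝ)⁻¹ * (deriv φ ((m:ℝ) * 2 ^ i))⁻¹ ≤ ((m:ℝ) * 2 ^ i) ^ ((1:ℝ)/16) := by
        have : 0 ≤ ((m:ℝ) * 2 ^ i) ^ ((1:ℝ)/16) := by positivity
        linarith
      refine h5.trans ?_
      calc ((m:ℝ) * 2 ^ i) ^ ((1:ℝ)/16) ≤ ((N:ℝ) ^ (1.005:ℝ)) ^ ((1:ℝ)/16) := by gcongr
        _ = (N:ℝ) ^ (1.005 * ((1:ℝ)/16)) := by rw [← Real.rpow_mul hN0.le]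
        _ ≤ _ := Real.rpow_le_rpow_of_exponent_le hN1 (by norm_num)
  calc (Jf φ m i : ℝ) * C * m ≤ (N:ℝ) ^ (0.063:ℝ) * (N:ℝ) ^ (0.005:ℝ) * (N:ℝ) ^ (0.005:ℝ) := by
        gcongr; linarith
    _ = (N:ℝ) ^ (0.073:ℝ) := by rw [← Real.rpow_add hN0, ← Real.rpow_add hN0]; norm_num
    _ ≤ _ := Real.rpow_le_rpow_of_exponent_le hN1 (by norm_num)

lemma GG_lower {φ φ2 : ℝ → ℝ} {y1 C : ℝ} (H : PhiOK φ φ2 y1 C) (m b n k : ℕ) (hm : y1 ≤ m) (hb : b ≤ m) (hn : 1 ≤ n)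
    (hk1 : φ ((m * n + b : ℕ) : ℝ) ≤ k) (hk2 : (k:ℝ) < φ (((m * n + b : ℕ) : ℝ) + 1)) :
    (deriv φ ((m * n + b : ℕ) : ℝ))⁻¹ ≤ 1024 * GG φ (Jf φ m) m b n := by
  have hm1 : (1:ℝ) ≤ m := H.y1_ge.trans hm
  obtain ⟨i, hi⟩ : ∃ i, i = Nat.log 2 n := ⟨_, rfl⟩
  have hlow : 2 ^ i ≤ n := by rw [hi]; exact Nat.pow_log_le_self 2 (by omega)
  have hup : n + 1 ≤ 2 ^ (i + 1) := by rw [hi]; exact Nat.lt_pow_succ_log_self (by norm_num) n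
  have hlow' : (2:ℝ) ^ i ≤ n := by exact_mod_cast hlow
  have hup' : (n:ℝ) + 1 ≤ 2 * 2 ^ i := by
    have : ((n + 1 : ℕ) : ℝ) ≤ ((2 ^ (i + 1) : ℕ) : ℝ) := by exact_mod_cast hup
    push_cast at this; rw [pow_succ] at this; linarith
  have hb' : (b:ℝ) ≤ m := by exact_mod_cast hb
  have h2i : (1:ℝ) ≤ 2 ^ i := one_le_pow₀ (by norm_num)
  obtain ⟨Y, hYd⟩ : ∃ Y : ℝ, Y = (m:ℝ) * 2 ^ i := ⟨_, rfl⟩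
  have hYm : (m:ℝ) ≤ Y := by rw [hYd]; exact le_mul_of_one_le_right (by linarith) h2i
  have hY : y1 ≤ Y := by linarith
  have hG : GG φ (Jf φ m) m b n = fej (Jf φ m i) (φ ((m * n + b : ℕ) : ℝ)) := by
    unfold GG; rw [if_neg (by omega), ← hi]
  rw [hG]
  obtain ⟨y, hy⟩ : ∃ y : ℝ, y = ((m * n + b : ℕ) : ℝ) := ⟨_, rfl⟩
  rw [← hy] at hk1 hk2 ⊢
  have hyY : Y ≤ y := by
    rw [hy, hYd]; push_cast
    have : (m:ℝ) * 2 ^ i ≤ m * n := by gcongr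
    have : (0:ℝ) ≤ b := by positivity
    linarith
  have hy2Y : y ≤ 2 * Y := by
    rw [hy, hYd]; push_cast
    have : (m:ℝ) * (n + 1) ≤ m * (2 * 2 ^ i) := by gcongr
    linarith
  have hdbl := H.doubling Y y hY hyY hy2Y
  have hpos := (H.main Y hY).1
  have hanti : ∀ z, Y ≤ z → deriv φ z ≤ deriv φ Y := fun z hz => phi'_anti H Y z hY hz
  obtain ⟨ζ, hζ, hζ2⟩ := exists_hasDerivAt_eq_slope φ (deriv φ) (show y < y + 1 by linarith)
    (fun t ht => (H.main t (by linarith [ht.1])).2.1.continuousAt.continuousWithinAt)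
    (fun t ht => (H.main t (by linarith [ht.1])).2.1)
  have hζ3 : φ (y + 1) - φ y ≤ deriv φ Y := by
    have h1 := hanti ζ (by linarith [hζ.1])
    rw [hζ2] at h1
    have e1 : y + 1 - y = 1 := by ring
    rw [e1, div_one] at h1
    exact h1
  have hJd : Jf φ m i = max 1 ⌊(16 * deriv φ Y)⁻¹⌋₊ := by unfold Jf; rw [hYd]
  by_cases hc : 1 ≤ (16 * deriv φ Y)⁻¹
  · have hfl1 : 1 ≤ ⌊(16 * deriv φ Y)⁻¹⌋₊ := by rw [Nat.one_le_floor_iff]; exact hc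
    have hJe : Jf φ m i = ⌊(16 * deriv φ Y)⁻¹⌋₊ := by rw [hJd]; exact max_eq_right hfl1
    obtain ⟨J, hJ⟩ : ∃ J, J = Jf φ m i := ⟨_, rfl⟩
    rw [← hJ] at hJe ⊢
    have hJ1 : 1 ≤ J := by omega
    have hJ1' : (1:ℝ) ≤ J := by exact_mod_cast hJ1
    have hJu : (J:ℝ) ≤ (16 * deriv φ Y)⁻¹ := by rw [hJe]; exact Nat.floor_le (by positivity)
    have hJl : (16 * deriv φ Y)⁻¹ ≤ 2 * J := by
      have := Nat.lt_floor_add_one ((16 * deriv φ Y)⁻¹)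
      rw [← hJe] at this; linarith
    have hf := fej_lower J hJ1 (φ y) (k:ℤ) (k - φ y) (by push_cast; ring) (by linarith) (by
      have h1 : (k:ℝ) - φ y ≤ deriv φ Y := by linarith
      calc ((k:ℝ) - φ y) * (16 * J) ≤ deriv φ Y * (16 * (16 * deriv φ Y)⁻¹) := by
            gcongr
        _ = 1 := by field_simp)
    have h16 : (deriv φ Y)⁻¹ = 16 * (16 * deriv φ Y)⁻¹ := by field_simp
    linarith
  · have hJe : Jf φ m i = 1 := by
      rw [hJd]; apply max_eq_left
      rw [not_le, ← Nat.floor_lt_one (by positivity)] at hc; omega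
    have hf1 : fej (Jf φ m i) (φ y) = 1 := by
      rw [hJe]; unfold fej; simp [e_zero]
    rw [hf1]
    have h16 : (deriv φ Y)⁻¹ = 16 * (16 * deriv φ Y)⁻¹ := by field_simp
    linarith

lemma natlog_le (N : ℕ) (hN : 1 ≤ N) (hl : 1 ≤ Real.log N) : ((Nat.log 2 N : ℕ) : ℝ) + 1 ≤ 5 * Real.log N := by
  have h1 : (2:ℝ) ^ (Nat.log 2 N) ≤ N := by exact_mod_cast Nat.pow_log_le_self 2 (by omega)
  have h2 := Real.log_le_log (by positivity) h1
  rw [Real.log_pow] at h2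
  have h3 := Real.log_two_gt_d9
  have h4 : (0:ℝ) ≤ (Nat.log 2 N : ℕ) := by positivity
  have h5 : ((Nat.log 2 N : ℕ) : ℝ) * (1/2) ≤ (Nat.log 2 N : ℕ) * Real.log 2 := by gcongr; linarith
  linarith

lemma err_small (N W D : ℕ) (hN : 1 ≤ N) (hW : 1 ≤ W) (hl : 1 ≤ Real.log N) (hL : 5 * Real.log N ≤ (N:ℝ) ^ (0.005:ℝ))
    (h6 : (10:ℝ) ^ 6 ≤ (N:ℝ) ^ (0.005:ℝ)) (hWN : (W:ℝ) ≤ Real.log N) (hDu : (D:ℝ) ≤ (N:ℝ) ^ (0.002:ℝ)) :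
    2048 * Real.log N / N * ((D:ℝ) ^ 6 + (Nat.log 2 N + 1) * ((D:ℝ) ^ 2 * ((N:ℝ) ^ (0.075:ℝ) * (50 * (N:ℝ) ^ (0.88:ℝ))))) +
     (D + 1) * (4 * Real.log N / N * ((N:ℝ) ^ (1.005:ℝ)) ^ ((1:ℝ)/16)) ≤ 1 / W := by
  have hN1 : (1:ℝ) ≤ N := by exact_mod_cast hN
  have hN0 : (0:ℝ) < N := by linarith
  have hmono : ∀ a b : ℝ, a ≤ b → (N:ℝ) ^ a ≤ (N:ℝ) ^ b := fun a b hab => Real.rpow_le_rpow_of_exponent_le hN1 hab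
  have hone : ∀ a : ℝ, 0 ≤ a → 1 ≤ (N:ℝ) ^ a := fun a ha => Real.one_le_rpow hN1 ha
  have hadd : ∀ a b : ℝ, (N:ℝ) ^ a * (N:ℝ) ^ b = (N:ℝ) ^ (a + b) := fun a b => (Real.rpow_add hN0 a b).symm
  have hlog1 : Real.log N ≤ (N:ℝ) ^ (0.005:ℝ) := by linarith
  have hnl := (natlog_le N hN hl).trans hL
  have hlogN : Real.log N / N ≤ (N:ℝ) ^ (-(0.995:ℝ)) := by
    calc Real.log N / N ≤ (N:ℝ) ^ (0.005:ℝ) / N := by gcongr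
      _ = (N:ℝ) ^ (0.005:ℝ) * (N:ℝ) ^ (-(1:ℝ)) := by rw [Real.rpow_neg_one, div_eq_mul_inv]
      _ = _ := by rw [hadd]; norm_num
  have hD6 : (D:ℝ) ^ 6 ≤ (N:ℝ) ^ (0.97:ℝ) := by
    calc (D:ℝ) ^ 6 ≤ ((N:ℝ) ^ (0.002:ℝ)) ^ 6 := by gcongr
      _ = (N:ℝ) ^ (0.012:ℝ) := by rw [← Real.rpow_natCast, ← Real.rpow_mul hN0.le]; norm_num
      _ ≤ _ := hmono _ _ (by norm_num)
  have hD2 : (D:ℝ) ^ 2 ≤ (N:ℝ) ^ (0.004:ℝ) := by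
    calc (D:ℝ) ^ 2 ≤ ((N:ℝ) ^ (0.002:ℝ)) ^ 2 := by gcongr
      _ = (N:ℝ) ^ (0.004:ℝ) := by rw [← Real.rpow_natCast, ← Real.rpow_mul hN0.le]; norm_num
  have hT : (Nat.log 2 N + 1) * ((D:ℝ) ^ 2 * ((N:ℝ) ^ (0.075:ℝ) * (50 * (N:ℝ) ^ (0.88:ℝ)))) ≤ 50 * (N:ℝ) ^ (0.97:ℝ) := by
    calc _ ≤ (N:ℝ) ^ (0.005:ℝ) * ((N:ℝ) ^ (0.004:ℝ) * ((N:ℝ) ^ (0.075:ℝ) * (50 * (N:ℝ) ^ (0.88:ℝ)))) := by gcongr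
      _ = 50 * ((N:ℝ) ^ (0.005:ℝ) * ((N:ℝ) ^ (0.004:ℝ) * ((N:ℝ) ^ (0.075:ℝ) * (N:ℝ) ^ (0.88:ℝ)))) := by ring
      _ = 50 * (N:ℝ) ^ (0.964:ℝ) := by rw [hadd, hadd, hadd]; norm_num
      _ ≤ _ := by have := hmono 0.964 0.97 (by norm_num); linarith
  have h1 : 2048 * Real.log N / N * ((D:ℝ) ^ 6 + (Nat.log 2 N + 1) * ((D:ℝ) ^ 2 * ((N:ℝ) ^ (0.075:ℝ) * (50 * (N:ℝ) ^ (0.88:ℝ)))))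
      ≤ 104448 * (N:ℝ) ^ (-(0.025:ℝ)) := by
    calc _ = 2048 * (Real.log N / N) * ((D:ℝ) ^ 6 + (Nat.log 2 N + 1) * ((D:ℝ) ^ 2 * ((N:ℝ) ^ (0.075:ℝ) * (50 * (N:ℝ) ^ (0.88:ℝ))))) := by ring
      _ ≤ 2048 * (N:ℝ) ^ (-(0.995:ℝ)) * ((N:ℝ) ^ (0.97:ℝ) + 50 * (N:ℝ) ^ (0.97:ℝ)) := by gcongr
      _ = 104448 * ((N:ℝ) ^ (-(0.995:ℝ)) * (N:ℝ) ^ (0.97:ℝ)) := by ring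
      _ = _ := by rw [hadd]; norm_num
  have h2 : ((D:ℝ) + 1) * (4 * Real.log N / N * ((N:ℝ) ^ (1.005:ℝ)) ^ ((1:ℝ)/16)) ≤ 8 * (N:ℝ) ^ (-(0.025:ℝ)) := by
    have hDD : (D:ℝ) + 1 ≤ 2 * (N:ℝ) ^ (0.002:ℝ) := by linarith [hone 0.002 (by norm_num)]
    have hp : ((N:ℝ) ^ (1.005:ℝ)) ^ ((1:ℝ)/16) ≤ (N:ℝ) ^ (0.063:ℝ) := by
      rw [← Real.rpow_mul hN0.le]; exact hmono _ _ (by norm_num)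
    calc _ = ((D:ℝ) + 1) * (4 * (Real.log N / N) * ((N:ℝ) ^ (1.005:ℝ)) ^ ((1:ℝ)/16)) := by ring
      _ ≤ (2 * (N:ℝ) ^ (0.002:ℝ)) * (4 * (N:ℝ) ^ (-(0.995:ℝ)) * (N:ℝ) ^ (0.063:ℝ)) := by gcongr
      _ = 8 * ((N:ℝ) ^ (0.002:ℝ) * ((N:ℝ) ^ (-(0.995:ℝ)) * (N:ℝ) ^ (0.063:ℝ))) := by ring
      _ = 8 * (N:ℝ) ^ (-(0.93:ℝ)) := by rw [hadd, hadd]; norm_num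
      _ ≤ _ := by have := hmono (-0.93) (-0.025) (by norm_num); linarith
  have hW0 : (0:ℝ) < W := by exact_mod_cast hW
  have h3 : (10:ℝ) ^ 6 * (N:ℝ) ^ (-(0.025:ℝ)) ≤ 1 / W := by
    rw [le_div_iff₀ hW0]
    calc (10:ℝ) ^ 6 * (N:ℝ) ^ (-(0.025:ℝ)) * W ≤ (N:ℝ) ^ (0.005:ℝ) * (N:ℝ) ^ (-(0.025:ℝ)) * (N:ℝ) ^ (0.005:ℝ) := by
          gcongr; linarith
      _ = (N:ℝ) ^ (-(0.015:ℝ)) := by rw [hadd, hadd]; norm_num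
      _ ≤ (N:ℝ) ^ (0:ℝ) := hmono _ _ (by norm_num)
      _ = 1 := Real.rpow_zero _
  have h4 : 0 ≤ (N:ℝ) ^ (-(0.025:ℝ)) := by positivity
  refine le_trans (add_le_add h1 h2) (le_trans ?_ h3)
  norm_num; linarith

lemma log_D (N D : ℕ) (hN : 1 ≤ N) (hDd : D = ⌊(N:ℝ) ^ (0.002:ℝ)⌋₊) 
    (h6 : (10:ℝ) ^ 6 ≤ (N:ℝ) ^ (0.005:ℝ)) : 1 ≤ D ∧ (D:ℝ) ≤ (N:ℝ) ^ (0.002:ℝ) ∧ 0.001 * Real.log N ≤ Real.log D := by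
  have hN1 : (1:ℝ) ≤ N := by exact_mod_cast hN
  have hN0 : (0:ℝ) < N := by linarith
  obtain ⟨x, hx⟩ : ∃ x, x = (N:ℝ) ^ (0.001:ℝ) := ⟨_, rfl⟩
  have hx0 : 0 < x := by rw [hx]; positivity
  have hx5 : (N:ℝ) ^ (0.005:ℝ) = x ^ 5 := by
    rw [hx, ← Real.rpow_natCast, ← Real.rpow_mul hN0.le]; norm_num
  have hx2 : (N:ℝ) ^ (0.002:ℝ) = x ^ 2 := by
    rw [hx, ← Real.rpow_natCast, ← Real.rpow_mul hN0.le]; norm_num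
  have h2 : 2 ≤ x := by
    by_contra h
    push Not at h
    have : x ^ 5 ≤ 2 ^ 5 := by gcongr
    rw [hx5] at h6; norm_num at *; linarith
  have hfl := Nat.lt_floor_add_one ((N:ℝ) ^ (0.002:ℝ))
  rw [← hDd, hx2] at hfl
  have hxD : x ≤ D := by nlinarith
  refine ⟨?_, ?_, ?_⟩
  · have : (1:ℝ) ≤ D := by linarith
    exact_mod_cast this
  · rw [hDd]; exact Nat.floor_le (by positivity)
  · have := Real.log_le_log hx0 hxD
    rwa [hx, Real.log_rpow hN0] at this

lemma nu_fourier {φ φ2 : ℝ → ℝ} {y1 C : ℝ} (H : PhiOK φ φ2 y1 C) (D m b N : ℕ) (hD : 1 ≤ D) (hm : y1 ≤ m) (hb : b ≤ m)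
    (hN : 1 ≤ N) (hmN : 5 * (m:ℝ) ≤ (N:ℝ) ^ (0.005:ℝ)) (hCN : C ≤ (N:ℝ) ^ (0.005:ℝ))
    (K : ℝ) (hK : 0 ≤ K) (s : ℕ → ℝ) (Sb T0 : ℝ) (hs : ∀ n, 0 ≤ s n) (hsb : ∑ n ∈ Finset.range N, s n ≤ Sb) (ξ : ℕ)
    (hT0 : ‖∑ n ∈ Finset.range N, ((‖Lam D m (m * n + b)‖ ^ 2 : ℝ) : ℂ) * e (-((ξ:ℝ) * n / N))‖ ≤ T0) :
    ‖fourierZN N (fun n => K * (‖Lam D m (m * n + b)‖ ^ 2 * GG φ (Jf φ m) m b n) + s n) ξ‖ ≤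
      K * (T0 + (Nat.log 2 N + 1) * ((D:ℝ) ^ 2 * ((N:ℝ) ^ (0.075:ℝ) * (50 * (N:ℝ) ^ (0.88:ℝ))))) + Sb := by
  have hT1 := T1_bound H D m b N hD hm hb hN hmN (Jf φ m) (fun i => le_max_left _ _)
    (fun i hi => Jf_bound H m N i hm hN hmN hCN hi) ξ
  have heq : fourierZN N (fun n => K * (‖Lam D m (m * n + b)‖ ^ 2 * GG φ (Jf φ m) m b n) + s n) ξ =
      (K:ℂ) * (∑ n ∈ Finset.range N, ((‖Lam D m (m * n + b)‖ ^ 2 : ℝ) : ℂ) * e (-((ξ:ℝ) * n / N)) +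
        ∑ n ∈ Finset.range N, ((‖Lam D m (m * n + b)‖ ^ 2 : ℝ) : ℂ) *
      ((((GG φ (Jf φ m) m b n : ℝ) : ℂ) - 1) * e (-((ξ:ℝ) * n / N)))) + ∑ n ∈ Finset.range N, (s n : ℂ) * e (-((ξ:ℝ) * n / N)) := by
    unfold fourierZN
    rw [← Finset.sum_add_distrib, Finset.mul_sum, ← Finset.sum_add_distrib]
    apply Finset.sum_congr rfl
    intro n _
    push_cast; ring
  rw [heq]
  have h3 : ‖∑ n ∈ Finset.range N, (s n : ℂ) * e (-((ξ:ℝ) * n / N))‖ ≤ Sb := by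
    refine (norm_sum_le _ _).trans (le_trans (Finset.sum_le_sum ?_) hsb)
    intro n _
    rw [norm_mul, norm_e, mul_one, Complex.norm_real, Real.norm_eq_abs, abs_of_nonneg (hs n)]
  refine (norm_add_le _ _).trans (add_le_add ?_ h3)
  rw [norm_mul, Complex.norm_real, Real.norm_eq_abs, abs_of_nonneg hK]
  exact mul_le_mul_of_nonneg_left ((norm_add_le _ _).trans (add_le_add hT0 hT1)) hK

lemma lam_facts {c : ℝ} (F : Fc c) {φ φ2 : ℝ → ℝ} {y1 C : ℝ} (H : PhiOK φ φ2 y1 C)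
    (hPS : ∀ y k : ℕ, y1 ≤ y → F.x₀ ≤ k → (y:ℤ) = ⌊F.toFun k⌋ → φ y ≤ k ∧ (k:ℝ) < φ (y + 1))
    (D m b N n : ℕ) (hD : 1 ≤ D) (hm : y1 ≤ m) (hb : b ≤ m)
    (hN : 2 ≤ N) (hmN : 5 * (m:ℝ) ≤ (N:ℝ) ^ (0.005:ℝ)) (hn1 : 1 ≤ n) (hn2 : n ≤ N / 2) :
    0 ≤ lamh F φ b m N n ∧ lamh F φ b m N n ≤ 4 * Real.log N / N * ((N:ℝ) ^ (1.005:ℝ)) ^ ((1:ℝ)/16) ∧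
    (D < n → lamh F φ b m N n ≤ (2048 * ((Nat.totient m : ℝ) / m) * Real.log N / N) * (‖Lam D m (m * n + b)‖ ^ 2 * GG φ (Jf φ m) m b n)) := by
  have hN2 : (2:ℝ) ≤ N := by exact_mod_cast hN
  have hN0 : (0:ℝ) < N := by linarith
  have hlogN : 0 ≤ Real.log N := Real.log_nonneg (by linarith)
  have hm1 : (1:ℝ) ≤ m := H.y1_ge.trans hm
  have hG := GG_nonneg φ (Jf φ m) m b n
  unfold lamh
  split_ifs with hmem
  · obtain ⟨_, hprime, k, hk0, hk⟩ := hmem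
    obtain ⟨y, hy⟩ : ∃ y : ℕ, y = m * n + b := ⟨_, rfl⟩
    have hcast : (m:ℝ) * n + b = (y:ℝ) := by rw [hy]; push_cast; ring
    rw [hcast, ← hy]
    rw [← hy] at hprime hk
    have hn1' : (1:ℝ) ≤ n := by exact_mod_cast hn1
    have hb' : (b:ℝ) ≤ m := by exact_mod_cast hb
    have hnN : (n:ℝ) + 1 ≤ N := by exact_mod_cast (by omega : n + 1 ≤ N)
    have hmy : (m:ℝ) ≤ y := by
      rw [← hcast]
      have := le_mul_of_one_le_right (show (0:ℝ) ≤ m by linarith) hn1'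
      have : (0:ℝ) ≤ b := by positivity
      linarith
    have hyy : y1 ≤ (y:ℝ) := by linarith
    have hymN : (y:ℝ) ≤ m * N := by
      rw [← hcast]
      have : (m:ℝ) * (n + 1) ≤ m * N := by gcongr
      linarith
    have hyN : (y:ℝ) ≤ (N:ℝ) ^ (1.005:ℝ) := by
      calc (y:ℝ) ≤ m * N := hymN
        _ ≤ (N:ℝ) ^ (0.005:ℝ) * N := by gcongr; linarith
        _ = (N:ℝ) ^ (1.005:ℝ) := by
          nth_rewrite 2 [← Real.rpow_one (N:ℝ)]; rw [← Real.rpow_add hN0]; norm_num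
    have hy0 : (1:ℝ) ≤ y := by linarith
    have hlogy : Real.log y ≤ 2 * Real.log N := by
      have h1 := Real.log_le_log (by linarith) hyN
      rw [Real.log_rpow hN0] at h1
      refine h1.trans ?_
      gcongr; norm_num
    have hlogy0 : 0 ≤ Real.log y := Real.log_nonneg hy0
    obtain ⟨g1, _, _, _, _, g2⟩ := H.main _ hyy
    obtain ⟨t, ht⟩ : ∃ t : ℝ, t = (Nat.totient m : ℝ) / m := ⟨_, rfl⟩
    have ht0 : 0 ≤ t := by rw [ht]; positivity
    have ht1 : t ≤ 1 := by
      rw [ht]; apply div_le_one_of_le₀ _ (by positivity)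
      exact_mod_cast Nat.totient_le m
    have heq : (Nat.totient m : ℝ) * Real.log y / (m * N * deriv φ y) = t * Real.log y / N * (deriv φ y)⁻¹ := by
      rw [ht]; field_simp
    rw [heq, ← ht]
    have hinv : 0 ≤ (deriv φ y)⁻¹ := by positivity
    refine ⟨by positivity, ?_, ?_⟩
    · calc t * Real.log y / N * (deriv φ y)⁻¹ ≤ 1 * (2 * Real.log N) / N * (2 * ((N:ℝ) ^ (1.005:ℝ)) ^ ((1:ℝ)/16)) := by
            gcongr
            refine g2.trans ?_
            gcongr
        _ = _ := by ring
    · intro hDn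
      have hLam : Lam D m y = 1 := by
        apply Lam_eq_one hD
        intro l hl
        have hl' := (mem_SL.mp hl).1
        have hyn : n ≤ y := by
          have hm1n : 1 ≤ m := by exact_mod_cast hm1
          rw [hy]; nlinarith
        exact (Nat.coprime_of_lt_prime (by omega) (by omega) hprime).symm
      rw [hLam]
      obtain ⟨hk1, hk2⟩ := hPS y k hyy hk0 hk
      rw [hy] at hk1 hk2
      have hlow := GG_lower H m b n k hm hb hn1 hk1 hk2
      rw [← hy] at hlow
      calc t * Real.log y / N * (deriv φ y)⁻¹ ≤ t * (2 * Real.log N) / N * (1024 * GG φ (Jf φ m) m b n) := by gcongr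
        _ = _ := by simp; ring
  · exact ⟨le_rfl, by positivity, fun _ => by positivity⟩

lemma core {c : ℝ} (F : Fc c) {φ φ2 : ℝ → ℝ} {y1 C : ℝ} (H : PhiOK φ φ2 y1 C)
    (hPS : ∀ y k : ℕ, y1 ≤ y → F.x₀ ≤ k → (y:ℤ) = ⌊F.toFun k⌋ → φ y ≤ k ∧ (k:ℝ) < φ (y + 1))
    (m b N W : ℕ) (hm : y1 ≤ m) (hb : b ≤ m) (hN : 2 ≤ N) (hl : 1 ≤ Real.log N)
    (hL : 5 * Real.log N ≤ (N:ℝ) ^ (0.005:ℝ)) (hCN : C ≤ (N:ℝ) ^ (0.005:ℝ)) (h6 : (10:ℝ) ^ 6 ≤ (N:ℝ) ^ (0.005:ℝ))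
    (hmlog : (m:ℝ) ≤ Real.log N) (hW : 1 ≤ W) (hWN : (W:ℝ) ≤ Real.log N) (hsq : Squarefree m)
    (hWm : ∀ p : ℕ, p.Prime → ¬ p ∣ m → W < p)
    (A : Finset ℕ) (hA : A ⊆ Finset.Icc 1 (N / 2)) (a : ℕ → ℝ) (ha : ∀ n, a n = if n ∈ A then lamh F φ b m N n else 0)
    (B : Finset ℕ) (hBN : B ⊆ Finset.range N) (hBc : (N:ℝ) / W ≤ B.card)
    (β : ℕ → ℝ) (hβ : ∀ n, β n = if n ∈ B then ((B.card : ℝ))⁻¹ else 0) (x : ℕ) :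
    |convZN N (convZN N a β) β x| ≤ 20000000 / N := by
  have hN1 : 1 ≤ N := by omega
  have hN0 : (0:ℝ) < N := by exact_mod_cast hN1
  have hW0 : (0:ℝ) < W := by exact_mod_cast hW
  have hmN : 5 * (m:ℝ) ≤ (N:ℝ) ^ (0.005:ℝ) := by linarith
  have hm1 : (1:ℝ) ≤ m := H.y1_ge.trans hm
  obtain ⟨D, hDd⟩ : ∃ D, D = ⌊(N:ℝ) ^ (0.002:ℝ)⌋₊ := ⟨_, rfl⟩
  obtain ⟨hD, hDu, hDl⟩ := log_D N D hN1 hDd h6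
  obtain ⟨t, ht⟩ : ∃ t : ℝ, t = (Nat.totient m : ℝ) / m := ⟨_, rfl⟩
  have htot : (0:ℝ) < Nat.totient m := by
    have : 0 < m := by
      have : (0:ℝ) < m := by linarith
      exact_mod_cast this
    exact_mod_cast Nat.totient_pos.mpr this
  have ht0 : 0 < t := by rw [ht]; positivity
  have ht1 : t ≤ 1 := by
    rw [ht]; apply div_le_one_of_le₀ _ (by positivity)
    exact_mod_cast Nat.totient_le m
  obtain ⟨K, hK⟩ : ∃ K : ℝ, K = 2048 * t * Real.log N / N := ⟨_, rfl⟩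
  have hK0 : 0 ≤ K := by rw [hK]; positivity
  have hKle : K ≤ 2048 * Real.log N / N := by
    rw [hK]; gcongr
    nlinarith
  have hfacts : ∀ n ∈ A, _ := fun n hn => lam_facts F H hPS D m b N n hD hm hb hN hmN
    (Finset.mem_Icc.mp (hA hn)).1 (Finset.mem_Icc.mp (hA hn)).2
  rw [← ht, ← hK] at hfacts
  obtain ⟨M, hM⟩ : ∃ M : ℝ, M = 4 * Real.log N / N * ((N:ℝ) ^ (1.005:ℝ)) ^ ((1:ℝ)/16) := ⟨_, rfl⟩
  have hM0 : 0 ≤ M := by rw [hM]; positivity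
  rw [← hM] at hfacts
  have ha0 : ∀ n, 0 ≤ a n := by
    intro n; rw [ha]; split_ifs with h
    · exact (hfacts n h).1
    · exact le_rfl
  have haM : ∀ n, a n ≤ M := by
    intro n; rw [ha]; split_ifs with h
    · exact (hfacts n h).2.1
    · exact hM0
  obtain ⟨s, hs⟩ : ∃ s : ℕ → ℝ, s = fun n => if n ≤ D then a n else 0 := ⟨_, rfl⟩
  have hs0 : ∀ n, 0 ≤ s n := by
    intro n; rw [hs]; dsimp only; split_ifs
    · exact ha0 n
    · exact le_rfl
  have hsb : ∑ n ∈ Finset.range N, s n ≤ (D + 1) * M := by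
    rw [hs, ← Finset.sum_filter]
    calc _ ≤ ∑ n ∈ Finset.range (D + 1), a n := by
          apply Finset.sum_le_sum_of_subset_of_nonneg
          · intro n hn
            rw [Finset.mem_filter] at hn
            rw [Finset.mem_range]; omega
          · intro n _ _; exact ha0 n
      _ ≤ ∑ n ∈ Finset.range (D + 1), M := Finset.sum_le_sum (fun n _ => haM n)
      _ = _ := by simp
  have haν : ∀ n < N, a n ≤ (fun n => K * (‖Lam D m (m * n + b)‖ ^ 2 * GG φ (Jf φ m) m b n) + s n) n := by
    intro n _
    have hG := GG_nonneg φ (Jf φ m) m b n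
    dsimp only
    by_cases hnD : n ≤ D
    · have : s n = a n := by rw [hs]; dsimp only; rw [if_pos hnD]
      rw [this]
      have : 0 ≤ K * (‖Lam D m (m * n + b)‖ ^ 2 * GG φ (Jf φ m) m b n) := by positivity
      linarith
    · have h1 := hs0 n
      by_cases hnA : n ∈ A
      · have := (hfacts n hnA).2.2 (by omega)
        rw [ha, if_pos hnA]; linarith
      · rw [ha, if_neg hnA]; positivity
  obtain ⟨T1, hT1⟩ : ∃ T1 : ℝ, T1 = (Nat.log 2 N + 1) * ((D:ℝ) ^ 2 * ((N:ℝ) ^ (0.075:ℝ) * (50 * (N:ℝ) ^ (0.88:ℝ)))) := ⟨_, rfl⟩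
  have hT10 : 0 ≤ T1 := by rw [hT1]; positivity
  have herr := err_small N W D hN1 hW hl hL h6 hWN hDu
  rw [← hT1, ← hM] at herr
  have herr2 : K * ((D:ℝ)^6 + T1) + (D + 1) * M ≤ 1 / W := by
    refine le_trans ?_ herr
    gcongr
  have hGS := GS_lower (D := D) hsq
  have hGS1 := one_le_GS (m := m) hD
  obtain ⟨G, hG⟩ : ∃ G, G = GS D m := ⟨_, rfl⟩
  rw [← hG] at hGS hGS1
  have hKG : K * (N / G) ≤ 4096000 := by
    have h1 : 0.001 * Real.log N * t ≤ 2 * G := by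
      have h2 : 0.001 * Real.log N ≤ 2 * (m / Nat.totient m) * G := hDl.trans hGS
      calc 0.001 * Real.log N * t ≤ 2 * (m / Nat.totient m) * G * t := by gcongr
        _ = 2 * G := by rw [ht]; field_simp
    have : K * (N / G) = 2048 * (t * Real.log N) / G := by rw [hK]; field_simp
    rw [this, div_le_iff₀ (by linarith)]
    linarith
  have hF0 := nu_fourier H D m b N hD hm hb hN1 hmN hCN K hK0 s _ _ hs0 hsb 0 (T0_zero D m b N hD)
  have hF1 : ∀ ξ, 0 < ξ → ξ < N → _ := fun ξ h0 h1 =>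
    nu_fourier H D m b N hD hm hb hN1 hmN hCN K hK0 s _ _ hs0 hsb ξ (T0_ne D m b N W ξ hD hW hWm h0 h1)
  rw [← hT1, ← hG] at hF0 hF1
  have hW1 : 1 / (W:ℝ) ≤ 1 := by
    rw [div_le_one hW0]; exact_mod_cast hW
  have hC0 : ‖fourierZN N (fun n => K * (‖Lam D m (m * n + b)‖ ^ 2 * GG φ (Jf φ m) m b n) + s n) 0‖ ≤ 4096001 := by
    refine hF0.trans ?_
    have : K * (N / G + (D:ℝ) ^ 6 + T1) + (D + 1) * M = K * (N / G) + (K * ((D:ℝ)^6 + T1) + (D + 1) * M) := by ring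
    rw [this]; linarith
  have hC1 : ∀ ξ, 0 < ξ → ξ < N → ‖fourierZN N (fun n => K * (‖Lam D m (m * n + b)‖ ^ 2 * GG φ (Jf φ m) m b n) + s n) ξ‖ ≤ 12288001 / W := by
    intro ξ h0 h1
    refine (hF1 ξ h0 h1).trans ?_
    have : K * (N * (3 / (W * G)) + (D:ℝ) ^ 6 + T1) + (D + 1) * M = (K * (N / G)) * (3 / W) + (K * ((D:ℝ)^6 + T1) + (D + 1) * M) := by
      field_simp; ring
    rw [this]
    calc _ ≤ 4096000 * (3 / (W:ℝ)) + 1 / W := by gcongr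
      _ = _ := by ring
  have hBpos : (0:ℝ) < B.card := lt_of_lt_of_le (by positivity) hBc
  have hBne : B.Nonempty := by
    rw [← Finset.card_pos]; exact_mod_cast hBpos
  have hfin := conv_bound N (by omega) a _ β B hBN hBne hβ ha0 haν _ _ hC0 hC1 (by positivity) x
  refine hfin.trans ?_
  have : (12288001:ℝ) / W / B.card ≤ 12288001 / N := by
    rw [div_div]
    apply div_le_div_of_nonneg_left (by norm_num) hN0
    rw [div_le_iff₀ hW0] at hBc; linarith
  calc (4096001:ℝ) / N + 12288001 / W / B.card ≤ 4096001 / N + 12288001 / N := by gcongr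
    _ = 16384002 / N := by ring
    _ ≤ _ := by gcongr; norm_num

/-- **Lemma 5.4 of the paper.** With `a = 1_A λ^h_{b,m,N}`,
`R = {ξ : |F_{ℤ_N}[a](ξ)| ≥ δ}`, `B` the Bohr `ε`-neighbourhood of `R`,
`β = |B|⁻¹ 1_B` and `a₁ = a * β * β`: if `ε^|R| ≥ log log W / W`, then for
sufficiently large `N` there holds `‖a₁‖_{ℓ^∞(ℤ_N)} ≤ C_φ / N` with a constant
`C_φ ≥ 2` depending only on `h`. -/
theorem linfty_bound_smoothed_measure {c : ℝ} (hc₁ : 1 ≤ c) (hc₂ : c < 16 / 15) (F : Fc c)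
    (φ : ℝ → ℝ) (hφ₁ : ∀ x ≥ F.x₀, φ (F.toFun x) = x)
    (hφ₂ : ∀ y ≥ F.toFun F.x₀, F.toFun (φ y) = y)
    (hφ₃ : ∀ y ≥ F.toFun F.x₀, F.x₀ ≤ φ y) :
    ∃ C : ℝ, 2 ≤ C ∧ ∃ N₀ : ℕ, ∀ N : ℕ, N.Prime → N₀ ≤ N →
      ∀ W : ℕ, (1 / 8 : ℝ) * Real.log (Real.log N) ≤ W →
        (W : ℝ) ≤ (1 / 2 : ℝ) * Real.log (Real.log N) →
      ∀ b : ℕ, b ≤ primorial W - 1 → Nat.gcd b (primorial W) = 1 →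
      ∀ A : Finset ℕ, A ⊆ Finset.Icc 1 (N / 2) →
      ∀ δ ε : ℝ, δ ∈ Set.Ioo (0 : ℝ) 1 → ε ∈ Set.Ioo (0 : ℝ) 1 →
      ∀ a : ℕ → ℝ, (∀ n, a n = if n ∈ A then lamh F φ b (primorial W) N n else 0) →
      ∀ R : Finset ℕ, R = (Finset.range N).filter (fun ξ => δ ≤ ‖fourierZN N a ξ‖) →
      ∀ B : Finset ℕ,
        B = (Finset.range N).filter (fun x : ℕ => ∀ ξ ∈ R, nint ((x : ℝ) * ξ / N) ≤ ε) →
      ∀ β : ℕ → ℝ, (∀ n, β n = if n ∈ B then ((B.card : ℝ))⁻¹ else 0) →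
      Real.log (Real.log W) / W ≤ ε ^ R.card →
      ∀ x : ℕ, x < N → |convZN N (convZN N a β) β x| ≤ C / N := by
  obtain ⟨y1, hy1, C, hC, φ2, hmain, hdbl, hPS⟩ := phi_facts hc₁ hc₂ F φ hφ₁ hφ₂ hφ₃
  have H : PhiOK φ φ2 y1 C := ⟨hy1, hC, hmain, hdbl⟩
  obtain ⟨p, hpy, hp⟩ := Nat.exists_infinite_primes ⌈y1⌉₊
  obtain ⟨Z, hZ⟩ : ∃ Z : ℝ, Z = p + Real.exp (Real.exp 1) := ⟨_, rfl⟩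
  have tN : Tendsto (fun N : ℕ => (N:ℝ)) atTop atTop := tendsto_natCast_atTop_atTop
  have tl : Tendsto (fun N : ℕ => Real.log N) atTop atTop := Real.tendsto_log_atTop.comp tN
  have tll : Tendsto (fun N : ℕ => Real.log (Real.log N)) atTop atTop := Real.tendsto_log_atTop.comp tl
  have tp : Tendsto (fun N : ℕ => (N:ℝ) ^ (0.005:ℝ)) atTop atTop := (tendsto_rpow_atTop (by norm_num)).comp tN
  have e1 : ∀ᶠ N : ℕ in atTop, 5 * Real.log N ≤ (N:ℝ) ^ (0.005:ℝ) := by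
    have h := (isLittleO_log_rpow_atTop (r := (0.005:ℝ)) (by norm_num)).bound (show (0:ℝ) < 1/5 by norm_num)
    filter_upwards [tN.eventually h, tl.eventually_ge_atTop 0] with N hN hl
    rw [Real.norm_of_nonneg hl, Real.norm_of_nonneg (by positivity)] at hN
    linarith
  have hev := (((e1.and (tl.eventually_ge_atTop 1)).and ((tll.eventually_ge_atTop (8 * Z)).and (tp.eventually_ge_atTop C))).and
    (tp.eventually_ge_atTop ((10:ℝ)^6)))
  obtain ⟨N₀, hN₀⟩ := eventually_atTop.mp hev
  refine ⟨20000000, by norm_num, N₀, ?_⟩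
  intro N hNp hNN W hW1 hW2 b hb hgcd A hA δ ε hδ hε a ha R hR B hB β hβ hεR x hx
  obtain ⟨⟨⟨g1, g2⟩, g3, g4⟩, g5⟩ := hN₀ N hNN
  have hWZ : Z ≤ W := by linarith
  have hexp0 : 0 < Real.exp (Real.exp 1) := Real.exp_pos _
  have hpW : p ≤ W := by
    have : (p:ℝ) ≤ W := by linarith
    exact_mod_cast this
  have hpp : 1 ≤ p := hp.one_lt.le
  have hWe : Real.exp (Real.exp 1) ≤ W := by
    have : (0:ℝ) ≤ p := by positivity
    linarith
  have hW0 : (0:ℝ) < W := lt_of_lt_of_le hexp0 hWe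
  have hllW : 1 ≤ Real.log (Real.log W) := by
    have h1 : Real.exp 1 ≤ Real.log W := by rw [Real.le_log_iff_exp_le hW0]; exact hWe
    rw [Real.le_log_iff_exp_le (lt_of_lt_of_le (Real.exp_pos _) h1)]; exact h1
  have hm : y1 ≤ (primorial W : ℕ) := by
    have hdvd : p ∣ primorial W := by
      by_contra h
      have := primorial_big W p hp h
      omega
    have h1 : p ≤ primorial W := Nat.le_of_dvd (primorial_pos W) hdvd
    calc y1 ≤ (⌈y1⌉₊ : ℝ) := Nat.le_ceil _
      _ ≤ (primorial W : ℕ) := by exact_mod_cast hpy.trans h1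
  have hlog0 : 0 < Real.log N := by linarith
  have hmlog : ((primorial W : ℕ) : ℝ) ≤ Real.log N := by
    have h1 : ((primorial W : ℕ) : ℝ) ≤ 4 ^ W := by exact_mod_cast primorial_le_four_pow W
    have h4 : (4:ℝ) ^ W = Real.exp (W * Real.log 4) := by
      rw [mul_comm, Real.exp_mul, Real.exp_log (by norm_num), Real.rpow_natCast]
    have hl4 : Real.log 4 ≤ 2 := by
      have : (4:ℝ) = 2 ^ 2 := by norm_num
      rw [this, Real.log_pow]
      have := Real.log_two_lt_d9
      push_cast; linarith
    have h5 : (W:ℝ) * Real.log 4 ≤ Real.log (Real.log N) := by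
      calc (W:ℝ) * Real.log 4 ≤ W * 2 := by gcongr
        _ ≤ _ := by linarith
    calc _ ≤ (4:ℝ) ^ W := h1
      _ = Real.exp (W * Real.log 4) := h4
      _ ≤ Real.exp (Real.log (Real.log N)) := Real.exp_le_exp.mpr h5
      _ = _ := Real.exp_log hlog0
  have hWN : (W:ℝ) ≤ Real.log N := by
    have := Real.log_le_sub_one_of_pos hlog0
    linarith
  have hNpos : (0:ℝ) < N := by exact_mod_cast hNp.pos
  have hBc : (N:ℝ) / W ≤ B.card := by
    have h1 := bohr_card N hNp.pos R ε hε.1 hε.2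
    rw [← hB] at h1
    refine le_trans ?_ h1
    rw [div_eq_mul_one_div]
    have h2 : 1 / (W:ℝ) ≤ ε ^ R.card := le_trans (by gcongr) hεR
    gcongr
  exact core F H hPS (primorial W) b N W hm (by omega) hNp.two_le g2 g1 g4 g5 hmlog (by omega) hWN (primorial_sqf W)
    (fun q hq hqd => primorial_big W q hq hqd) A hA a ha B (by rw [hB]; exact Finset.filter_subset _ _) hBc β hβ x
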